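/- Let α ∈ (0, 1/4] and γ = 2α/(1−2α). Suppose ω = Σ_{n=1}^N θ_n χ_{Ω_n(t)} is a patch solution to the g-SQG equation on ℝ² on [0,T) with T < ∞ and sup_{t∈[0,T)} ‖Ω(t)‖_{C^{1,γ}} < ∞. Then there is a constant C < ∞ such that for every t ∈ [0,T), sup_{(n,ξ)≠(j,η)} (|n−j| + |ξ−η|) / |z_n(ξ,t) − z_j(η,t)| ≤ C e^{Ct}; in particular, boundaries of distinct patches and folds of the same patch boundary can approach each other at most exponentially quickly in time. -/

import Mathlib

open Real Set Filter MeasureTheory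

noncomputable section

abbrev R2 : Type := EuclideanSpace ℝ (Fin 2)

def mk2 (a b : ℝ) : R2 := (EuclideanSpace.equiv (Fin 2) ℝ).symm ![a, b]

/-- Counterclockwise rotation by 90°: `(v₁,v₂)^⊥ = (−v₂,v₁)`. -/
def perp (v : R2) : R2 := mk2 (-(v 1)) (v 0)

/-- The g-SQG Biot–Savart kernel `w ↦ w^⊥/|w|^{2+2α}`. -/
def kern (α : ℝ) (w : R2) : R2 := (‖w‖ ^ (2 + 2 * α))⁻¹ • perp w

/-- The g-SQG velocity of `ω = Σ θₙ χ_{Ωₙ}`: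
`u(x) = c_α ∫_{ℝ²} (x−y)^⊥/|x−y|^{2+2α} ω(y) dy`. -/
def gSQGvel (α cα : ℝ) {N : ℕ} (θ : Fin N → ℝ) (Ω : Fin N → Set R2) (x : R2) : R2 :=
  cα • ∑ n, θ n • ∫ y in Ω n, kern α (x - y)

/-- The distance on the torus `𝕋 = ℝ/2πℤ` between (the classes of) two reals. -/
def distT (ξ η : ℝ) : ℝ := ⨅ k : ℤ, |ξ - η + 2 * π * k|


/-! ### Basic planar algebra -/

theorem inner2 (v w : R2) : inner ℝ v w = v 0 * w 0 + v 1 * w 1 := by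
  simp [PiLp.inner_apply, Fin.sum_univ_two, mul_comm]

theorem normsq2 (v : R2) : ‖v‖ ^ 2 = v 0 ^ 2 + v 1 ^ 2 := by
  rw [← real_inner_self_eq_norm_sq, inner2]; ring

theorem perp_0 (v : R2) : perp v 0 = -(v 1) := by simp [perp, mk2]

theorem perp_1 (v : R2) : perp v 1 = v 0 := by simp [perp, mk2]

theorem norm_perp (v : R2) : ‖perp v‖ = ‖v‖ := by
  have : ‖perp v‖ ^ 2 = ‖v‖ ^ 2 := by rw [normsq2, normsq2, perp_0, perp_1]; ring
  exact (sq_eq_sq₀ (norm_nonneg _) (norm_nonneg _)).1 this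

theorem ext2 {v w : R2} (h0 : v 0 = w 0) (h1 : v 1 = w 1) : v = w := by
  ext i; fin_cases i <;> assumption

theorem perp_add (v w : R2) : perp (v + w) = perp v + perp w := by
  apply ext2 <;> simp [perp_0, perp_1]; ring

theorem perp_smul (a : ℝ) (v : R2) : perp (a • v) = a • perp v := by
  apply ext2 <;> simp [perp_0, perp_1]

theorem perp_perp (v : R2) : perp (perp v) = -v := by
  apply ext2 <;> simp [perp_0, perp_1]

theorem inner_perp_self (v : R2) : inner ℝ (perp v) v = 0 := by
  rw [inner2, perp_0, perp_1]; ring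

theorem continuous_perp : Continuous perp := by
  have h : perp = fun v => WithLp.toLp 2 ![-(v 1), v 0] := by
    funext v; apply ext2 <;> simp [perp_0, perp_1]
  rw [h]
  refine (PiLp.continuous_toLp 2 _).comp ?_
  refine continuous_pi fun i => ?_
  fin_cases i <;> simp <;> fun_prop

/-- decomposition along a unit vector and its rotation -/
theorem decomp2 {e : R2} (he : ‖e‖ = 1) (v : R2) :
    v = inner ℝ e v • e + inner ℝ (perp e) v • perp e := by
  have h : e 0 ^ 2 + e 1 ^ 2 = 1 := by rw [← normsq2, he]; norm_num
  apply ext2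
  · simp [inner2, perp_0, perp_1]; linear_combination (-(v 0)) * h
  · simp [inner2, perp_0, perp_1]; linear_combination (-(v 1)) * h

theorem normsq_decomp {e : R2} (he : ‖e‖ = 1) (v : R2) :
    ‖v‖ ^ 2 = (inner ℝ e v) ^ 2 + (inner ℝ (perp e) v) ^ 2 := by
  have h : e 0 ^ 2 + e 1 ^ 2 = 1 := by rw [← normsq2, he]; norm_num
  simp only [normsq2, inner2, perp_0, perp_1]
  linear_combination (-(v 0 ^ 2 + v 1 ^ 2)) * h

theorem abs_inner_le (v w : R2) : |inner ℝ v w| ≤ ‖v‖ * ‖w‖ := abs_real_inner_le_norm v w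

theorem abs_inner_unit {e : R2} (he : ‖e‖ = 1) (w : R2) : |inner ℝ e w| ≤ ‖w‖ := by
  have := abs_inner_le e w; rwa [he, one_mul] at this

/-! ### Torus distance -/

theorem distT_le (ξ η : ℝ) (k : ℤ) : distT ξ η ≤ |ξ - η + 2 * π * k| :=
  ciInf_le ⟨0, by rintro _ ⟨k, rfl⟩; exact abs_nonneg _⟩ k

theorem distT_nonneg (ξ η : ℝ) : 0 ≤ distT ξ η := Real.iInf_nonneg fun _ => abs_nonneg _

theorem distT_attained (ξ η : ℝ) :
    ∃ k : ℤ, distT ξ η = |ξ - η + 2 * π * k| ∧ |ξ - η + 2 * π * k| ≤ π := by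
  have hp := Real.pi_pos
  set x := ξ - η with hx
  set m := round (x / (2 * π)) with hm
  have h1 := abs_sub_round (x / (2 * π))
  have h2 : |x - 2 * π * m| ≤ π := by
    have : x - 2 * π * m = (2 * π) * (x / (2 * π) - m) := by field_simp
    rw [this, abs_mul, abs_of_pos (by positivity)]
    nlinarith
  refine ⟨-m, ?_, by push_cast; rw [mul_neg, ← sub_eq_add_neg]; exact h2⟩
  apply le_antisymm (distT_le _ _ _)
  refine le_ciInf fun k => ?_
  have h3 := round_le (x / (2 * π)) (-k)
  have e1 : x + 2 * π * ((-m : ℤ) : ℝ) = (2 * π) * (x / (2 * π) - m) := by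
    push_cast; field_simp; ring
  have e2 : x + 2 * π * (k : ℝ) = (2 * π) * (x / (2 * π) - ((-k : ℤ) : ℝ)) := by
    push_cast; field_simp; ring
  rw [e1, e2, abs_mul (2 * π), abs_mul (2 * π), abs_of_pos (by positivity : (0:ℝ) < 2 * π)]
  exact mul_le_mul_of_nonneg_left h3 (by positivity)

theorem distT_le_pi (ξ η : ℝ) : distT ξ η ≤ π := by
  obtain ⟨k, h, h'⟩ := distT_attained ξ η; linarith

theorem distT_eq_abs {ξ η : ℝ} (h : |ξ - η| ≤ π) : distT ξ η = |ξ - η| := by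
  have hp := Real.pi_pos
  apply le_antisymm
  · simpa using distT_le ξ η 0
  · refine le_ciInf fun k => ?_
    rcases eq_or_ne k 0 with rfl | hk
    · simp
    · have : (1:ℝ) ≤ |(k:ℝ)| := by exact_mod_cast Int.one_le_abs hk
      have h2 : |2 * π * (k:ℝ)| ≤ |ξ - η + 2 * π * k| + |ξ - η| := by
        have := abs_sub (ξ - η + 2 * π * k) (ξ - η)
        rwa [add_sub_cancel_left] at this
      rw [abs_mul, abs_of_pos (by positivity : (0:ℝ) < 2 * π)] at h2
      nlinarith

theorem distT_lip (ξ η ξ' η' : ℝ) : distT ξ η ≤ distT ξ' η' + |ξ - ξ' - (η - η')| := by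
  obtain ⟨k, h, -⟩ := distT_attained ξ' η'
  rw [h]
  refine (distT_le ξ η k).trans ?_
  have := abs_add_le (ξ' - η' + 2 * π * k) (ξ - ξ' - (η - η'))
  rwa [show ξ' - η' + 2 * π * k + (ξ - ξ' - (η - η')) = ξ - η + 2 * π * k by ring] at this

/-! ### Closed curves with Hölder tangent -/

structure Crv (γ M c : ℝ) (p p' : ℝ → R2) : Prop where
  der : ∀ ξ, HasDerivAt p (p' ξ) ξ
  per : ∀ ξ, p (ξ + 2 * π) = p ξ
  speed : ∀ ξ, ‖p' ξ‖ = c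
  bd : ∀ ξ, ‖p ξ‖ ≤ M
  spM : c ≤ M
  hol : ∀ ξ η, ‖p' ξ - p' η‖ ≤ M * |ξ - η| ^ γ

def Smp (p : ℝ → R2) : Prop := ∀ ξ η, p ξ = p η → distT ξ η = 0

namespace Crv
variable {γ M c : ℝ} {p p' : ℝ → R2}

theorem cont (h : Crv γ M c p p') : Continuous p :=
  continuous_iff_continuousAt.2 fun ξ => (h.der ξ).continuousAt

theorem c_nonneg (h : Crv γ M c p p') : 0 ≤ c := by rw [← h.speed 0]; positivity

theorem M_nonneg (h : Crv γ M c p p') : 0 ≤ M := h.c_nonneg.trans h.spM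

theorem perk (h : Crv γ M c p p') (ξ : ℝ) (k : ℤ) : p (ξ + 2 * π * k) = p ξ := by
  have : Function.Periodic p (2 * π) := h.per
  have := this.int_mul k ξ
  rwa [mul_comm (k:ℝ)] at this

theorem per' (h : Crv γ M c p p') (ξ : ℝ) : p' (ξ + 2 * π) = p' ξ := by
  have h1 := (h.der (ξ + 2 * π)).comp_add_const ξ (2 * π)
  have h2 : (fun x => p (x + 2 * π)) = p := funext h.per
  rw [h2] at h1
  exact h1.unique (h.der ξ)

theorem perk' (h : Crv γ M c p p') (ξ : ℝ) (k : ℤ) : p' (ξ + 2 * π * k) = p' ξ := by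
  have : Function.Periodic p' (2 * π) := h.per'
  have := this.int_mul k ξ
  rwa [mul_comm (k:ℝ)] at this

theorem cont' (h : Crv γ M c p p') (hγ : 0 < γ) : Continuous p' := by
  rw [continuous_iff_continuousAt]
  intro ξ
  rw [ContinuousAt, tendsto_iff_norm_sub_tendsto_zero]
  refine squeeze_zero (fun _ => norm_nonneg _) (fun η => h.hol η ξ) ?_
  have : Continuous fun η : ℝ => M * |η - ξ| ^ γ := by
    refine continuous_const.mul ?_
    exact Continuous.rpow_const (by fun_prop) fun _ => Or.inr hγ.le
  have h2 := this.tendsto ξ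
  simpa [Real.zero_rpow hγ.ne'] using h2

theorem lip (h : Crv γ M c p p') (ξ η : ℝ) : ‖p ξ - p η‖ ≤ M * |ξ - η| := by
  have := Convex.norm_image_sub_le_of_norm_hasDerivWithin_le (f := p) (f' := p') (C := M)
    (s := univ) (x := η) (y := ξ) (fun x _ => (h.der x).hasDerivWithinAt)
    (fun x _ => by rw [h.speed]; exact h.spM) convex_univ (mem_univ _) (mem_univ _)
  simpa [Real.norm_eq_abs] using this

theorem taylor (h : Crv γ M c p p') (hγ : 0 < γ) (ξ η : ℝ) :
    ‖p ξ - p η - (ξ - η) • p' η‖ ≤ M * |ξ - η| ^ (1 + γ) := by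
  rcases eq_or_ne ξ η with rfl | hne
  · simp [Real.zero_rpow (by linarith : 1 + γ ≠ 0)]
  have hpos : 0 < |ξ - η| := abs_pos.2 (sub_ne_zero.2 hne)
  have := Convex.norm_image_sub_le_of_norm_hasDerivWithin_le (f := fun s => p s - s • p' η)
    (f' := fun s => p' s - p' η) (C := M * |ξ - η| ^ γ)
    (s := uIcc η ξ) (x := η) (y := ξ)
    (fun x _ => by
      have := (h.der x).sub ((hasDerivAt_id x).smul_const (p' η))
      rw [one_smul] at this
      exact this.hasDerivWithinAt)
    (fun x hx => by
      refine (h.hol x η).trans ?_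
      refine mul_le_mul_of_nonneg_left ?_ h.M_nonneg
      refine Real.rpow_le_rpow (abs_nonneg _) ?_ hγ.le
      have := abs_sub_left_of_mem_uIcc hx
      exact this)
    (convex_uIcc η ξ) left_mem_uIcc right_mem_uIcc
  rw [Real.rpow_add hpos, Real.rpow_one]
  calc _ = ‖p ξ - ξ • p' η - (p η - η • p' η)‖ := by congr 1; rw [sub_smul]; abel
    _ ≤ _ := this
    _ = _ := by rw [Real.norm_eq_abs]; ring

theorem inner_taylor (h : Crv γ M c p p') (hγ : 0 < γ) {e : R2} (he : ‖e‖ = 1) (ξ η : ℝ) :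
    |inner ℝ e (p ξ - p η) - (ξ - η) * inner ℝ e (p' η)| ≤ M * |ξ - η| ^ (1 + γ) := by
  have := (abs_inner_unit he _).trans (h.taylor hγ ξ η)
  rwa [inner_sub_right, inner_smul_right] at this

theorem chord (h : Crv γ M c p p') (hγ : 0 < γ) {ξ η : ℝ} (hs : M * |ξ - η| ^ γ ≤ c / 2) :
    c / 2 * |ξ - η| ≤ ‖p ξ - p η‖ := by
  have h1 := h.taylor hγ ξ η
  have h2 : ‖(ξ - η) • p' η‖ = |ξ - η| * c := by rw [norm_smul, h.speed, Real.norm_eq_abs]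
  have h3 := norm_sub_norm_le ((ξ - η) • p' η) (p ξ - p η)
  rw [norm_sub_rev ((ξ - η) • p' η)] at h3
  have h4 : |ξ - η| ^ (1 + γ) = |ξ - η| * |ξ - η| ^ γ := by
    rcases eq_or_ne (|ξ - η|) 0 with h0 | h0
    · rw [h0, Real.zero_rpow (by linarith), zero_mul]
    · rw [Real.rpow_add (lt_of_le_of_ne (abs_nonneg _) h0.symm), Real.rpow_one]
  rw [h4] at h1
  have := abs_nonneg (ξ - η)
  nlinarith

/-- fixed-time arc-chord bound -/
theorem arcchord (h : Crv γ M c p p') (hγ : 0 < γ) (hc : 0 < c) (hs : Smp p) :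
    ∃ κ > 0, ∀ ξ η, κ * distT ξ η ≤ ‖p ξ - p η‖ := by
  have hM : 0 < M := hc.trans_le h.spM
  have hp := Real.pi_pos
  obtain ⟨ℓ, hℓ, hℓM⟩ : ∃ ℓ > 0, M * ℓ ^ γ ≤ c / 2 := by
    refine ⟨(c / 2 / M) ^ (1 / γ), by positivity, ?_⟩
    rw [← Real.rpow_mul (by positivity), one_div_mul_cancel hγ.ne', Real.rpow_one]
    field_simp; rfl
  have hcomp : IsCompact (Icc (0:ℝ) (2 * π) ×ˢ Icc ℓ π) := isCompact_Icc.prod isCompact_Icc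
  have hcont : ContinuousOn (fun a : ℝ × ℝ => ‖p (a.1 + a.2) - p a.1‖)
      (Icc (0:ℝ) (2 * π) ×ˢ Icc ℓ π) := by
    have := h.cont
    fun_prop
  obtain ⟨m, hm, hmin⟩ : ∃ m > 0, ∀ a ∈ Icc (0:ℝ) (2 * π) ×ˢ Icc ℓ π,
      m ≤ ‖p (a.1 + a.2) - p a.1‖ := by
    rcases (Icc (0:ℝ) (2 * π) ×ˢ Icc ℓ π).eq_empty_or_nonempty with he | hne
    · exact ⟨1, one_pos, by rw [he]; simp⟩
    · obtain ⟨a, ha, hmin⟩ := hcomp.exists_isMinOn hne hcont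
      refine ⟨_, ?_, fun b hb => hmin hb⟩
      show 0 < ‖p (a.1 + a.2) - p a.1‖
      rw [norm_pos_iff, sub_ne_zero]
      intro heq
      have h1 := hs _ _ heq
      have h2 : |a.1 + a.2 - a.1| = a.2 := by
        rw [add_sub_cancel_left, abs_of_pos (hℓ.trans_le ha.2.1)]
      rw [distT_eq_abs (by rw [h2]; exact ha.2.2), h2] at h1
      linarith [ha.2.1]
  have hpos : ∀ ξ s, s ∈ Icc ℓ π → m ≤ ‖p (ξ + s) - p ξ‖ := by
    intro ξ s hs'
    obtain ⟨k, hk⟩ : ∃ k : ℤ, ξ + 2 * π * k ∈ Icc 0 (2 * π) := by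
      refine ⟨-⌊ξ / (2 * π)⌋, ?_⟩
      have e : ξ + 2 * π * ((-⌊ξ / (2 * π)⌋ : ℤ) : ℝ) = 2 * π * Int.fract (ξ / (2 * π)) := by
        rw [Int.fract]; push_cast; field_simp; ring
      rw [e]
      have := Int.fract_nonneg (ξ / (2 * π)); have := (Int.fract_lt_one (ξ / (2 * π))).le
      constructor <;> nlinarith
    have := hmin (ξ + 2 * π * k, s) ⟨hk, hs'⟩
    simp only at this
    rwa [h.perk, add_right_comm, h.perk] at this
  refine ⟨min (c / 2) (m / π), lt_min (by positivity) (by positivity), fun ξ η => ?_⟩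
  obtain ⟨k, hk, hk'⟩ := distT_attained ξ η
  have e : ‖p ξ - p η‖ = ‖p (ξ + 2 * π * k) - p η‖ := by rw [h.perk]
  set ξ' := ξ + 2 * π * k with hξ'
  have e1 : ξ - η + 2 * π * k = ξ' - η := by rw [hξ']; ring
  rw [e1] at hk hk'
  rw [e, hk]
  rcases le_total (|ξ' - η|) ℓ with hle | hge
  · refine le_trans ?_ (h.chord hγ (le_trans ?_ hℓM))
    · exact mul_le_mul_of_nonneg_right (min_le_left _ _) (abs_nonneg _)
    · exact mul_le_mul_of_nonneg_left (Real.rpow_le_rpow (abs_nonneg _) hle hγ.le) hM.le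
  · have h1 : m ≤ ‖p ξ' - p η‖ := by
      rcases le_total 0 (ξ' - η) with h0 | h0
      · rw [abs_of_nonneg h0] at hge hk'
        have := hpos η (ξ' - η) ⟨hge, hk'⟩
        rwa [add_sub_cancel] at this
      · rw [abs_of_nonpos h0] at hge hk'
        have := hpos ξ' (-(ξ' - η)) ⟨hge, hk'⟩
        rw [norm_sub_rev]
        rwa [show ξ' + -(ξ' - η) = η by ring] at this
    calc _ ≤ m / π * π := mul_le_mul (min_le_right _ _) hk' (abs_nonneg _) (by positivity)
      _ = m := by field_simp
      _ ≤ _ := h1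

end Crv

/-! ### Sides of the boundary -/

theorem pre_sub {S U : Set R2} (hS : IsPreconnected S) (hU : IsOpen U)
    (hd : ∀ x ∈ S, x ∉ frontier U) {x : R2} (hx : x ∈ S) (hxU : x ∈ U) : S ⊆ U := by
  refine hS.subset_of_closure_inter_subset hU ⟨x, hx, hxU⟩ ?_
  rintro y ⟨hy, hyS⟩
  by_contra hyU
  refine hd y hyS ⟨hy, ?_⟩
  rwa [hU.interior_eq]

/-- a boundary domain: open, bounded, with frontier the curve. -/
structure Bdy (p : ℝ → R2) (Ω : Set R2) : Prop where
  op : IsOpen Ω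
  bdd : Bornology.IsBounded Ω
  fr : range p = frontier Ω

def coneS (p p' : ℝ → R2) (c ε : ℝ) (s k r : ℝ) : Set R2 :=
  {y | ‖y - p s‖ < r ∧ k * c * ‖y - p s‖ < ε * inner ℝ (perp (p' s)) (y - p s)}

theorem coneS_convex (p p' : ℝ → R2) {c ε s k r : ℝ} (hk : 0 ≤ k * c) :
    Convex ℝ (coneS p p' c ε s k r) := by
  intro y hy w hw a b ha hb hab
  obtain ⟨hy1, hy2⟩ := hy
  obtain ⟨hw1, hw2⟩ := hw
  have e : a • y + b • w - p s = a • (y - p s) + b • (w - p s) := by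
    have : p s = (a + b) • p s := by rw [hab, one_smul]
    nth_rewrite 1 [this]
    rw [add_smul, smul_sub, smul_sub]; abel
  have hn : ‖a • (y - p s) + b • (w - p s)‖ ≤ a * ‖y - p s‖ + b * ‖w - p s‖ := by
    refine (norm_add_le _ _).trans ?_
    rw [norm_smul, norm_smul, Real.norm_of_nonneg ha, Real.norm_of_nonneg hb]
  constructor
  · rw [e]
    refine hn.trans_lt ?_
    rcases ha.eq_or_lt with rfl | ha'
    · have : b = 1 := by linarith
      subst this; simpa using hw1
    · have : a * r + b * r = r := by rw [← add_mul, hab, one_mul]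
      linarith [mul_lt_mul_of_pos_left hy1 ha', mul_le_mul_of_nonneg_left hw1.le hb]
  · rw [e, inner_add_right, inner_smul_right, inner_smul_right]
    refine (mul_le_mul_of_nonneg_left hn hk).trans_lt ?_
    rcases ha.eq_or_lt with rfl | ha'
    · have : b = 1 := by linarith
      subst this; simpa using hw2
    · nlinarith [mul_lt_mul_of_pos_left hy2 ha', mul_le_mul_of_nonneg_left hw2.le hb]

namespace Crv
variable {γ M c : ℝ} {p p' : ℝ → R2} {Ω : Set R2}

/-- cones around the normal avoid the curve. -/
theorem cone_avoid (h : Crv γ M c p p') (hγ : 0 < γ) (hc : 0 < c) (hs : Smp p) {k : ℝ}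
    (hk : 0 < k) : ∃ r > 0, ∀ s ε, |ε| = 1 → ∀ y ∈ coneS p p' c ε s k r, y ∉ range p := by
  obtain ⟨κ, hκ, hac⟩ := h.arcchord hγ hc hs
  have hM : 0 < M := hc.trans_le h.spM
  set r := (k / M) ^ (1 / γ) * κ ^ (1 / γ) * κ with hr
  refine ⟨r, by positivity, ?_⟩
  rintro s ε hε y ⟨hy1, hy2⟩ ⟨s', rfl⟩
  have hd := hac s' s
  obtain ⟨j, hj, -⟩ := distT_attained s' s
  rw [← h.perk s' j] at hy1 hy2 hd
  rw [hj] at hd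
  have e1 : s' - s + 2 * π * j = (s' + 2 * π * j) - s := by ring
  rw [e1] at hd
  set σ := s' + 2 * π * j
  have ht := h.taylor hγ σ s
  set w := p σ - p s with hw
  have h1 : inner ℝ (perp (p' s)) w = inner ℝ (perp (p' s)) (w - (σ - s) • p' s) := by
    symm; rw [inner_sub_right, inner_smul_right, inner_perp_self]; ring
  have h2 : |inner ℝ (perp (p' s)) w| ≤ c * (M * |σ - s| ^ (1 + γ)) := by
    rw [h1]
    refine (abs_inner_le _ _).trans ?_
    rw [norm_perp, h.speed]
    exact mul_le_mul_of_nonneg_left ht hc.le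
  have h3 : ε * inner ℝ (perp (p' s)) w ≤ |inner ℝ (perp (p' s)) w| := by
    refine (le_abs_self _).trans ?_
    rw [abs_mul, hε, one_mul]
  have h4 : k * ‖w‖ < M * |σ - s| ^ (1 + γ) := by
    have : c * (k * ‖w‖) < c * (M * |σ - s| ^ (1 + γ)) := by nlinarith
    exact lt_of_mul_lt_mul_left this hc.le
  have hpos : 0 < |σ - s| := by
    rcases (abs_nonneg (σ - s)).eq_or_lt with h0 | h0
    · rw [← h0, Real.zero_rpow (by linarith)] at h4
      have := norm_nonneg w
      nlinarith
    · exact h0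
  rw [Real.rpow_add hpos, Real.rpow_one] at h4
  have h5 : k * κ < M * |σ - s| ^ γ := by
    have : |σ - s| * (k * κ) < |σ - s| * (M * |σ - s| ^ γ) := by
      nlinarith
    exact lt_of_mul_lt_mul_left this hpos.le
  have h6 : |σ - s| < (k / M) ^ (1 / γ) * κ ^ (1 / γ) := by
    have : κ * |σ - s| < κ * ((k / M) ^ (1 / γ) * κ ^ (1 / γ)) := by
      calc _ ≤ _ := hd
        _ < r := hy1
        _ = _ := by rw [hr]; ring
    exact lt_of_mul_lt_mul_left this hκ.le
  have h7 : |σ - s| ^ γ ≤ k / M * κ := by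
    refine (Real.rpow_le_rpow hpos.le h6.le hγ.le).trans ?_
    rw [← Real.mul_rpow (by positivity) hκ.le, ← Real.rpow_mul (by positivity),
      one_div_mul_cancel hγ.ne', Real.rpow_one]
  have h8 : M * (k / M * κ) = k * κ := by field_simp
  nlinarith [mul_le_mul_of_nonneg_left h7 hM.le]

/-- nearest point: the difference is normal. -/
theorem nearest (h : Crv γ M c p p') (y : R2) :
    ∃ s, (∀ s', ‖y - p s‖ ≤ ‖y - p s'‖) ∧ inner ℝ (p' s) (y - p s) = 0 := by
  have hp := Real.pi_pos
  have hcont : Continuous fun s => ‖y - p s‖ := by have := h.cont; fun_prop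
  obtain ⟨s, hs, hmin⟩ := (isCompact_Icc (a := (0:ℝ)) (b := 2 * π)).exists_isMinOn
    ⟨0, by constructor <;> positivity⟩ hcont.continuousOn
  have hglob : ∀ s', ‖y - p s‖ ≤ ‖y - p s'‖ := by
    intro s'
    have hper : Function.Periodic p (2 * π) := h.per
    obtain ⟨x, hx, hxe⟩ := hper.exists_mem_Ico₀ (by positivity) s'
    rw [hxe]
    exact hmin (Ico_subset_Icc_self hx)
  refine ⟨s, hglob, ?_⟩
  have hd : HasDerivAt (fun s => ‖y - p s‖ ^ 2) (2 * inner ℝ (y - p s) (-(p' s))) s :=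
    ((h.der s).const_sub y).norm_sq
  have hl : IsLocalMin (fun s => ‖y - p s‖ ^ 2) s :=
    Filter.Eventually.of_forall fun s' => pow_le_pow_left₀ (norm_nonneg _) (hglob s') 2
  have := hl.hasDerivAt_eq_zero hd
  rw [inner_neg_right, real_inner_comm] at this
  linarith

theorem side (h : Crv γ M c p p') (hγ : 0 < γ) (hc : 0 < c) (hs : Smp p) (hB : Bdy p Ω) :
    ∃ σ : ℝ, |σ| = 1 ∧ ∀ s v, 0 < σ * inner ℝ (perp (p' s)) v →
      (∀ᶠ r in nhdsWithin (0:ℝ) (Ioi 0), p s + r • v ∈ Ω) ∧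
      (∀ᶠ r in nhdsWithin (0:ℝ) (Ioi 0), p s - r • v ∉ Ω) := by
  obtain ⟨r, hr, hav⟩ := h.cone_avoid hγ hc hs (k := 1 / 2) (by norm_num)
  -- test points
  set T : ℝ → ℝ → R2 := fun ε s => p s + (r / 2 / c * ε) • perp (p' s) with hT
  have hTcone : ∀ ε, |ε| = 1 → ∀ s, T ε s ∈ coneS p p' c ε s (1 / 2) r := by
    intro ε hε s
    have hn : ‖(r / 2 / c * ε) • perp (p' s)‖ = r / 2 := by
      rw [norm_smul, norm_perp, h.speed, Real.norm_eq_abs, abs_mul, hε,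
        abs_of_pos (by positivity)]; field_simp
    have hε2 : ε * ε = 1 := by rw [← abs_mul_abs_self, hε]; norm_num
    have hi : inner ℝ (perp (p' s)) ((r / 2 / c * ε) • perp (p' s)) = r / 2 * c * ε := by
      rw [inner_smul_right, real_inner_self_eq_norm_sq, norm_perp, h.speed]; field_simp
    refine ⟨by simp only [hT]; rw [add_sub_cancel_left, hn]; linarith, ?_⟩
    simp only [hT]
    rw [add_sub_cancel_left, hn, hi]
    have : ε * (r / 2 * c * ε) = r / 2 * c := by linear_combination r / 2 * c * hε2
    rw [this]
    have : 0 < r * c := by positivity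
    nlinarith
  -- cones are in or out
  have hcone : ∀ ε, |ε| = 1 → ∀ s, ∀ k, 0 < k → ∀ r', (∀ y ∈ coneS p p' c ε s k r', y ∉ range p) →
      ∀ y ∈ coneS p p' c ε s k r', y ∈ Ω → coneS p p' c ε s k r' ⊆ Ω := by
    intro ε hε s k hk r' hd y hy hyΩ
    refine pre_sub (coneS_convex p p' (by positivity)).isPreconnected hB.op ?_ hy hyΩ
    intro x hx; rw [← hB.fr]; exact hd x hx
  have hTconst : ∀ ε, |ε| = 1 → ∀ s s', T ε s ∈ Ω → T ε s' ∈ Ω := by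
    intro ε hε s s' hin
    have hcont : Continuous (T ε) := by
      have h1 := h.cont
      have h2 : Continuous fun s => perp (p' s) := continuous_perp.comp (h.cont' hγ)
      simp only [hT]
      fun_prop
    have : range (T ε) ⊆ Ω := by
      refine pre_sub (isPreconnected_range hcont) hB.op ?_ (mem_range_self s) hin
      rintro _ ⟨s'', rfl⟩
      rw [← hB.fr]; exact hav s'' ε hε _ (hTcone ε hε s'')
    exact this (mem_range_self s')
  -- every point close to the curve is in a cone
  have hnear : ∀ y, y ∉ range p → ∀ s0, ‖y - p s0‖ < r → ∃ ε, |ε| = 1 ∧ (ε = 1 ∨ ε = -1) ∧ ∃ s,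
      y ∈ coneS p p' c ε s (1 / 2) r := by
    intro y hy s0 hs0
    obtain ⟨s, hmin, hort⟩ := h.nearest y
    have hlt : ‖y - p s‖ < r := (hmin s0).trans_lt hs0
    have hpos : 0 < ‖y - p s‖ := by
      rw [norm_pos_iff, sub_ne_zero]; rintro rfl; exact hy (mem_range_self s)
    have hdec : (inner ℝ (perp (p' s)) (y - p s)) ^ 2 = (c * ‖y - p s‖) ^ 2 := by
      have h1 := h.speed s
      have h2 : p' s 0 ^ 2 + p' s 1 ^ 2 = c ^ 2 := by rw [← normsq2, h1]
      rw [mul_pow, normsq2, ← h2]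
      rw [inner2] at hort
      rw [inner2, perp_0, perp_1]
      linear_combination (-(p' s 0 * (y - p s) 0 + p' s 1 * (y - p s) 1)) * hort
    rcases sq_eq_sq_iff_eq_or_eq_neg.1 hdec with he | he
    · refine ⟨1, by simp, Or.inl rfl, s, hlt, ?_⟩
      rw [he]; nlinarith [mul_pos hc hpos]
    · refine ⟨-1, by simp, Or.inr rfl, s, hlt, ?_⟩
      rw [he]; nlinarith [mul_pos hc hpos]
  have hin_of : ∀ ε, |ε| = 1 → (T ε 0 ∈ Ω) → ∀ s, coneS p p' c ε s (1 / 2) r ⊆ Ω := by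
    intro ε hε h0 s
    exact hcone ε hε s _ (by norm_num) r (hav s ε hε) _ (hTcone ε hε s) (hTconst ε hε 0 s h0)
  have hout_of : ∀ ε, |ε| = 1 → (T ε 0 ∉ Ω) → ∀ s, ∀ y ∈ coneS p p' c ε s (1 / 2) r, y ∉ Ω := by
    intro ε hε h0 s y hy hyΩ
    apply h0
    apply hTconst ε hε s 0
    exact hcone ε hε s _ (by norm_num) r (hav s ε hε) y hy hyΩ (hTcone ε hε s)
  have hfrdisj : ∀ y ∈ Ω, y ∉ range p := by
    intro y hy; rw [hB.fr, hB.op.frontier_eq]; exact fun hh => hh.2 hy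
  -- not both out
  have hone : T 1 0 ∈ Ω ∨ T (-1) 0 ∈ Ω := by
    by_contra hcon
    push Not at hcon
    have hcl : p 0 ∈ closure Ω := by
      have : p 0 ∈ frontier Ω := by rw [← hB.fr]; exact mem_range_self 0
      exact this.1
    obtain ⟨y, hyΩ, hy⟩ := Metric.mem_closure_iff.1 hcl r hr
    rw [dist_comm, dist_eq_norm] at hy
    obtain ⟨ε, hε, hε', s, hsc⟩ := hnear y (hfrdisj y hyΩ) 0 hy
    rcases hε' with rfl | rfl
    · exact hout_of 1 hε hcon.1 s y hsc hyΩ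
    · exact hout_of (-1) hε hcon.2 s y hsc hyΩ
  have htwo : ¬ (T 1 0 ∈ Ω ∧ T (-1) 0 ∈ Ω) := by
    rintro ⟨h1, h2⟩
    have hopen : IsOpen (closure Ω) := by
      rw [Metric.isOpen_iff]
      intro y hy
      by_cases hyΩ : y ∈ Ω
      · obtain ⟨ε, hε, hb⟩ := Metric.isOpen_iff.1 hB.op y hyΩ
        exact ⟨ε, hε, hb.trans subset_closure⟩
      · have hyfr : y ∈ frontier Ω := by rw [hB.op.frontier_eq]; exact ⟨hy, hyΩ⟩
        rw [← hB.fr] at hyfr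
        obtain ⟨s0, rfl⟩ := hyfr
        refine ⟨r, hr, fun w hw => ?_⟩
        rw [mem_ball_iff_norm] at hw
        by_cases hwr : w ∈ range p
        · rw [hB.fr] at hwr; exact hwr.1
        · obtain ⟨ε, hε, hε', s, hsc⟩ := hnear w hwr s0 hw
          apply subset_closure
          rcases hε' with rfl | rfl
          · exact hin_of 1 hε h1 s hsc
          · exact hin_of (-1) hε h2 s hsc
    have hclopen : IsClopen (closure Ω) := ⟨isClosed_closure, hopen⟩
    rcases isClopen_iff.1 hclopen with he | he
    · have := subset_closure h1; rw [he] at this; exact this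
    · have := hB.bdd.closure
      rw [he] at this
      exact NormedSpace.unbounded_univ ℝ R2 this
  -- final transfer to arbitrary transversal directions
  have hfin : ∀ ε, |ε| = 1 → ∀ s v, 0 < ε * inner ℝ (perp (p' s)) v → ∃ r' > (0:ℝ), ∀ ρ : ℝ, 0 < ρ → ρ < r' →
      (p s + ρ • v ∈ Ω ↔ T ε 0 ∈ Ω) := by
    intro ε hε s v hv
    have hvpos : 0 < ‖v‖ := by
      rw [norm_pos_iff]; rintro rfl; simp at hv
    set k := min (1 / 2) (ε * inner ℝ (perp (p' s)) v / (2 * c * ‖v‖)) with hk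
    have hkpos : 0 < k := lt_min (by norm_num) (by positivity)
    have hkle : k ≤ 1 / 2 := min_le_left _ _
    obtain ⟨r2, hr2, hav2⟩ := h.cone_avoid hγ hc hs hkpos
    have hmem : ∀ ρ, 0 < ρ → ρ < r2 / ‖v‖ → p s + ρ • v ∈ coneS p p' c ε s k r2 := by
      intro ρ hρ hρ'
      have hn : ‖ρ • v‖ = ρ * ‖v‖ := by rw [norm_smul, Real.norm_of_nonneg hρ.le]
      refine ⟨by rw [add_sub_cancel_left, hn]; rwa [lt_div_iff₀ hvpos] at hρ', ?_⟩
      rw [add_sub_cancel_left, hn, inner_smul_right]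
      have h1 : k * (2 * c * ‖v‖) ≤ ε * inner ℝ (perp (p' s)) v := by
        rw [← le_div_iff₀ (by positivity)]; exact min_le_right _ _
      have h2 : 0 < k * c * ‖v‖ := by positivity
      have h3 : k * c * ‖v‖ < ε * inner ℝ (perp (p' s)) v := by nlinarith
      nlinarith [mul_lt_mul_of_pos_left h3 hρ]
    -- common normal point
    set ρ0 := min (r / 2 / c) (r2 / 2 / c) with hρ0
    have hρ0pos : 0 < ρ0 := lt_min (by positivity) (by positivity)
    have hρr : ρ0 * c < r := by
      have : ρ0 ≤ r / 2 / c := min_le_left _ _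
      rw [le_div_iff₀ hc] at this; linarith
    have hρr2 : ρ0 * c < r2 := by
      have : ρ0 ≤ r2 / 2 / c := min_le_right _ _
      rw [le_div_iff₀ hc] at this; linarith
    have hgen : ∀ k', 0 < k' → k' < 1 → ∀ r', ρ0 * c < r' →
        p s + (ρ0 * ε) • perp (p' s) ∈ coneS p p' c ε s k' r' := by
      intro k' hk' hk1 r' hr'
      have hε2 : ε * ε = 1 := by rw [← abs_mul_abs_self, hε]; norm_num
      have hn : ‖(ρ0 * ε) • perp (p' s)‖ = ρ0 * c := by
        rw [norm_smul, norm_perp, h.speed, Real.norm_eq_abs, abs_mul, hε, abs_of_pos hρ0pos, mul_one]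
      have hi : inner ℝ (perp (p' s)) ((ρ0 * ε) • perp (p' s)) = ρ0 * ε * c ^ 2 := by
        rw [inner_smul_right, real_inner_self_eq_norm_sq, norm_perp, h.speed]
      refine ⟨by rw [add_sub_cancel_left, hn]; exact hr', ?_⟩
      rw [add_sub_cancel_left, hn, hi]
      have : ε * (ρ0 * ε * c ^ 2) = ρ0 * c ^ 2 := by linear_combination ρ0 * c ^ 2 * hε2
      rw [this]
      have : 0 < ρ0 * c ^ 2 := by positivity
      nlinarith
    have hA := hgen (1 / 2) (by norm_num) (by norm_num) r hρr
    have hBm := hgen k hkpos (by linarith) r2 hρr2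
    refine ⟨r2 / ‖v‖, by positivity, fun ρ hρ hρ' => ?_⟩
    constructor
    · intro hin
      have h1 := hcone ε hε s k hkpos r2 (hav2 s ε hε) _ (hmem ρ hρ hρ') hin hBm
      have h2 := hcone ε hε s _ (by norm_num) r (hav s ε hε) _ hA h1 (hTcone ε hε s)
      exact hTconst ε hε s 0 h2
    · intro hin
      have h1 := hin_of ε hε hin s hA
      exact hcone ε hε s k hkpos r2 (hav2 s ε hε) _ hBm h1 (hmem ρ hρ hρ')
  have hconc : ∀ σ : ℝ, |σ| = 1 → T σ 0 ∈ Ω → T (-σ) 0 ∉ Ω → ∀ s v,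
      0 < σ * inner ℝ (perp (p' s)) v →
      (∀ᶠ r in nhdsWithin (0:ℝ) (Ioi 0), p s + r • v ∈ Ω) ∧
      (∀ᶠ r in nhdsWithin (0:ℝ) (Ioi 0), p s - r • v ∉ Ω) := by
    intro σ hσ h1 h2 s v hv
    obtain ⟨r1, hr1, hh1⟩ := hfin σ hσ s v hv
    obtain ⟨r2, hr2, hh2⟩ := hfin (-σ) (by rwa [abs_neg]) s (-v) (by
      rw [inner_neg_right]; linarith)
    constructor
    · filter_upwards [Ioo_mem_nhdsGT hr1] with ρ hρ
      exact (hh1 ρ hρ.1 hρ.2).2 h1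
    · filter_upwards [Ioo_mem_nhdsGT hr2] with ρ hρ hin
      apply h2
      rw [← hh2 ρ hρ.1 hρ.2, smul_neg, ← sub_eq_add_neg]
      exact hin
  rcases hone with h1 | h1
  · refine ⟨1, by simp, hconc 1 (by simp) h1 fun h2 => htwo ⟨h1, h2⟩⟩
  · refine ⟨-1, by simp, hconc (-1) (by simp) h1 fun h2 => htwo ⟨by simpa using h2, h1⟩⟩

/-- Two strands crossing a segment in the same direction cannot be all the crossings. -/
theorem no_parallel (h : Crv γ M c p p') (hγ : 0 < γ) (hc : 0 < c) (hs : Smp p) (hB : Bdy p Ω)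
    {P v : R2} {h0 h1 : ℝ} (hlt : h0 < h1) (hm0 : P + h0 • v ∈ range p)
    (hm1 : P + h1 • v ∈ range p) (ε : ℝ)
    (hdir : ∀ s, ∀ h' ∈ Icc h0 h1, p s = P + h' • v → 0 < ε * inner ℝ (perp (p' s)) v) :
    False := by
  -- reduce to the case where moving in direction `w = τ v` enters the domain
  obtain ⟨σ, hσ, hside⟩ := h.side hγ hc hs hB
  have hε : ε ≠ 0 := by
    rintro rfl
    obtain ⟨s, hs⟩ := hm0
    have := hdir s h0 ⟨le_rfl, hlt.le⟩ hs
    simp at this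
  have key : ∀ (Q w : R2) (a b : ℝ), a < b → Q + a • w ∈ range p → Q + b • w ∈ range p →
      (∀ s, ∀ h' ∈ Icc a b, p s = Q + h' • w → 0 < σ * inner ℝ (perp (p' s)) w) → False := by
    intro Q w a b hab ha hb hd
    obtain ⟨s0, hs0⟩ := ha
    have hfr : ∀ y ∈ range p, y ∉ Ω := by
      intro y hy hyΩ; rw [hB.fr, hB.op.frontier_eq] at hy; exact hy.2 hyΩ
    have hup := (hside s0 w (hd s0 a ⟨le_rfl, hab.le⟩ hs0)).1
    -- first exit
    obtain ⟨δ, hδ, hδin⟩ := mem_nhdsGT_iff_exists_Ioo_subset.1 hup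
    have hline : Continuous fun t : ℝ => Q + t • w := by fun_prop
    set S := {t | t ∈ Icc (a + min δ (b - a) / 2) b ∧ Q + t • w ∉ Ω} with hS
    have hδ' : 0 < min δ (b - a) := lt_min hδ (by linarith)
    have hδ1 : min δ (b - a) ≤ δ := min_le_left _ _
    have hδ2 : min δ (b - a) ≤ b - a := min_le_right _ _
    have hSc : IsClosed S := by
      rw [hS, ofPred_and]
      exact isClosed_Icc.inter (hB.op.isClosed_compl.preimage hline)
    have hSb : b ∈ S := ⟨⟨by linarith, le_rfl⟩, hfr _ hb⟩
    have hSbd : BddBelow S := ⟨a, fun t ht => by have := ht.1.1; linarith⟩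
    set m := sInf S with hm
    have hmS : m ∈ S := hSc.csInf_mem ⟨b, hSb⟩ hSbd
    have hbelow : ∀ t, a < t → t < m → Q + t • w ∈ Ω := by
      intro t hat htm
      by_cases htd : t < a + δ
      · have := hδin (show t - a ∈ Ioo 0 δ from ⟨by linarith, by linarith⟩)
        simp only [mem_ofPred_eq] at this
        rw [hs0] at this
        convert this using 1
        rw [sub_smul]; abel
      · by_contra hc
        have : t ∈ S := ⟨⟨by linarith, by linarith [hmS.1.2]⟩, hc⟩
        linarith [csInf_le hSbd this]
    have ham : a < m := by have := hmS.1.1; linarith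
    have hmfr : Q + m • w ∈ range p := by
      rw [hB.fr, hB.op.frontier_eq]
      refine ⟨?_, hmS.2⟩
      have hcw : ContinuousWithinAt (fun t : ℝ => Q + t • w) (Ioo a m) m :=
        hline.continuousWithinAt
      refine hcw.mem_closure ?_ (fun t ht => hbelow t ht.1 ht.2)
      rw [closure_Ioo ham.ne]; exact ⟨ham.le, le_rfl⟩
    obtain ⟨s1, hs1⟩ := hmfr
    have hdown := (hside s1 w (hd s1 m ⟨ham.le, hmS.1.2⟩ hs1)).2
    obtain ⟨r, hr1, hr2⟩ := (hdown.and (Ioo_mem_nhdsGT (by linarith : 0 < m - a))).exists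
    apply hr1
    rw [hs1]
    have := hbelow (m - r) (by linarith [hr2.2]) (by linarith [hr2.1])
    convert this using 1
    rw [sub_smul]; abel
  have hσ2 : σ = 1 ∨ σ = -1 := by
    rcases abs_choice σ with hh | hh <;> rw [hσ] at hh
    · exact Or.inl hh.symm
    · right; linarith
  rcases lt_or_gt_of_ne (mul_ne_zero hε (by rcases hσ2 with h | h <;> rw [h] <;> norm_num :
      σ ≠ 0)) with hneg | hpos
  · refine key P (-v) (-h1) (-h0) (by linarith) (by simpa using hm1) (by simpa using hm0) ?_
    intro s h' hh' heq
    have := hdir s (-h') ⟨by linarith [hh'.2], by linarith [hh'.1]⟩ (by simpa using heq)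
    rw [inner_neg_right]
    rcases hσ2 with h | h <;> rw [h] at hneg ⊢ <;> nlinarith
  · refine key P v h0 h1 hlt hm0 hm1 ?_
    intro s h' hh' heq
    have := hdir s h' hh' heq
    rcases hσ2 with h | h <;> rw [h] at hpos ⊢ <;> nlinarith

end Crv

/-! ### Limits of curves along ultrafilters -/

theorem redper (ξ : ℝ) :
    ∃ ζ ∈ Icc 0 (2 * π), ∀ g : ℝ → R2, (∀ ξ, g (ξ + 2 * π) = g ξ) → g ξ = g ζ := by
  have hp := Real.pi_pos
  refine ⟨toIcoMod (by positivity : (0:ℝ) < 2 * π) 0 ξ, ?_, fun g hg => ?_⟩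
  · have := toIcoMod_mem_Ico (by positivity : (0:ℝ) < 2 * π) 0 ξ
    rw [zero_add] at this; exact Ico_subset_Icc_self this
  · have h : Function.Periodic g (2 * π) := hg
    rw [toIcoMod]
    exact (h.sub_zsmul_eq _).symm

theorem unif_limit {ι : Type*} (F : Ultrafilter ι) (f : ι → ℝ → R2) (M g : ℝ) (hM : 0 ≤ M)
    (hg : 0 < g)
    (hf : ∀ᶠ i in (F : Filter ι), (∀ ξ, ‖f i ξ‖ ≤ M) ∧ (∀ ξ, f i (ξ + 2 * π) = f i ξ) ∧
      ∀ ξ η, ‖f i ξ - f i η‖ ≤ M * |ξ - η| ^ g) :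
    ∃ q : ℝ → R2, (∀ ξ, Tendsto (fun i => f i ξ) F (nhds (q ξ))) ∧
      ∀ ε > 0, ∀ᶠ i in (F : Filter ι), ∀ ξ, ‖f i ξ - q ξ‖ < ε := by
  have hlim : ∀ ξ, ∃ y, Tendsto (fun i => f i ξ) F (nhds y) := by
    intro ξ
    obtain ⟨y, -, hy⟩ := (isCompact_closedBall (0:R2) M).ultrafilter_le_nhds
      (F.map fun i => f i ξ) (by
        rw [Filter.le_principal_iff]
        show ∀ᶠ i in (F : Filter ι), f i ξ ∈ Metric.closedBall 0 M
        filter_upwards [hf] with i hi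
        simpa using hi.1 ξ)
    exact ⟨y, hy⟩
  choose q hq using hlim
  have hqper : ∀ ξ, q (ξ + 2 * π) = q ξ := fun ξ => by
    refine tendsto_nhds_unique ((hq (ξ + 2 * π)).congr' ?_) (hq ξ)
    filter_upwards [hf] with i hi
    exact hi.2.1 ξ
  have hqhol : ∀ ξ η, ‖q ξ - q η‖ ≤ M * |ξ - η| ^ g := fun ξ η => by
    refine le_of_tendsto ((hq ξ).sub (hq η)).norm ?_
    filter_upwards [hf] with i hi
    exact hi.2.2 ξ η
  refine ⟨q, hq, fun ε hε => ?_⟩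
  obtain ⟨δ, hδ, hδM⟩ : ∃ δ > 0, M * δ ^ g ≤ ε / 4 := by
    refine ⟨(ε / 4 / (M + 1)) ^ (1 / g), by positivity, ?_⟩
    rw [← Real.rpow_mul (by positivity), one_div_mul_cancel hg.ne', Real.rpow_one]
    rw [mul_div_assoc', div_le_iff₀ (by positivity)]
    nlinarith
  obtain ⟨s, -, hsf, hs⟩ := (isCompact_Icc (a := (0:ℝ)) (b := 2 * π)).finite_cover_balls hδ
  have hev : ∀ᶠ i in (F : Filter ι), ∀ x ∈ s, ‖f i x - q x‖ < ε / 4 := by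
    rw [Filter.eventually_all_finite hsf]
    intro x _
    have := Metric.tendsto_nhds.1 (hq x) (ε / 4) (by positivity)
    simpa [dist_eq_norm] using this
  filter_upwards [hev, hf] with i hi hfi ξ
  obtain ⟨ζ, hζ, hζe⟩ := redper ξ
  rw [hζe q hqper, hζe (f i) hfi.2.1]
  obtain ⟨x, hx, hxζ⟩ := mem_iUnion₂.1 (hs hζ)
  rw [Metric.mem_ball, Real.dist_eq] at hxζ
  have hb : M * |ζ - x| ^ g ≤ ε / 4 :=
    (mul_le_mul_of_nonneg_left (Real.rpow_le_rpow (abs_nonneg _) hxζ.le hg.le) hM).trans hδM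
  have h1 := (hfi.2.2 ζ x).trans hb
  have h2 := (hqhol ζ x).trans hb
  have h3 := hi x hx
  have e : f i ζ - q ζ = (f i ζ - f i x) - (q ζ - q x) + (f i x - q x) := by abel
  rw [e]
  calc _ ≤ ‖(f i ζ - f i x) - (q ζ - q x)‖ + ‖f i x - q x‖ := norm_add_le _ _
    _ ≤ ‖f i ζ - f i x‖ + ‖q ζ - q x‖ + ‖f i x - q x‖ := by gcongr; exact norm_sub_le _ _
    _ < ε := by linarith

theorem crv_limit {ι : Type*} (F : Ultrafilter ι) {γ M : ℝ} (hγ : 0 < γ) (hM : 0 ≤ M)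
    (f f' : ι → ℝ → R2) (hf : ∀ᶠ i in (F : Filter ι), ∃ c, Crv γ M c (f i) (f' i)) :
    ∃ q q' c, Crv γ M c q q' ∧ ∀ ε > 0, ∀ᶠ i in (F : Filter ι), ∀ ξ, ‖f i ξ - q ξ‖ < ε ∧
      ‖f' i ξ - q' ξ‖ < ε := by
  obtain ⟨q, hq, hqu⟩ := unif_limit F f M 1 hM one_pos (by
    filter_upwards [hf] with i ⟨c, h⟩
    refine ⟨h.bd, h.per, fun ξ η => ?_⟩
    rw [Real.rpow_one]; exact h.lip ξ η)
  obtain ⟨q', hq', hqu'⟩ := unif_limit F f' M γ hM hγ (by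
    filter_upwards [hf] with i ⟨c, h⟩
    exact ⟨fun ξ => by rw [h.speed]; exact h.spM, h.per', h.hol⟩)
  refine ⟨q, q', ‖q' 0‖, ⟨fun ξ => ?_, fun ξ => ?_, fun ξ => ?_, fun ξ => ?_, ?_, fun ξ η => ?_⟩,
    fun ε hε => ?_⟩
  · have ht : ∀ η, ‖q η - q ξ - (η - ξ) • q' ξ‖ ≤ M * |η - ξ| ^ (1 + γ) := fun η => by
      refine le_of_tendsto (((hq η).sub (hq ξ)).sub ((hq' ξ).const_smul (η - ξ))).norm ?_
      filter_upwards [hf] with i ⟨c, h⟩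
      exact h.taylor hγ η ξ
    rw [hasDerivAt_iff_isLittleO]
    refine Asymptotics.IsBigO.trans_isLittleO (g := fun η => |η - ξ| ^ (1 + γ)) ?_ ?_
    · refine Asymptotics.IsBigO.of_bound M (Filter.Eventually.of_forall fun η => ?_)
      rw [Real.norm_of_nonneg (by positivity)]; exact ht η
    · rw [Asymptotics.isLittleO_iff]
      intro ε hε
      have hc : Continuous fun η : ℝ => |η - ξ| ^ γ :=
        Continuous.rpow_const (by fun_prop) fun _ => Or.inr hγ.le
      have := hc.tendsto ξ
      simp only [sub_self, abs_zero, Real.zero_rpow hγ.ne'] at this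
      filter_upwards [this.eventually (gt_mem_nhds hε)] with η hη
      rw [Real.norm_of_nonneg (by positivity), Real.norm_eq_abs]
      rcases (abs_nonneg (η - ξ)).eq_or_lt with h0 | h0
      · rw [← h0, Real.zero_rpow (by linarith)]; simp
      · rw [Real.rpow_add h0, Real.rpow_one]; nlinarith
  · refine tendsto_nhds_unique ((hq (ξ + 2 * π)).congr' ?_) (hq ξ)
    filter_upwards [hf] with i ⟨c, h⟩
    exact h.per ξ
  · refine tendsto_nhds_unique ((hq' ξ).norm.congr' ?_) (hq' 0).norm
    filter_upwards [hf] with i ⟨c, h⟩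
    rw [h.speed, h.speed]
  · refine le_of_tendsto (hq ξ).norm ?_
    filter_upwards [hf] with i ⟨c, h⟩
    exact h.bd ξ
  · refine le_of_tendsto (hq' 0).norm ?_
    filter_upwards [hf] with i ⟨c, h⟩
    rw [h.speed]; exact h.spM
  · refine le_of_tendsto ((hq' ξ).sub (hq' η)).norm ?_
    filter_upwards [hf] with i ⟨c, h⟩
    exact h.hol ξ η
  · filter_upwards [hqu ε hε, hqu' ε hε] with i h1 h2 ξ
    exact ⟨h1 ξ, h2 ξ⟩

theorem distT_zero {ξ η : ℝ} (h : distT ξ η = 0) : ∃ k : ℤ, ξ = η + 2 * π * k := by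
  obtain ⟨k, hk, -⟩ := distT_attained ξ η
  rw [h] at hk
  refine ⟨-k, ?_⟩
  have := abs_eq_zero.1 hk.symm
  push_cast; linarith

namespace Crv
variable {γ M c c1 : ℝ} {p p' q q' : ℝ → R2} {Ω : Set R2}

/-- continuous lift -/
theorem lift (h : Crv γ M c p p') (hs : Smp p) (hq : Continuous q) (hr : range q ⊆ range p) :
    ∃ φ : ℝ → ℝ, Continuous φ ∧ ∀ ξ, q ξ = p (φ ξ) := by
  have hp := Real.pi_pos
  have : Fact (0 < 2 * π) := ⟨by positivity⟩
  have hper : Function.Periodic p (2 * π) := h.per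
  set e : AddCircle (2 * π) → R2 := hper.lift with he
  have hcoe : ∀ x : ℝ, e (x : AddCircle (2 * π)) = p x := fun x => hper.lift_coe x
  have hec : Continuous e := by
    refine continuous_quot_lift _ h.cont
  have hei : Function.Injective e := by
    intro a b
    induction a using QuotientAddGroup.induction_on with | H a => ?_
    induction b using QuotientAddGroup.induction_on with | H b => ?_
    intro hab
    have hab' : p a = p b := hab
    obtain ⟨k, hk⟩ := distT_zero (hs _ _ hab')
    rw [hk]
    refine QuotientAddGroup.eq_iff_sub_mem.2 ?_
    rw [add_sub_cancel_left]
    exact AddSubgroup.mem_zmultiples_iff.2 ⟨k, by rw [zsmul_eq_mul]; ring⟩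
  have hemb : Topology.IsEmbedding e := (hec.isClosedEmbedding hei).isEmbedding
  choose s hs' using fun ξ => hr (mem_range_self ξ)
  have hfc : Continuous fun ξ => (s ξ : AddCircle (2 * π)) := by
    rw [hemb.continuous_iff]
    refine hq.congr fun ξ => ?_
    simp [hcoe, hs']
  obtain ⟨φ, ⟨-, hφ⟩, -⟩ := (AddCircle.isCoveringMap_coe (2 * π)).existsUnique_continuousMap_lifts
    ⟨_, hfc⟩ 0 (s 0) rfl
  refine ⟨φ, φ.continuous, fun ξ => ?_⟩
  have := congrFun hφ ξ
  simp only [Function.comp_apply, ContinuousMap.coe_mk] at this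
  rw [← hs' ξ, ← hcoe, ← hcoe, this]

theorem affine (h : Crv γ M c p p') (hγ : 0 < γ) (hc : 0 < c) (hs : Smp p)
    (hq : Crv γ M c1 q q') (hr : range q ⊆ range p) :
    ∃ (a : ℝ) (k : ℤ), (∀ ξ, q ξ = p (a + k * ξ)) ∧ ∀ ξ, q' ξ = (k:ℝ) • p' (a + k * ξ) := by
  have hp := Real.pi_pos
  obtain ⟨φ, hφc, hφ⟩ := h.lift hs hq.cont hr
  set ψ : ℝ → ℝ := fun ξ => inner ℝ (p' (φ ξ)) (q' ξ) / c ^ 2 with hψ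
  have hd : ∀ ξ, HasDerivAt φ (ψ ξ) ξ := by
    intro ξ
    set v := p' (φ ξ) with hv
    have hv2 : inner ℝ v v = c ^ 2 := by rw [real_inner_self_eq_norm_sq, hv, h.speed]
    have hg : HasStrictDerivAt (fun s => inner ℝ v (p s)) (c ^ 2) (φ ξ) := by
      refine hasStrictDerivAt_of_hasDerivAt_of_continuousAt (f' := fun s => inner ℝ v (p' s)) ?_ ?_ |>.congr_deriv ?_
      · refine Filter.Eventually.of_forall fun s => ?_
        simpa using (hasDerivAt_const s v).inner ℝ (h.der s)
      · have := h.cont' hγ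
        exact (continuous_const.inner this).continuousAt
      · exact hv2
    have hne : c ^ 2 ≠ 0 := by positivity
    have hli := hg.to_localInverse hne
    have hgφ : HasDerivAt (fun ξ => inner ℝ v (p (φ ξ))) (inner ℝ v (q' ξ)) ξ := by
      have h1 : (fun ξ => inner ℝ v (p (φ ξ))) = fun ξ => inner ℝ v (q ξ) := by
        funext ξ; rw [hφ]
      rw [h1]
      simpa using (hasDerivAt_const ξ v).inner ℝ (hq.der ξ)
    have hcomp := hli.hasDerivAt.comp ξ hgφ
    have : ψ ξ = (c ^ 2)⁻¹ * inner ℝ v (q' ξ) := by rw [hψ]; ring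
    rw [this]
    refine hcomp.congr_of_eventuallyEq ?_
    have hev := (hg.hasStrictFDerivAt_equiv hne).eventually_left_inverse
    filter_upwards [hφc.continuousAt.eventually hev] with η hη
    exact hη.symm
  have hq' : ∀ ξ, q' ξ = ψ ξ • p' (φ ξ) := fun ξ => by
    have h1 := (h.der (φ ξ)).scomp ξ (hd ξ)
    have h2 : p ∘ φ = q := funext fun ξ => (hφ ξ).symm
    rw [h2] at h1
    exact (hq.der ξ).unique h1
  have hψa : ∀ ξ, |ψ ξ| = c1 / c := fun ξ => by
    have h1 := hq.speed ξ
    rw [hq' ξ, norm_smul, h.speed, Real.norm_eq_abs] at h1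
    rw [← h1]; field_simp
  have hψc : Continuous ψ := by
    have h1 := (h.cont' hγ).comp hφc
    exact (Continuous.inner (f := fun ξ => p' (φ ξ)) h1 (hq.cont' hγ)).div_const _
  have hconst : ∀ ξ, ψ ξ = ψ 0 := by
    rcases hq.c_nonneg.eq_or_lt with h0 | h0
    · intro ξ
      have h1 := hψa ξ; have h2 := hψa 0
      rw [← h0, zero_div, abs_eq_zero] at h1 h2
      rw [h1, h2]
    · have hsq : ∀ ξ, ψ ξ ≠ 0 := fun ξ h1 => by
        have h2 := hψa ξ; rw [h1, abs_zero] at h2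
        have : 0 < c1 / c := by positivity
        linarith
      intro ξ
      have heq := isPreconnected_univ.eq_of_sq_eq (f := ψ) (g := fun _ => ψ 0) hψc.continuousOn
        continuousOn_const (fun x _ => by
          simp only [Pi.pow_apply]
          rw [← sq_abs, hψa, ← sq_abs (ψ 0), hψa]) (fun _ => hsq 0) (mem_univ 0) rfl
      exact heq (mem_univ ξ)
  have haff : ∀ ξ, φ ξ = φ 0 + ψ 0 * ξ := by
    intro ξ
    have hz : ∀ x, HasDerivAt (fun x => φ x - ψ 0 * x) 0 x := fun x => by
      have := (hd x).sub ((hasDerivAt_id x).const_mul (ψ 0))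
      rw [hconst x] at this
      rw [mul_one, sub_self] at this
      exact this
    have := is_const_of_deriv_eq_zero (fun x => (hz x).differentiableAt)
      (fun x => (hz x).deriv) ξ 0
    simp at this; linarith
  obtain ⟨k, hk⟩ : ∃ k : ℤ, ψ 0 = k := by
    have h1 := hq.per 0
    rw [hφ, hφ] at h1
    obtain ⟨k, hk⟩ := distT_zero (hs _ _ h1)
    rw [haff (0 + 2 * π)] at hk
    refine ⟨k, ?_⟩
    have : 2 * π * ψ 0 = 2 * π * k := by linarith
    exact mul_left_cancel₀ (by positivity) this
  refine ⟨φ 0, k, fun ξ => ?_, fun ξ => ?_⟩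
  · rw [hφ, haff, hk]
  · rw [hq', hconst, haff, hk]

end Crv

/-! ### Signed area and winding -/

def area (p p' : ℝ → R2) : ℝ := ∫ ξ in (0:ℝ)..(2 * π), (p ξ 0 * p' ξ 1 - p ξ 1 * p' ξ 0)

theorem cross_eq (v w : R2) : v 0 * w 1 - v 1 * w 0 = inner ℝ (perp v) w := by
  rw [inner2, perp_0, perp_1]; ring

theorem area_eq (p p' : ℝ → R2) : area p p' = ∫ ξ in (0:ℝ)..(2 * π), inner ℝ (perp (p ξ)) (p' ξ) := by
  simp only [area, cross_eq]

theorem perp_sub (v w : R2) : perp (v - w) = perp v - perp w := by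
  rw [sub_eq_add_neg, perp_add, ← neg_one_smul ℝ w, perp_smul, neg_one_smul, ← sub_eq_add_neg]

namespace Crv
variable {γ M c c1 : ℝ} {p p' q q' : ℝ → R2} {Ω : Set R2}

theorem contX (h : Crv γ M c p p') (hγ : 0 < γ) :
    Continuous fun ξ => inner ℝ (perp (p ξ)) (p' ξ) :=
  (continuous_perp.comp h.cont).inner (h.cont' hγ)

theorem area_close (h : Crv γ M c p p') (hγ : 0 < γ) (hq : Crv γ M c1 q q') {ε : ℝ}
    (hcl : ∀ ξ, ‖p ξ - q ξ‖ < ε ∧ ‖p' ξ - q' ξ‖ < ε) :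
    |area p p' - area q q'| ≤ 4 * π * M * ε := by
  have hp := Real.pi_pos
  rw [area_eq, area_eq, ← intervalIntegral.integral_sub
    ((h.contX hγ).intervalIntegrable _ _) ((hq.contX hγ).intervalIntegrable _ _), ← Real.norm_eq_abs]
  refine (intervalIntegral.norm_integral_le_of_norm_le_const (C := 2 * M * ε) ?_).trans ?_
  · intro ξ _
    obtain ⟨h1, h2⟩ := hcl ξ
    have e : inner ℝ (perp (p ξ)) (p' ξ) - inner ℝ (perp (q ξ)) (q' ξ)
      = inner ℝ (perp (p ξ - q ξ)) (p' ξ) + inner ℝ (perp (q ξ)) (p' ξ - q' ξ) := by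
      rw [perp_sub, inner_sub_left, inner_sub_right]; ring
    rw [e, Real.norm_eq_abs]
    refine (abs_add_le _ _).trans ?_
    have h3 := abs_inner_le (perp (p ξ - q ξ)) (p' ξ)
    have h4 := abs_inner_le (perp (q ξ)) (p' ξ - q' ξ)
    rw [norm_perp] at h3 h4
    rw [h.speed] at h3
    have h5 : ‖p ξ - q ξ‖ * c ≤ ε * M := mul_le_mul h1.le h.spM h.c_nonneg ((norm_nonneg _).trans h1.le)
    have h6 : ‖q ξ‖ * ‖p' ξ - q' ξ‖ ≤ M * ε := mul_le_mul (hq.bd ξ) h2.le (norm_nonneg _) h.M_nonneg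
    linarith
  · rw [sub_zero, abs_of_pos (by positivity)]; apply le_of_eq; ring

theorem perX (h : Crv γ M c p p') :
    Function.Periodic (fun ξ => inner ℝ (perp (p ξ)) (p' ξ)) (2 * π) := fun ξ => by
  simp only [h.per, h.per']

theorem area_shift (h : Crv γ M c p p') (a : ℝ) :
    area (fun ξ => p (a + ξ)) (fun ξ => p' (a + ξ)) = area p p' := by
  rw [area_eq, area_eq]
  have h1 := intervalIntegral.integral_comp_add_left (a := 0) (b := 2 * π)
    (fun ξ => inner ℝ (perp (p ξ)) (p' ξ)) a
  rw [h1]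
  have := h.perX.intervalIntegral_add_eq a 0
  rw [zero_add] at this
  rw [add_zero, this]

theorem area_refl (h : Crv γ M c p p') (a : ℝ) :
    area (fun ξ => p (a - ξ)) (fun ξ => -p' (a - ξ)) = -area p p' := by
  rw [area_eq, area_eq]
  simp only [inner_neg_right]
  rw [intervalIntegral.integral_neg]
  have h1 := intervalIntegral.integral_comp_sub_left (a := 0) (b := 2 * π)
    (fun ξ => inner ℝ (perp (p ξ)) (p' ξ)) a
  rw [h1]
  have := h.perX.intervalIntegral_add_eq (a - 2 * π) 0
  rw [zero_add, sub_add_cancel] at this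
  rw [sub_zero, this]

set_option maxHeartbeats 1000000 in
theorem no_wind (h : Crv γ M c p p') (hγ : 0 < γ) (hc : 0 < c) (hs : Smp p) (a : ℝ) (k : ℤ)
    (hk : 2 ≤ |k|) : ∃ ε > 0, ∀ (c1 : ℝ) (q q' : ℝ → R2) (Ω : Set R2), Crv γ M c1 q q' → 0 < c1 →
      Smp q → Bdy q Ω →
      (∀ ξ, ‖q ξ - p (a + k * ξ)‖ < ε ∧ ‖q' ξ - (k:ℝ) • p' (a + k * ξ)‖ < ε) → False := by
  have hp := Real.pi_pos
  have hM : 0 < M := hc.trans_le h.spM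
  obtain ⟨κ, hκ, hac⟩ := h.arcchord hγ hc hs
  set K : ℝ := |(k:ℝ)| with hK
  have hK2 : (2:ℝ) ≤ K := by rw [hK]; exact_mod_cast hk
  have hK0 : 0 < K := by linarith
  set e := (k:ℝ) • p' a with he
  set E := K * c with hE
  have hE0 : 0 < E := by positivity
  have hen : ‖e‖ = E := by rw [he, norm_smul, h.speed, Real.norm_eq_abs]
  have hroot : ∀ b > 0, ∃ r > 0, M * r ^ γ ≤ b := fun b hb => by
    refine ⟨(b / M) ^ (1 / γ), by positivity, ?_⟩
    rw [← Real.rpow_mul (by positivity), one_div_mul_cancel hγ.ne', Real.rpow_one]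
    field_simp; rfl
  obtain ⟨r1, hr1, hr1M⟩ := hroot (c / 4) (by positivity)
  obtain ⟨r2, hr2, hr2M⟩ := hroot (c / 2) (by positivity)
  set δ := min (r2 / K) (min (1 / K) (κ * r1 / (4 * M * K))) with hδ
  have hδ0 : 0 < δ := lt_min (by positivity) (lt_min (by positivity) (by positivity))
  have hδ1 : K * δ ≤ r2 := by
    have : δ ≤ r2 / K := min_le_left _ _
    rwa [le_div_iff₀ hK0, mul_comm] at this
  have hδ2 : K * δ ≤ 1 := by
    have : δ ≤ 1 / K := (min_le_right _ _).trans (min_le_left _ _)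
    rwa [le_div_iff₀ hK0, mul_comm] at this
  have hδ3 : M * (K * δ) ≤ κ * r1 / 4 := by
    have : δ ≤ κ * r1 / (4 * M * K) := (min_le_right _ _).trans (min_le_right _ _)
    rw [le_div_iff₀ (by positivity)] at this; linarith
  set ε := min (E / 4) (min (δ * E / 4) (κ * r1 / 8)) with hε
  have hε0 : 0 < ε := lt_min (by positivity) (lt_min (by positivity) (by positivity))
  have hε1 : ε ≤ E / 4 := min_le_left _ _
  have hε2 : ε ≤ δ * E / 4 := (min_le_right _ _).trans (min_le_left _ _)
  have hε3 : ε ≤ κ * r1 / 8 := (min_le_right _ _).trans (min_le_right _ _)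
  refine ⟨ε, hε0, fun c1 q q' Ω hq hc1 hsq hB hcl => ?_⟩
  set P := p a with hP
  set v := perp e with hv
  have hvn : ‖v‖ = E := by rw [hv, norm_perp, hen]
  -- direction of crossings
  have hdir : ∀ s, ‖q s - P‖ ≤ 3 * κ * r1 / 8 → 0 < inner ℝ (perp (q' s)) v := by
    intro s hsP
    have h1 : ‖p (a + k * s) - p a‖ ≤ κ * r1 / 2 := by
      have : p (a + k * s) - p a = (q s - P) - (q s - p (a + k * s)) := by rw [hP]; abel
      rw [this]
      have := (norm_sub_le (q s - P) (q s - p (a + k * s)))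
      have := (hcl s).1
      linarith
    have h2 := (hac (a + k * s) a).trans h1
    obtain ⟨j, hj, -⟩ := distT_attained (a + k * s) a
    have h3 : |(a + k * s + 2 * π * j) - a| ≤ r1 := by
      rw [hj] at h2
      have e1 : a + k * s - a + 2 * π * j = (a + k * s + 2 * π * j) - a := by ring
      rw [e1] at h2
      nlinarith
    have h4 := h.hol (a + k * s + 2 * π * j) a
    rw [h.perk'] at h4
    have h5 : ‖p' (a + k * s) - p' a‖ ≤ c / 4 :=
      h4.trans ((mul_le_mul_of_nonneg_left (Real.rpow_le_rpow (abs_nonneg _) h3 hγ.le) hM.le).trans hr1M)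
    have h6 : inner ℝ (perp (q' s)) v = inner ℝ (q' s) e := by
      rw [hv, inner2, inner2, perp_0, perp_0, perp_1, perp_1]; ring
    have h7 : ‖q' s - e‖ ≤ E / 2 := by
      have : q' s - e = (q' s - (k:ℝ) • p' (a + k * s)) + (k:ℝ) • (p' (a + k * s) - p' a) := by
        rw [he, smul_sub]; abel
      rw [this]
      refine (norm_add_le _ _).trans ?_
      rw [norm_smul, Real.norm_eq_abs]
      have := (hcl s).2
      have h8 : K * ‖p' (a + k * s) - p' a‖ ≤ K * (c / 4) := mul_le_mul_of_nonneg_left h5 hK0.le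
      linarith
    have h8 : inner ℝ (q' s) e = E ^ 2 + inner ℝ (q' s - e) e := by
      rw [inner_sub_left, real_inner_self_eq_norm_sq e, hen]; ring
    have h9 := abs_inner_le (q' s - e) e
    rw [hen] at h9
    have h10 := neg_abs_le (inner ℝ (q' s - e) e)
    rw [h6, h8]
    nlinarith
  -- strands
  have hst : ∀ ξ0 : ℝ, p (a + k * ξ0) = P → p' (a + k * ξ0) = p' a →
      ∃ ξ hh : ℝ, |ξ - ξ0| ≤ δ ∧ q ξ = P + hh • v ∧ |hh| * E ≤ κ * r1 * (3 / 8) := by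
    intro ξ0 hp0 hp0'
    have hT : ∀ s, |s| ≤ δ → ‖p (a + k * (ξ0 + s)) - P - s • e‖ ≤ |s| * E / 2 := by
      intro s hsδ
      have h1 := h.taylor hγ (a + k * (ξ0 + s)) (a + k * ξ0)
      rw [hp0, hp0', show a + k * (ξ0 + s) - (a + k * ξ0) = k * s by ring] at h1
      have e1 : s • e = (k * s : ℝ) • p' a := by rw [he, smul_smul, mul_comm]
      rw [e1]
      refine h1.trans ?_
      have e2 : |(k:ℝ) * s| = K * |s| := abs_mul _ _
      rw [e2]
      have h3 : M * (K * |s|) ^ (1 + γ) = (M * (K * |s|) ^ γ) * (K * |s|) := by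
        rcases (abs_nonneg s).eq_or_lt with h0 | h0
        · rw [← h0, mul_zero, Real.zero_rpow (by linarith)]; ring
        · rw [Real.rpow_add (by positivity), Real.rpow_one]; ring
      rw [h3]
      have h4 : M * (K * |s|) ^ γ ≤ c / 2 := le_trans (mul_le_mul_of_nonneg_left
        (Real.rpow_le_rpow (by positivity) ((mul_le_mul_of_nonneg_left hsδ hK0.le).trans hδ1) hγ.le)
          hM.le) hr2M
      calc _ ≤ c / 2 * (K * |s|) := mul_le_mul_of_nonneg_right h4 (by positivity)
        _ = _ := by rw [hE]; ring
    set g : ℝ → ℝ := fun s => inner ℝ e (q (ξ0 + s) - P) with hg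
    have hgc : Continuous g := by have := hq.cont; fun_prop
    have hgv : ∀ s, |s| ≤ δ → |g s - s * E ^ 2| ≤ (|s| * E / 2 + ε) * E := by
      intro s hsδ
      have e1 : g s - s * E ^ 2 = inner ℝ e ((q (ξ0 + s) - p (a + k * (ξ0 + s))) +
          (p (a + k * (ξ0 + s)) - P - s • e)) := by
        rw [hg, show (q (ξ0 + s) - p (a + k * (ξ0 + s))) + (p (a + k * (ξ0 + s)) - P - s • e)
          = q (ξ0 + s) - P - s • e by abel, inner_sub_right, inner_smul_right,
          real_inner_self_eq_norm_sq, hen]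
      rw [e1]
      refine (abs_inner_le _ _).trans ?_
      rw [hen, mul_comm]
      refine mul_le_mul_of_nonneg_right ((norm_add_le _ _).trans ?_) hE0.le
      have := hT s hsδ; have := (hcl (ξ0 + s)).1
      linarith
    have h1 := hgv δ (by rw [abs_of_pos hδ0])
    have h2 := hgv (-δ) (by rw [abs_neg, abs_of_pos hδ0])
    rw [abs_neg] at h2
    rw [abs_of_pos hδ0] at h1 h2
    have hb : (δ * E / 2 + ε) * E ≤ 3 / 4 * (δ * E ^ 2) := by nlinarith
    have hδE : 0 < δ * E ^ 2 := by positivity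
    obtain ⟨s, hsI, hs0⟩ := intermediate_value_Icc (by linarith : -δ ≤ δ) hgc.continuousOn
      (show (0:ℝ) ∈ Icc (g (-δ)) (g δ) from
        ⟨by have := (abs_le.1 h2).2; linarith, by have := (abs_le.1 h1).1; linarith⟩)
    have hsδ : |s| ≤ δ := abs_le.2 hsI
    have hdec : q (ξ0 + s) - P = (inner ℝ v (q (ξ0 + s) - P) / E ^ 2) • v := by
      set w := q (ξ0 + s) - P with hw
      have h0 : inner ℝ e w = 0 := hs0
      have hE2 : e 0 ^ 2 + e 1 ^ 2 = E ^ 2 := by rw [← normsq2, hen]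
      rw [inner2] at h0
      have hE2' : E ^ 2 ≠ 0 := by positivity
      apply ext2
      · rw [PiLp.smul_apply, smul_eq_mul, inner2, hv, perp_0, perp_1, div_mul_eq_mul_div,
          eq_div_iff hE2', ← hE2]
        linear_combination e 0 * h0
      · rw [PiLp.smul_apply, smul_eq_mul, inner2, hv, perp_0, perp_1, div_mul_eq_mul_div,
          eq_div_iff hE2', ← hE2]
        linear_combination e 1 * h0
    refine ⟨ξ0 + s, inner ℝ v (q (ξ0 + s) - P) / E ^ 2, by simpa using hsδ, ?_, ?_⟩
    · rw [← hdec]; abel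
    · have hnn : |inner ℝ v (q (ξ0 + s) - P) / E ^ 2| * E = ‖q (ξ0 + s) - P‖ := by
        nth_rewrite 2 [hdec]
        rw [norm_smul, hvn, Real.norm_eq_abs]
      rw [hnn]
      have h3 := h.lip (a + k * (ξ0 + s)) (a + k * ξ0)
      rw [hp0, show a + k * (ξ0 + s) - (a + k * ξ0) = k * s by ring, abs_mul] at h3
      have h4 : q (ξ0 + s) - P = (q (ξ0 + s) - p (a + k * (ξ0 + s))) + (p (a + k * (ξ0 + s)) - P) := by abel
      rw [h4]
      refine (norm_add_le _ _).trans ?_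
      have h5 := (hcl (ξ0 + s)).1
      have h6 : M * (K * |s|) ≤ M * (K * δ) := by gcongr
      linarith
  obtain ⟨ξ1, a1, h11, h12, h13⟩ := hst 0 (by simp [hP]) (by simp)
  have hsg : ∃ m : ℤ, (k:ℝ) * (2 * π / K) = 2 * π * m := by
    rcases abs_choice (k:ℝ) with hh | hh
    · exact ⟨1, by rw [hK, hh]; have : (k:ℝ) ≠ 0 := by rw [← hh]; exact hK0.ne'
                   field_simp; simp⟩
    · exact ⟨-1, by rw [hK, hh]; have : (k:ℝ) ≠ 0 := by intro h0; rw [h0] at hh; simp [hK, h0] at hK0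
                    field_simp; simp⟩
  obtain ⟨m, hm⟩ := hsg
  obtain ⟨ξ2, a2, h21, h22, h23⟩ := hst (2 * π / K) (by rw [hm, h.perk]) (by rw [hm, h.perk'])
  have hne : a1 ≠ a2 := by
    rintro rfl
    have h1 := hsq ξ1 ξ2 (by rw [h12, h22])
    have h2 := distT_lip 0 (2 * π / K) ξ1 ξ2
    have hle : 2 * π / K ≤ π := by rw [div_le_iff₀ hK0]; nlinarith
    rw [h1, distT_eq_abs (by rw [zero_sub, abs_neg, abs_of_pos (by positivity)]; exact hle), zero_sub,
      abs_neg, abs_of_pos (by positivity : 0 < 2 * π / K)] at h2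
    have h3 : |0 - ξ1 - (2 * π / K - ξ2)| ≤ 2 * δ := by
      rw [show 0 - ξ1 - (2 * π / K - ξ2) = (ξ2 - 2 * π / K) - (ξ1 - 0) by ring]
      refine (abs_sub _ _).trans (by linarith)
    have h4 : 2 * π / K ≤ 2 * δ := by linarith
    rw [div_le_iff₀ hK0] at h4
    nlinarith [Real.pi_gt_three]
  have hfin : ∀ b1 b2, b1 < b2 → |b1| * E ≤ κ * r1 * (3 / 8) → |b2| * E ≤ κ * r1 * (3 / 8) →
      P + b1 • v ∈ range q → P + b2 • v ∈ range q → False := by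
    intro b1 b2 hb hb1 hb2 hm1 hm2
    refine hq.no_parallel hγ hc1 hsq hB hb hm1 hm2 1 ?_
    intro s b hbI heq
    rw [one_mul]
    apply hdir
    rw [heq, add_sub_cancel_left, norm_smul, hvn, Real.norm_eq_abs]
    have : |b| ≤ max |b1| |b2| := abs_le_max_abs_abs hbI.1 hbI.2
    rcases max_choice |b1| |b2| with hh | hh <;> rw [hh] at this <;> nlinarith
  rcases lt_or_gt_of_ne hne with hlt | hlt
  · exact hfin _ _ hlt h13 h23 ⟨_, h12⟩ ⟨_, h22⟩
  · exact hfin _ _ hlt h23 h13 ⟨_, h22⟩ ⟨_, h12⟩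

end Crv

theorem ultra_of {ι : Type*} {f : Filter ι} {P : ι → Prop} (h : ¬ ∀ᶠ x in f, P x) :
    ∃ F : Ultrafilter ι, (F : Filter ι) ≤ f ∧ ∀ᶠ x in (F : Filter ι), ¬ P x := by
  have := Filter.frequently_mem_iff_neBot.1 (Filter.not_eventually.1 h)
  refine ⟨@Ultrafilter.of _ _ this, ?_, ?_⟩
  · exact (Ultrafilter.of_le _).trans inf_le_left
  · exact Filter.le_principal_iff.1 ((@Ultrafilter.of_le _ _ this).trans inf_le_right)

/-! ### The solution structure -/

structure Sol (α γ T cα M : ℝ) (N : ℕ) (θ : Fin N → ℝ) (Ω : Fin N → ℝ → Set R2)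
    (p p' : Fin N → ℝ → ℝ → R2) (c : Fin N → ℝ → ℝ) : Prop where
  hα0 : 0 < α
  hα : α ≤ 1 / 4
  hγ : γ = 2 * α / (1 - 2 * α)
  hT : 0 < T
  hcα : 0 < cα
  hM : 0 < M
  crv : ∀ n, ∀ t ∈ Ico 0 T, Crv γ M (c n t) (p n t) (p' n t)
  cpos : ∀ n, ∀ t ∈ Ico 0 T, 0 < c n t
  smp : ∀ n, ∀ t ∈ Ico 0 T, Smp (p n t)
  bdy : ∀ n, ∀ t ∈ Ico 0 T, Bdy (p n t) (Ω n t)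
  ccw : ∀ n, ∀ t ∈ Ico 0 T, 0 < area (p n t) (p' n t)
  disj : ∀ t ∈ Ico 0 T, ∀ n j : Fin N, n ≠ j → ∀ ξ η, p n t ξ ≠ p j t η
  haus : ∀ n, ∀ t₀ ∈ Ico 0 T,
      Tendsto (fun t => Metric.hausdorffDist (frontier (Ω n t)) (frontier (Ω n t₀)))
        (nhdsWithin t₀ (Ico 0 T)) (nhds 0)
  patch : ∀ t ∈ Ioo 0 T,
      Tendsto (fun h =>
          Metric.hausdorffDist (⋃ n, frontier (Ω n (t + h)))
            ((fun x => x + h • gSQGvel α cα θ (fun n => Ω n t) x) ''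
              ⋃ n, frontier (Ω n t)) / |h|)
        (nhdsWithin 0 {h : ℝ | t + h ∈ Ico 0 T ∧ h ≠ 0}) (nhds 0)

theorem Crv.bdd_range {γ M c : ℝ} {p p' : ℝ → R2} (h : Crv γ M c p p') :
    Bornology.IsBounded (range p) := by
  refine (Metric.isBounded_closedBall (x := (0:R2)) (r := M)).subset ?_
  rintro _ ⟨ξ, rfl⟩
  simpa using h.bd ξ

theorem Crv.cpt_range {γ M c : ℝ} {p p' : ℝ → R2} (h : Crv γ M c p p') : IsCompact (range p) := by
  have : range p = p '' Icc 0 (2 * π) := by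
    apply Subset.antisymm
    · rintro _ ⟨ξ, rfl⟩
      obtain ⟨ζ, hζ, hζe⟩ := redper ξ
      exact ⟨ζ, hζ, (hζe p h.per).symm⟩
    · exact image_subset_range _ _
  rw [this]
  exact isCompact_Icc.image h.cont

theorem hausE_ne_top {A B : Set R2} (hA : A.Nonempty) (hB : B.Nonempty)
    (hA' : Bornology.IsBounded A) (hB' : Bornology.IsBounded B) : Metric.hausdorffEDist A B ≠ ⊤ :=
  Metric.hausdorffEDist_ne_top_of_nonempty_of_bounded hA hB hA' hB'

namespace Sol
variable {α γ T cα M : ℝ} {N : ℕ} {θ : Fin N → ℝ} {Ω : Fin N → ℝ → Set R2}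
    {p p' : Fin N → ℝ → ℝ → R2} {c : Fin N → ℝ → ℝ}

theorem γ0 (S : Sol α γ T cα M N θ Ω p p' c) : 0 < γ := by
  rw [S.hγ]; have := S.hα; have := S.hα0
  apply div_pos <;> linarith

theorem fr (S : Sol α γ T cα M N θ Ω p p' c) {t : ℝ} (ht : t ∈ Ico 0 T) (n : Fin N) :
    frontier (Ω n t) = range (p n t) := (S.bdy n t ht).fr.symm

/-- N2: closeness of nearby curves in `C^1` modulo shift. -/
theorem close (S : Sol α γ T cα M N θ Ω p p' c) (n : Fin N) {t0 : ℝ} (ht0 : t0 ∈ Ico 0 T)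
    {ε : ℝ} (hε : 0 < ε) : ∀ᶠ t in nhdsWithin t0 (Ico 0 T), ∃ a, ∀ ξ,
      ‖p n t ξ - p n t0 (a + ξ)‖ < ε ∧ ‖p' n t ξ - p' n t0 (a + ξ)‖ < ε := by
  have hp := Real.pi_pos
  by_contra hcon
  have hmem : ∀ᶠ t in nhdsWithin t0 (Ico 0 T), t ∈ Ico 0 T := self_mem_nhdsWithin
  obtain ⟨F, hF, hFn⟩ := ultra_of hcon
  have hFm : ∀ᶠ t in (F : Filter ℝ), t ∈ Ico 0 T := hF hmem
  obtain ⟨q, q', c1, hq, hqu⟩ := crv_limit F S.γ0 S.hM.le (fun t => p n t) (fun t => p' n t) (by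
    filter_upwards [hFm] with t ht
    exact ⟨_, S.crv n t ht⟩)
  have h := S.crv n t0 ht0
  have hc := S.cpos n t0 ht0
  have hs := S.smp n t0 ht0
  have hH := (S.haus n t0 ht0).mono_left hF
  have hHd : ∀ δ > 0, ∀ᶠ t in (F : Filter ℝ), Metric.hausdorffDist (range (p n t)) (range (p n t0)) < δ := by
    intro δ hδ
    filter_upwards [hH.eventually (gt_mem_nhds hδ), hFm] with t h1 ht
    rwa [S.fr ht, S.fr ht0] at h1
  have hfin : ∀ t ∈ Ico 0 T, Metric.hausdorffEDist (range (p n t)) (range (p n t0)) ≠ ⊤ := fun t ht =>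
    hausE_ne_top (range_nonempty _) (range_nonempty _)
      (S.crv n t ht).bdd_range h.bdd_range
  have hr1 : range q ⊆ range (p n t0) := by
    rintro _ ⟨ξ, rfl⟩
    rw [← h.cpt_range.isClosed.closure_eq, Metric.mem_closure_iff]
    intro δ hδ
    obtain ⟨t, h1, h2, ht⟩ := ((hHd (δ / 2) (by positivity)).and
      ((hqu (δ / 2) (by positivity)).and hFm)).exists
    obtain ⟨y, hy, hyd⟩ := Metric.exists_dist_lt_of_hausdorffDist_lt (mem_range_self ξ) h1 (hfin t ht)
    refine ⟨y, hy, ?_⟩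
    have h3 := (h2 ξ).1
    rw [← dist_eq_norm, dist_comm] at h3
    linarith [dist_triangle (q ξ) (p n t ξ) y]
  have hr2 : range (p n t0) ⊆ range q := by
    rintro y hy
    rw [← hq.cpt_range.isClosed.closure_eq, Metric.mem_closure_iff]
    intro δ hδ
    obtain ⟨t, h1, h2, ht⟩ := ((hHd (δ / 2) (by positivity)).and
      ((hqu (δ / 2) (by positivity)).and hFm)).exists
    obtain ⟨_, ⟨ξ, rfl⟩, hyd⟩ := Metric.exists_dist_lt_of_hausdorffDist_lt' hy h1 (hfin t ht)
    refine ⟨q ξ, mem_range_self ξ, ?_⟩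
    have h3 := (h2 ξ).1
    rw [← dist_eq_norm] at h3
    rw [dist_comm] at hyd
    linarith [dist_triangle y (p n t ξ) (q ξ)]
  obtain ⟨a, k, hk1, hk2⟩ := h.affine S.γ0 hc hs hq hr1
  have hk0 : k ≠ 0 := by
    rintro rfl
    obtain ⟨ξ, hξ⟩ := hr2 (mem_range_self (a + π))
    rw [hk1] at hξ
    have := hs _ _ hξ.symm
    rw [distT_eq_abs (by simp [abs_of_pos hp])] at this
    simp [hp.ne'] at this
  have hk2' : ¬ 2 ≤ |k| := by
    intro hk
    obtain ⟨ε', hε', hno⟩ := h.no_wind S.γ0 hc hs a k hk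
    obtain ⟨t, h1, ht⟩ := ((hqu ε' hε').and hFm).exists
    refine hno _ _ _ _ (S.crv n t ht) (S.cpos n t ht) (S.smp n t ht) (S.bdy n t ht) fun ξ => ?_
    rw [← hk1, ← hk2]; exact h1 ξ
  have hk1' : k = 1 ∨ k = -1 := by
    have : 1 ≤ |k| := Int.one_le_abs hk0
    have : |k| = 1 := by omega
    rcases abs_choice k with hh | hh <;> omega
  rcases hk1' with rfl | rfl
  · obtain ⟨t, h1, ht⟩ := ((hqu ε hε).and hFn).exists
    refine ht ⟨a, fun ξ => ?_⟩
    have := h1 ξ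
    rw [hk1, hk2] at this
    simpa using this
  · have hA := S.ccw n t0 ht0
    have hAq : area q q' = -area (p n t0) (p' n t0) := by
      rw [← h.area_refl a]
      congr 1
      · funext ξ; rw [hk1]; congr 1; push_cast; ring
      · funext ξ; rw [hk2]; push_cast; rw [neg_one_smul]; congr 2; ring
    have hM := S.hM
    obtain ⟨t, h1, ht⟩ := ((hqu (area (p n t0) (p' n t0) / (8 * π * M)) (by positivity)).and hFm).exists
    have h2 := (S.crv n t ht).area_close S.γ0 hq h1
    have h3 := S.ccw n t ht
    rw [hAq] at h2
    have h4 : 4 * π * M * (area (p n t0) (p' n t0) / (8 * π * M)) = area (p n t0) (p' n t0) / 2 := by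
      field_simp; norm_num
    rw [h4] at h2
    have := (abs_le.1 h2).2
    linarith

end Sol

/-! ### The kernel -/

theorem kern_norm (α : ℝ) (hα : 0 < α) (w : R2) : ‖kern α w‖ = ‖w‖ ^ (-(1 + 2 * α)) := by
  rw [kern, norm_smul, norm_perp, Real.norm_of_nonneg (by positivity)]
  rcases (norm_nonneg w).eq_or_lt with h | h
  · rw [← h, mul_zero, Real.zero_rpow (by linarith)]
  · rw [Real.rpow_neg h.le, show 2 + 2 * α = (1 + 2 * α) + 1 by ring, Real.rpow_add h, Real.rpow_one]
    field_simp

theorem kern_meas (α : ℝ) : Measurable (kern α) := by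
  unfold kern
  exact ((measurable_norm.pow_const _).inv).smul continuous_perp.measurable

theorem kern_ball (α : ℝ) (hα0 : 0 < α) (hα : α ≤ 1 / 4) (R : ℝ) :
    IntegrableOn (kern α) (Metric.ball 0 R) := by
  have h1 : IntegrableOn (fun w : R2 => (fun r : ℝ => r ^ (-(1 + 2 * α))) ‖w‖) (Metric.ball 0 R) := by
    refine (integrableOn_fun_norm_addHaar (E := R2) (F := ℝ) (μ := (volume : Measure R2))
      (f := fun r : ℝ => r ^ (-(1 + 2 * α))) (r := R)).2 ?_
    have h2 : IntegrableOn (fun y : ℝ => y ^ (-(2 * α))) (Ioo 0 R) := by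
      rcases le_total R 0 with h | h
      · rw [Ioo_eq_empty (by linarith)]; exact integrableOn_empty
      · have := (intervalIntegral.intervalIntegrable_rpow' (a := 0) (b := R)
          (by linarith : -1 < -(2 * α)))
        rw [intervalIntegrable_iff_integrableOn_Ioo_of_le h] at this
        exact this
    refine h2.congr_fun ?_ measurableSet_Ioo
    intro y hy
    have hy0 : 0 < y := hy.1
    simp only [finrank_euclideanSpace, Fintype.card_fin, Nat.add_one_sub_one, pow_one, smul_eq_mul]
    rw [show -(2 * α) = 1 + -(1 + 2 * α) by ring, Real.rpow_add hy0, Real.rpow_one]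
  refine h1.mono' (kern_meas α).aestronglyMeasurable ?_
  filter_upwards with w
  rw [kern_norm α hα0]

theorem sub_mem_ball {Ω : Set R2} {R : ℝ} (hΩ : ∀ y ∈ Ω, ‖y‖ ≤ R) {x y : R2} {r : ℝ} (hx : ‖x‖ ≤ r)
    (hy : y ∈ Ω) : x - y ∈ Metric.ball (0:R2) (r + R + 1) := by
  rw [mem_ball_zero_iff]
  have := norm_sub_le x y; have := hΩ y hy; linarith

theorem kern_int (α : ℝ) (hα0 : 0 < α) (hα : α ≤ 1 / 4) {Ω : Set R2} (hm : MeasurableSet Ω) {R : ℝ}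
    (hΩ : ∀ y ∈ Ω, ‖y‖ ≤ R) (x : R2) : IntegrableOn (fun y => kern α (x - y)) Ω := by
  have h1 := (kern_ball α hα0 hα (‖x‖ + R + 1)).integrable_indicator measurableSet_ball
  have h2 := (h1.comp_sub_left x).integrableOn (s := Ω)
  refine h2.congr_fun ?_ hm
  intro y hy
  simp only
  rw [indicator_of_mem (sub_mem_ball hΩ le_rfl hy)]

theorem kern_int_bd (α : ℝ) (hα0 : 0 < α) (hα : α ≤ 1 / 4) {Ω : Set R2} (hm : MeasurableSet Ω) {R r : ℝ}
    (hΩ : ∀ y ∈ Ω, ‖y‖ ≤ R) {x : R2} (hx : ‖x‖ ≤ r) :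
    ∫ y in Ω, ‖kern α (x - y)‖ ≤ ∫ w in Metric.ball 0 (r + R + 1), ‖kern α w‖ := by
  have h1 := (integrable_indicator_iff measurableSet_ball).2 (kern_ball α hα0 hα (r + R + 1)).norm
  have h2 := (h1.comp_sub_left x)
  have e := integral_sub_left_eq_self (fun w => (Metric.ball (0:R2) (r + R + 1)).indicator
    (fun w => ‖kern α w‖) w) volume x
  rw [← integral_indicator hm, ← integral_indicator measurableSet_ball, ← e]
  refine integral_mono ((integrable_indicator_iff hm).2 (kern_int α hα0 hα hm hΩ x).norm) h2 ?_
  intro y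
  simp only
  by_cases hy : y ∈ Ω
  · rw [indicator_of_mem hy, indicator_of_mem (sub_mem_ball hΩ hx hy)]
  · rw [indicator_of_notMem hy]
    exact indicator_nonneg (fun _ _ => norm_nonneg _) _

theorem Crv.null {γ M c : ℝ} {p p' : ℝ → R2} (h : Crv γ M c p p') : volume (range p) = 0 := by
  set L : R2 →L[ℝ] ℝ := EuclideanSpace.proj 0
  set f : R2 → R2 := fun v => p (L v)
  have hs : volume {v : R2 | v 1 = 0} = 0 := by
    have := Measure.addHaar_submodule (volume : Measure R2)
      (LinearMap.ker (EuclideanSpace.proj 1 : R2 →L[ℝ] ℝ).toLinearMap) (by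
        intro htop
        have : mk2 0 1 ∈ (LinearMap.ker (EuclideanSpace.proj 1 : R2 →L[ℝ] ℝ).toLinearMap) := by
          rw [htop]; trivial
        rw [LinearMap.mem_ker] at this
        simp [mk2] at this)
    convert this using 2
    ext v; simp
  have := addHaar_image_eq_zero_of_differentiableOn_of_addHaar_eq_zero (volume : Measure R2)
    (f := f) (s := {v : R2 | v 1 = 0}) (fun v _ => by
      have h1 := (h.der (L v)).differentiableAt
      exact (h1.comp v L.differentiableAt).differentiableWithinAt) hs
  refine measure_mono_null ?_ this
  rintro _ ⟨ξ, rfl⟩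
  refine ⟨mk2 ξ 0, ?_, ?_⟩
  · simp [mk2]
  · simp [f, L, mk2]

theorem vel_cont (α : ℝ) (hα0 : 0 < α) (hα : α ≤ 1 / 4) {Ω : Set R2} (ho : IsOpen Ω) {R : ℝ}
    (hΩ : ∀ y ∈ Ω, ‖y‖ ≤ R) (hfr : volume (frontier Ω) = 0) :
    Continuous fun x => ∫ y in Ω, kern α (x - y) := by
  rw [continuous_iff_continuousAt]
  intro x0
  have e : (fun x => ∫ y in Ω, kern α (x - y)) =
      fun x => ∫ w, ((fun w => x - w) ⁻¹' Ω).indicator (kern α) w := by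
    funext x
    rw [← integral_indicator ho.measurableSet, ← integral_sub_left_eq_self _ volume x]
    congr 1
    funext w
    by_cases hw : x - w ∈ Ω
    · rw [indicator_of_mem hw, indicator_of_mem (by exact hw)]; simp
    · rw [indicator_of_notMem hw, indicator_of_notMem (by exact hw)]
  rw [e]
  refine continuousAt_of_dominated (bound := (Metric.ball 0 (‖x0‖ + 1 + R + 1)).indicator
    fun w => ‖kern α w‖) ?_ ?_ ?_ ?_
  · filter_upwards with x
    refine ((kern_meas α).indicator ?_).aestronglyMeasurable
    exact (ho.preimage (by fun_prop)).measurableSet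
  · have : ∀ᶠ x in nhds x0, ‖x‖ < ‖x0‖ + 1 :=
      continuous_norm.continuousAt.eventually (gt_mem_nhds (by linarith))
    filter_upwards [this] with x hx
    filter_upwards with w
    by_cases hw : x - w ∈ Ω
    · have := sub_mem_ball hΩ hx.le hw
      rw [sub_sub_cancel] at this
      rw [indicator_of_mem (by exact hw), indicator_of_mem this]
    · rw [indicator_of_notMem (by exact hw), norm_zero]
      exact indicator_nonneg (fun _ _ => norm_nonneg _) _
  · exact (integrable_indicator_iff measurableSet_ball).2 (kern_ball α hα0 hα _).norm
  · have hn : ∀ᵐ w : R2, x0 - w ∉ frontier Ω := by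
      have h1 : ∀ᵐ w : R2, w ∉ frontier Ω := by
        rw [ae_iff]; simpa using hfr
      have := (Measure.measurePreserving_sub_left (volume : Measure R2) x0).quasiMeasurePreserving.ae h1
      exact this
    filter_upwards [hn] with w hw
    have hc : Continuous fun x : R2 => x - w := by fun_prop
    by_cases hw0 : x0 - w ∈ Ω
    · have : ∀ᶠ x in nhds x0, x - w ∈ Ω := hc.continuousAt.eventually (ho.mem_nhds hw0)
      refine (continuousAt_const (y := kern α w)).congr ?_
      filter_upwards [this] with x hx
      rw [indicator_of_mem (by exact hx)]
    · have hcl : x0 - w ∉ closure Ω := by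
        intro hcl; apply hw; rw [ho.frontier_eq]; exact ⟨hcl, hw0⟩
      have : ∀ᶠ x in nhds x0, x - w ∈ (closure Ω)ᶜ :=
        hc.continuousAt.eventually (isClosed_closure.isOpen_compl.mem_nhds hcl)
      refine (continuousAt_const (y := (0:R2))).congr ?_
      filter_upwards [this] with x hx
      rw [indicator_of_notMem]
      intro hx'; exact hx (subset_closure hx')

namespace Crv
variable {γ M c c1 : ℝ} {p p' q q' : ℝ → R2} {Ω : Set R2}

theorem flux_pt (h : Crv γ M c p p') (hγ : 0 < γ) {α : ℝ} (hα0 : 0 < α) {y : R2} (hy : y ∉ range p) :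
    ∫ ξ in (0:ℝ)..(2 * π), inner ℝ (perp (kern α (p ξ - y))) (p' ξ) = 0 := by
  have hne : ∀ ξ, p ξ - y ≠ 0 := fun ξ h0 => hy ⟨ξ, sub_eq_zero.1 h0⟩
  have hpos : ∀ ξ, 0 < ‖p ξ - y‖ := fun ξ => norm_pos_iff.2 (hne ξ)
  have hd : ∀ ξ ∈ uIcc 0 (2 * π), HasDerivAt (fun ξ => (‖p ξ - y‖ ^ 2) ^ (-α) / (2 * α))
      (inner ℝ (perp (kern α (p ξ - y))) (p' ξ)) ξ := by
    intro ξ _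
    have h1 := ((h.der ξ).sub_const y).norm_sq
    have h2 := (h1.rpow_const (p := -α) (Or.inl (by have := hpos ξ; positivity))).div_const (2 * α)
    refine h2.congr_deriv ?_
    symm
    have hk : kern α (p ξ - y) = (‖p ξ - y‖ ^ (2 + 2 * α))⁻¹ • perp (p ξ - y) := rfl
    rw [hk, perp_smul, perp_perp, inner_smul_left, inner_neg_left]
    have h3 : (‖p ξ - y‖ ^ 2) ^ (-α - 1) = (‖p ξ - y‖ ^ (2 + 2 * α))⁻¹ := by
      rw [← Real.rpow_natCast, ← Real.rpow_mul (hpos ξ).le, ← Real.rpow_neg (hpos ξ).le]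
      congr 1; push_cast; ring
    rw [h3]
    simp only [conj_trivial]
    field_simp
  rw [intervalIntegral.integral_eq_sub_of_hasDerivAt hd]
  · have := h.per 0
    rw [zero_add] at this
    rw [this, sub_self]
  · apply Continuous.intervalIntegrable
    have h1 := h.cont
    have h2 := h.cont' hγ
    unfold kern
    have h3 : Continuous fun ξ => (‖p ξ - y‖ ^ (2 + 2 * α))⁻¹ := by
      refine Continuous.inv₀ ?_ fun ξ => (Real.rpow_pos_of_pos (hpos ξ) _).ne'
      exact Continuous.rpow_const (by fun_prop) fun ξ => Or.inl (hpos ξ).ne'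
    have h4 : Continuous fun ξ => perp (p ξ - y) := continuous_perp.comp (by fun_prop)
    exact (continuous_perp.comp (h3.smul h4)).inner h2

theorem flux (h : Crv γ M c p p') (hγ : 0 < γ) {α : ℝ} (hα0 : 0 < α) (hα : α ≤ 1 / 4)
    (hm : MeasurableSet Ω) {R : ℝ} (hΩ : ∀ y ∈ Ω, ‖y‖ ≤ R) :
    ∫ ξ in (0:ℝ)..(2 * π), inner ℝ (perp (∫ y in Ω, kern α (p ξ - y))) (p' ξ) = 0 := by
  have hp := Real.pi_pos
  have hperpL : ∀ ξ, inner ℝ (perp (∫ y in Ω, kern α (p ξ - y))) (p' ξ) =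
      ∫ y in Ω, inner ℝ (perp (kern α (p ξ - y))) (p' ξ) := by
    intro ξ
    have e : ∀ v w : R2, inner ℝ (perp v) w = -inner ℝ (perp w) v := fun v w => by
      rw [inner2, inner2, perp_0, perp_0, perp_1, perp_1]; ring
    rw [e]
    simp only [e _ (p' ξ)]
    rw [integral_neg, integral_inner (kern_int α hα0 hα hm hΩ (p ξ))]
  simp only [hperpL]
  rw [intervalIntegral.integral_of_le (by positivity)]
  have hmeas : Measurable (Function.uncurry fun (ξ : ℝ) (y : R2) =>
      inner ℝ (perp (kern α (p ξ - y))) (p' ξ)) := by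
    have h1 : Measurable fun a : ℝ × R2 => perp (kern α (p a.1 - a.2)) := by
      refine continuous_perp.measurable.comp ((kern_meas α).comp ?_)
      have := h.cont; exact Continuous.measurable (by fun_prop)
    have h2 : Measurable fun a : ℝ × R2 => p' a.1 := (h.cont' hγ).measurable.comp measurable_fst
    exact h1.inner h2
  have hbd : ∀ ξ y, ‖inner ℝ (perp (kern α (p ξ - y))) (p' ξ)‖ ≤ M * ‖kern α (p ξ - y)‖ := by
    intro ξ y
    rw [Real.norm_eq_abs]
    refine (abs_inner_le _ _).trans ?_
    rw [norm_perp, h.speed, mul_comm]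
    exact mul_le_mul_of_nonneg_right h.spM (norm_nonneg _)
  have hI : ∀ ξ, IntegrableOn (fun y => inner ℝ (perp (kern α (p ξ - y))) (p' ξ)) Ω := fun ξ => by
    refine ((kern_int α hα0 hα hm hΩ (p ξ)).norm.const_mul M).mono' ?_ ?_
    · exact (hmeas.comp (measurable_prodMk_left (x := ξ))).aestronglyMeasurable
    · filter_upwards with y; exact hbd ξ y
  rw [integral_integral_swap]
  · apply integral_eq_zero_of_ae
    have h1 : ∀ᵐ y : R2, y ∉ range p := by exact measure_eq_zero_iff_ae_notMem.1 h.null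
    filter_upwards [ae_restrict_of_ae h1] with y hy
    have := h.flux_pt hγ hα0 hy
    rwa [intervalIntegral.integral_of_le (by positivity)] at this
  · rw [integrable_prod_iff hmeas.aestronglyMeasurable]
    constructor
    · filter_upwards with ξ; exact hI ξ
    · refine Integrable.mono' (integrable_const
        (M * ∫ w in Metric.ball 0 (M + R + 1), ‖kern α w‖)) ?_ ?_
      · exact hmeas.aestronglyMeasurable.norm.integral_prod_right'
      · filter_upwards with ξ
        rw [Real.norm_of_nonneg (integral_nonneg fun _ => norm_nonneg _)]
        calc _ ≤ ∫ y in Ω, M * ‖kern α (p ξ - y)‖ :=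
              integral_mono (hI ξ).norm ((kern_int α hα0 hα hm hΩ (p ξ)).norm.const_mul M)
                (fun y => hbd ξ y)
          _ = M * ∫ y in Ω, ‖kern α (p ξ - y)‖ := integral_const_mul _ _
          _ ≤ _ := mul_le_mul_of_nonneg_left (kern_int_bd α hα0 hα hm hΩ (h.bd ξ)) h.M_nonneg

end Crv

/-! ### Area of nearby curves -/

/-- Cross product. -/
def X2 (v w : R2) : ℝ := inner ℝ (perp v) w

theorem X2_def (v w : R2) : X2 v w = v 0 * w 1 - v 1 * w 0 := (cross_eq v w).symm

theorem X2_le (v w : R2) : |X2 v w| ≤ ‖v‖ * ‖w‖ := by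
  have := abs_inner_le (perp v) w
  rwa [norm_perp] at this

theorem X2_le' {v w : R2} {a b : ℝ} (hv : ‖v‖ ≤ a) (hw : ‖w‖ ≤ b) : |X2 v w| ≤ a * b :=
  (X2_le v w).trans (mul_le_mul hv hw (norm_nonneg _) ((norm_nonneg _).trans hv))

theorem X2_cont {X : Type*} [TopologicalSpace X] {f g : X → R2} (hf : Continuous f) (hg : Continuous g) :
    Continuous fun x => X2 (f x) (g x) := (continuous_perp.comp hf).inner hg

namespace Crv
variable {γ M c c1 : ℝ} {p p' q q' : ℝ → R2} {Ω : Set R2}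

theorem int_const (h : Crv γ M c p p') (hγ : 0 < γ) (v : R2) (a b : ℝ) :
    ∫ s in a..b, X2 v (p' s) = X2 v (p b - p a) := by
  have hd : ∀ s ∈ uIcc a b, HasDerivAt (fun s => X2 v (p s)) (X2 v (p' s)) s := fun s _ => by
    have := (hasDerivAt_const s (perp v)).inner ℝ (h.der s)
    refine this.congr_deriv ?_
    simp [X2]
  rw [intervalIntegral.integral_eq_sub_of_hasDerivAt hd
    ((X2_cont continuous_const (h.cont' hγ)).intervalIntegrable _ _)]
  simp only [X2, inner_sub_right]

theorem poly_err (h : Crv γ M c p p') (hγ : 0 < γ) (a b : ℝ) :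
    |(∫ s in a..b, X2 (p s) (p' s)) - X2 (p a) (p b)| ≤ 2 * M ^ 2 * |b - a| ^ (2 + γ) := by
  have hM := h.M_nonneg
  have e1 : X2 (p a) (p b) = ∫ s in a..b, X2 (p a) (p' s) := by
    rw [h.int_const hγ]; simp only [X2_def, PiLp.sub_apply]; ring
  rw [e1, ← intervalIntegral.integral_sub ((X2_cont h.cont (h.cont' hγ)).intervalIntegrable _ _)
    ((X2_cont continuous_const (h.cont' hγ)).intervalIntegrable _ _)]
  rcases eq_or_ne a b with hab | hab
  · subst hab
    simp only [intervalIntegral.integral_same, abs_zero]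
    positivity
  have hpos : 0 < |b - a| := abs_pos.2 (sub_ne_zero.2 hab.symm)
  have := intervalIntegral.norm_integral_le_of_norm_le_const (a := a) (b := b)
    (f := fun s => X2 (p s) (p' s) - X2 (p a) (p' s)) (C := 2 * M ^ 2 * |b - a| ^ (1 + γ)) (by
      intro s hs
      have hsa : |s - a| ≤ |b - a| := by
        rw [abs_sub_comm s, abs_sub_comm b]
        rcases le_total a b with h' | h'
        · rw [uIoc_of_le h'] at hs
          rw [abs_of_nonpos (by linarith [hs.1]), abs_of_nonpos (by linarith)]; linarith [hs.2]
        · rw [uIoc_of_ge h'] at hs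
          rw [abs_of_nonneg (by linarith [hs.2]), abs_of_nonneg (by linarith)]; linarith [hs.1]
      have e2 : X2 (p s) (p' s) - X2 (p a) (p' s) =
          X2 (p s - p a - (s - a) • p' a) (p' s) + (s - a) * X2 (p' a) (p' s - p' a) := by
        simp only [X2_def, PiLp.sub_apply, PiLp.smul_apply, smul_eq_mul]; ring
      rw [e2, Real.norm_eq_abs]
      have b1 := X2_le' (h.taylor hγ s a) ((h.speed s).le.trans h.spM)
      have b2 := X2_le' ((h.speed a).le.trans h.spM) (h.hol s a)
      have m1 : |s - a| ^ (1 + γ) ≤ |b - a| ^ (1 + γ) :=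
        Real.rpow_le_rpow (abs_nonneg _) hsa (by linarith)
      have m2 : |s - a| ^ γ ≤ |b - a| ^ γ := Real.rpow_le_rpow (abs_nonneg _) hsa hγ.le
      have m3 : |b - a| ^ (1 + γ) = |b - a| * |b - a| ^ γ := by
        rw [Real.rpow_add hpos, Real.rpow_one]
      calc _ ≤ |X2 (p s - p a - (s - a) • p' a) (p' s)| + |(s - a) * X2 (p' a) (p' s - p' a)| :=
            abs_add_le _ _
        _ ≤ M * |b - a| ^ (1 + γ) * M + |b - a| * (M * (M * |b - a| ^ γ)) := by
            rw [abs_mul]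
            refine add_le_add (b1.trans ?_) (mul_le_mul hsa (b2.trans ?_) (abs_nonneg _) (abs_nonneg _))
            · gcongr
            · gcongr
        _ = _ := by rw [m3]; ring)
  rw [Real.norm_eq_abs] at this
  refine this.trans (le_of_eq ?_)
  rw [show 2 + γ = (1 + γ) + 1 by ring, Real.rpow_add hpos (1 + γ), Real.rpow_one]; ring

theorem edge_err (h : Crv γ M c p p') (hγ : 0 < γ) {u : R2 → R2} (hu : Continuous u) {a b e : ℝ}
    (w v : R2) {hh : ℝ} (hh0 : 0 ≤ hh) (he : 0 ≤ e) (hw : ‖w - hh • v‖ ≤ e * hh)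
    (hosc : ∀ s ∈ uIcc a b, ‖v - u (p s)‖ ≤ e) :
    |X2 w (p b - p a) - hh * ∫ s in a..b, X2 (u (p s)) (p' s)| ≤ 2 * e * M * hh * |b - a| := by
  have hM := h.M_nonneg
  have hcu : Continuous fun s => X2 (u (p s)) (p' s) := X2_cont (hu.comp h.cont) (h.cont' hγ)
  have i1 := hcu.intervalIntegrable (μ := volume) a b
  have i2 := (X2_cont (continuous_const (y := v)) (h.cont' hγ)).intervalIntegrable (μ := volume) a b
  have e1 : X2 w (p b - p a) - hh * ∫ s in a..b, X2 (u (p s)) (p' s) =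
      X2 (w - hh • v) (p b - p a) + hh * ∫ s in a..b, (X2 v (p' s) - X2 (u (p s)) (p' s)) := by
    rw [intervalIntegral.integral_sub i2 i1, h.int_const hγ]
    simp only [X2_def, PiLp.sub_apply, PiLp.smul_apply, smul_eq_mul]; ring
  have b1 := X2_le' hw (h.lip b a)
  have b2 := intervalIntegral.norm_integral_le_of_norm_le_const (a := a) (b := b)
    (f := fun s => X2 v (p' s) - X2 (u (p s)) (p' s)) (C := e * M) (by
      intro s hs
      have e2 : X2 v (p' s) - X2 (u (p s)) (p' s) = X2 (v - u (p s)) (p' s) := by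
        simp only [X2_def, PiLp.sub_apply]; ring
      rw [e2, Real.norm_eq_abs]
      exact X2_le' (hosc s (uIoc_subset_uIcc hs)) ((h.speed s).le.trans h.spM))
  rw [Real.norm_eq_abs] at b2
  rw [e1]
  refine (abs_add_le _ _).trans ?_
  rw [abs_mul, abs_of_nonneg hh0]
  nlinarith [mul_le_mul_of_nonneg_left b2 hh0]

theorem area_poly (h : Crv γ M c p p') (hγ : 0 < γ) (hq : Crv γ M c1 q q') {u : R2 → R2}
    (hu : Continuous u) {U L e r hh : ℝ} (hU : ∀ s, ‖u (p s)‖ ≤ U) (hL : 0 ≤ L)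
    (hfl : ∫ s in (0:ℝ)..(2 * π), X2 (u (p s)) (p' s) = 0) (he : 0 ≤ e) (he1 : e ≤ 1)
    (hosc : ∀ s s', |s - s'| ≤ r → ‖u (p s) - u (p s')‖ ≤ e) (hh0 : 0 < hh) (hr : L * hh ≤ r)
    {m : ℕ} (hm : 0 < m) (hmh : 2 * π / m ≤ hh) (hmh2 : m * hh ≤ 8) (φ : ℕ → ℝ)
    (hφ : φ m = φ 0 + 2 * π) (hφL : ∀ i < m, |φ (i + 1) - φ i| ≤ L * hh)
    (hQ : ∀ i ≤ m, ‖q (2 * π * i / m) - p (φ i) - hh • u (p (φ i))‖ ≤ e * hh) :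
    |area q q' - area p p'| ≤ 8 * (2 * M ^ 2 * (1 + L ^ (2 + γ)) * hh ^ (1 + γ) +
      (4 * e * M * L + 3 * e * (U + 1)) * hh) := by
  have hp := Real.pi_pos
  have hM := h.M_nonneg
  have hm' : (0:ℝ) < m := by exact_mod_cast hm
  have hU0 : 0 ≤ U := (norm_nonneg _).trans (hU 0)
  set x : ℕ → ℝ := fun i => 2 * π * i / m with hx
  have hcq := X2_cont hq.cont (hq.cont' hγ)
  have hcp := X2_cont h.cont (h.cont' hγ)
  have hcu : Continuous fun s => X2 (u (p s)) (p' s) := X2_cont (hu.comp h.cont) (h.cont' hγ)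
  have sq : area q q' = ∑ i ∈ Finset.range m, ∫ s in x i..x (i + 1), X2 (q s) (q' s) := by
    rw [intervalIntegral.sum_integral_adjacent_intervals (fun k _ => hcq.intervalIntegrable _ _)]
    rw [area_eq]
    have : x m = 2 * π := by simp only [hx]; field_simp
    rw [this]; simp [hx, X2]
  have sp : area p p' = ∑ i ∈ Finset.range m, ∫ s in φ i..φ (i + 1), X2 (p s) (p' s) := by
    rw [intervalIntegral.sum_integral_adjacent_intervals (fun k _ => hcp.intervalIntegrable _ _), hφ]
    rw [area_eq]
    have := h.perX.intervalIntegral_add_eq 0 (φ 0)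
    rw [zero_add] at this
    exact this
  have su : 0 = ∑ i ∈ Finset.range m, ∫ s in φ i..φ (i + 1), X2 (u (p s)) (p' s) := by
    rw [intervalIntegral.sum_integral_adjacent_intervals (fun k _ => hcu.intervalIntegrable _ _), hφ]
    have hper : Function.Periodic (fun s => X2 (u (p s)) (p' s)) (2 * π) := fun s => by
      simp only [h.per, h.per']
    have := hper.intervalIntegral_add_eq 0 (φ 0)
    rw [zero_add] at this
    rw [← this]
    exact hfl.symm
  set W : ℕ → R2 := fun i => q (x i) - p (φ i) with hW
  set G : ℕ → ℝ := fun i => X2 (W i) (p (φ i)) with hG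
  have sG : 0 = ∑ i ∈ Finset.range m, (G (i + 1) - G i) := by
    rw [Finset.sum_range_sub]
    have h1 : q (x m) = q (x 0) := by
      have e1 : x m = x 0 + 2 * π := by simp only [hx]; field_simp; simp
      rw [e1, hq.per]
    have h2 : p (φ m) = p (φ 0) := by rw [hφ, h.per]
    simp only [hG, hW]
    rw [h1, h2, sub_self]
  have key : area q q' - area p p' = ∑ i ∈ Finset.range m,
      ((∫ s in x i..x (i + 1), X2 (q s) (q' s)) - (∫ s in φ i..φ (i + 1), X2 (p s) (p' s))
        + (G (i + 1) - G i) - 2 * hh * ∫ s in φ i..φ (i + 1), X2 (u (p s)) (p' s)) := by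
    rw [Finset.sum_sub_distrib, Finset.sum_add_distrib, Finset.sum_sub_distrib, ← Finset.mul_sum,
      ← sG, ← su, ← sq, ← sp]; ring
  have hedge : ∀ i ∈ Finset.range m,
      ‖(∫ s in x i..x (i + 1), X2 (q s) (q' s)) - (∫ s in φ i..φ (i + 1), X2 (p s) (p' s))
        + (G (i + 1) - G i) - 2 * hh * ∫ s in φ i..φ (i + 1), X2 (u (p s)) (p' s)‖ ≤
      (2 * M ^ 2 * (1 + L ^ (2 + γ)) * hh ^ (1 + γ) +
      (4 * e * M * L + 3 * e * (U + 1)) * hh) * hh := by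
    intro i hi
    have hi := Finset.mem_range.1 hi
    have hΔ := hφL i hi
    have hxx : |x (i + 1) - x i| ≤ hh := by
      have : x (i + 1) - x i = 2 * π / m := by simp only [hx]; push_cast; field_simp; ring
      rw [this, abs_of_nonneg (by positivity)]; exact hmh
    have hWi : ∀ k ≤ m, ‖W k‖ ≤ (U + 1) * hh := fun k hk => by
      have h1 := hQ k hk
      have h2 : W k = (q (2 * π * k / m) - p (φ k) - hh • u (p (φ k))) + hh • u (p (φ k)) := by
        simp [hW, hx]
      rw [h2]
      refine (norm_add_le _ _).trans ?_
      rw [norm_smul, Real.norm_of_nonneg hh0.le]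
      nlinarith [hU (φ k)]
    have hQ1 := hQ i hi.le
    have hQ2 := hQ (i + 1) hi
    have hWW : ‖W (i + 1) - W i‖ ≤ 3 * e * hh := by
      have h2 : W (i + 1) - W i =
        (q (2 * π * (i + 1 : ℕ) / m) - p (φ (i + 1)) - hh • u (p (φ (i + 1)))) -
        (q (2 * π * i / m) - p (φ i) - hh • u (p (φ i))) + hh • (u (p (φ (i + 1))) - u (p (φ i))) := by
        simp only [hW, hx, smul_sub]; abel
      rw [h2]
      refine (norm_add_le _ _).trans ?_
      have h3 := norm_sub_le (q (2 * π * (i + 1 : ℕ) / m) - p (φ (i + 1)) - hh • u (p (φ (i + 1))))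
        (q (2 * π * i / m) - p (φ i) - hh • u (p (φ i)))
      rw [norm_smul, Real.norm_of_nonneg hh0.le]
      have := hosc (φ (i + 1)) (φ i) (hΔ.trans hr)
      nlinarith
    have E1 := hq.poly_err hγ (x i) (x (i + 1))
    have E2 := h.poly_err hγ (φ i) (φ (i + 1))
    have hin : ∀ s ∈ uIcc (φ i) (φ (i + 1)), |φ i - s| ≤ r ∧ |φ (i + 1) - s| ≤ r := by
      intro s hs
      have h1 := abs_sub_left_of_mem_uIcc hs
      have h2 := abs_sub_right_of_mem_uIcc hs
      rw [abs_sub_comm s] at h1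
      constructor <;> linarith
    have E3 := h.edge_err hγ hu (W i) (u (p (φ i))) hh0.le he hQ1
      (fun s hs => hosc (φ i) s (hin s hs).1)
    have E4 := h.edge_err hγ hu (W (i + 1)) (u (p (φ (i + 1)))) hh0.le he hQ2
      (fun s hs => hosc (φ (i + 1)) s (hin s hs).2)
    have E5 := X2_le' (hWi i hi.le) hWW
    have id : X2 (q (x i)) (q (x (i + 1))) - X2 (p (φ i)) (p (φ (i + 1))) + (G (i + 1) - G i) =
        X2 (W i) (p (φ (i + 1)) - p (φ i)) + X2 (W (i + 1)) (p (φ (i + 1)) - p (φ i)) +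
        X2 (W i) (W (i + 1) - W i) := by
      simp only [hG, hW, X2_def, PiLp.sub_apply]; ring
    have B1 : |x (i + 1) - x i| ^ (2 + γ) ≤ hh ^ (1 + γ) * hh := by
      refine (Real.rpow_le_rpow (abs_nonneg _) hxx (by linarith)).trans (le_of_eq ?_)
      rw [show 2 + γ = (1 + γ) + 1 by ring, Real.rpow_add hh0 (1 + γ), Real.rpow_one]
    have B2 : |φ (i + 1) - φ i| ^ (2 + γ) ≤ L ^ (2 + γ) * (hh ^ (1 + γ) * hh) := by
      refine (Real.rpow_le_rpow (abs_nonneg _) hΔ (by linarith)).trans (le_of_eq ?_)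
      rw [Real.mul_rpow hL hh0.le]
      rw [show hh ^ (2 + γ) = hh ^ (1 + γ) * hh by
        rw [show 2 + γ = (1 + γ) + 1 by ring, Real.rpow_add hh0 (1 + γ), Real.rpow_one]]
    have B3 : 2 * e * M * hh * |φ (i + 1) - φ i| ≤ 2 * e * M * hh * (L * hh) :=
      mul_le_mul_of_nonneg_left hΔ (by positivity)
    have B1' := mul_le_mul_of_nonneg_left B1 (by positivity : 0 ≤ 2 * M ^ 2)
    have B2' := mul_le_mul_of_nonneg_left B2 (by positivity : 0 ≤ 2 * M ^ 2)
    rw [Real.norm_eq_abs]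
    rw [abs_le] at E1 E2 E3 E4 E5 ⊢
    obtain ⟨E1a, E1b⟩ := E1
    obtain ⟨E2a, E2b⟩ := E2
    obtain ⟨E3a, E3b⟩ := E3
    obtain ⟨E4a, E4b⟩ := E4
    obtain ⟨E5a, E5b⟩ := E5
    have hR : (2 * M ^ 2 * (1 + L ^ (2 + γ)) * hh ^ (1 + γ) +
      (4 * e * M * L + 3 * e * (U + 1)) * hh) * hh = 2 * M ^ 2 * (hh ^ (1 + γ) * hh) +
      2 * M ^ 2 * (L ^ (2 + γ) * (hh ^ (1 + γ) * hh)) + 2 * (2 * e * M * hh * (L * hh)) +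
      (U + 1) * hh * (3 * e * hh) := by ring
    rw [hR]
    have hJ : 2 * hh * (∫ s in φ i..φ (i + 1), X2 (u (p s)) (p' s)) =
      hh * (∫ s in φ i..φ (i + 1), X2 (u (p s)) (p' s)) +
      hh * (∫ s in φ i..φ (i + 1), X2 (u (p s)) (p' s)) := by ring
    rw [hJ]
    clear hR hJ hQ hosc hφL sG su sq sp key hWi hin hfl
    constructor <;> linarith only [E1a, E1b, E2a, E2b, E3a, E3b, E4a, E4b, E5a, E5b, id, B1', B2', B3]
  rw [key]
  have hs := norm_sum_le_of_le _ hedge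
  rw [Real.norm_eq_abs, Finset.sum_const, Finset.card_range, nsmul_eq_mul] at hs
  refine hs.trans ?_
  have hnn : 0 ≤ 2 * M ^ 2 * (1 + L ^ (2 + γ)) * hh ^ (1 + γ) +
      (4 * e * M * L + 3 * e * (U + 1)) * hh := by positivity
  nlinarith [mul_le_mul_of_nonneg_left hmh2 hnn]

end Crv

/-! ### Matching of boundary points, conservation of area -/

theorem Bdy.ball {γ M c : ℝ} {p p' : ℝ → R2} {Ω : Set R2} (hB : Bdy p Ω) (h : Crv γ M c p p') :
    ∀ y ∈ Ω, ‖y‖ ≤ M := by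
  intro y hy
  by_contra hcon
  push Not at hcon
  have hM := h.M_nonneg
  have hy0 : 0 < ‖y‖ := lt_of_le_of_lt hM hcon
  have hsub : (fun s : ℝ => s • y) '' Ici 1 ⊆ Ω := by
    refine pre_sub ?_ hB.op ?_ (x := y) ⟨1, by simp, by simp⟩ hy
    · exact isPreconnected_Ici.image _ (by fun_prop)
    · rintro _ ⟨s, hs, rfl⟩ hfr
      rw [← hB.fr] at hfr
      obtain ⟨ξ, hξ⟩ := hfr
      have h1 := h.bd ξ
      simp only at hξ
      rw [hξ, norm_smul, Real.norm_of_nonneg (by linarith [mem_Ici.1 hs])] at h1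
      nlinarith [mem_Ici.1 hs]
  obtain ⟨R, hR⟩ := hB.bdd.exists_norm_le
  have hR0 : ‖y‖ ≤ R := hR y hy
  have hRy : 0 ≤ R / ‖y‖ := by apply div_nonneg <;> linarith
  have := hR _ (hsub ⟨R / ‖y‖ + 1, by simp only [mem_Ici]; linarith, rfl⟩)
  simp only at this
  rw [norm_smul, Real.norm_of_nonneg (by linarith), add_mul, div_mul_cancel₀ _ hy0.ne'] at this
  linarith

theorem pos_dist {A B : Set R2} (hA : IsCompact A) (hB : IsCompact B) (hd : Disjoint A B) :
    ∃ ρ > 0, ∀ a ∈ A, ∀ b ∈ B, ρ ≤ ‖a - b‖ := by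
  obtain ⟨ρ, hρ, h⟩ := hd.exists_thickenings hA hB.isClosed
  refine ⟨ρ, hρ, fun a ha b hb => ?_⟩
  by_contra hcon
  push Not at hcon
  refine Set.disjoint_left.1 h (show a ∈ _ from Metric.mem_thickening_iff.2 ⟨a, ha, ?_⟩)
    (Metric.mem_thickening_iff.2 ⟨b, hb, ?_⟩)
  · simpa using hρ
  · rwa [dist_eq_norm]

namespace Sol
variable {α γ T cα M : ℝ} {N : ℕ} {θ : Fin N → ℝ} {Ω : Fin N → ℝ → Set R2}
    {p p' : Fin N → ℝ → ℝ → R2} {c : Fin N → ℝ → ℝ}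

theorem velc (S : Sol α γ T cα M N θ Ω p p' c) {t : ℝ} (ht : t ∈ Ico 0 T) :
    Continuous (gSQGvel α cα θ fun n => Ω n t) := by
  unfold gSQGvel
  have h1 : ∀ n, Continuous fun x => ∫ y in Ω n t, kern α (x - y) := fun n => by
    refine vel_cont α S.hα0 S.hα (S.bdy n t ht).op ((S.bdy n t ht).ball (S.crv n t ht)) ?_
    rw [S.fr ht]; exact (S.crv n t ht).null
  fun_prop

theorem bigcpt (S : Sol α γ T cα M N θ Ω p p' c) {t : ℝ} (ht : t ∈ Ico 0 T) :
    IsCompact (⋃ n, range (p n t)) := isCompact_iUnion fun n => (S.crv n t ht).cpt_range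

theorem velbd (S : Sol α γ T cα M N θ Ω p p' c) {t : ℝ} (ht : t ∈ Ico 0 T) :
    ∃ U ≥ 0, ∀ n ξ, ‖gSQGvel α cα θ (fun n => Ω n t) (p n t ξ)‖ ≤ U := by
  obtain ⟨U, hU⟩ := ((S.bigcpt ht).image (S.velc ht)).isBounded.exists_norm_le
  refine ⟨max U 0, le_max_right _ _, fun n ξ => (hU _ ⟨p n t ξ, ?_, rfl⟩).trans (le_max_left _ _)⟩
  exact mem_iUnion.2 ⟨n, ξ, rfl⟩

theorem sep (S : Sol α γ T cα M N θ Ω p p' c) {t : ℝ} (ht : t ∈ Ico 0 T) (n : Fin N) :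
    ∃ ρ > 0, ∀ j, n ≠ j → ∀ ξ η, ρ ≤ ‖p n t ξ - p j t η‖ := by
  have h1 : ∀ j : Fin N, ∃ ρ > 0, n ≠ j → ∀ ξ η, ρ ≤ ‖p n t ξ - p j t η‖ := fun j => by
    by_cases hj : n = j
    · exact ⟨1, one_pos, fun h => absurd hj h⟩
    · obtain ⟨ρ, hρ, h⟩ := pos_dist (S.crv n t ht).cpt_range (S.crv j t ht).cpt_range (by
        rw [Set.disjoint_left]
        rintro _ ⟨ξ, rfl⟩ ⟨η, hη⟩
        exact S.disj t ht n j hj ξ η hη.symm)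
      exact ⟨ρ, hρ, fun _ ξ η => h _ ⟨ξ, rfl⟩ _ ⟨η, rfl⟩⟩
  have h2 : ∀ᶠ ρ in nhdsWithin (0:ℝ) (Ioi 0), ∀ j, n ≠ j → ∀ ξ η, ρ ≤ ‖p n t ξ - p j t η‖ := by
    rw [eventually_all]
    intro j
    obtain ⟨ρ, hρ, h⟩ := h1 j
    filter_upwards [Ioo_mem_nhdsGT hρ] with r hr hj ξ η
    exact hr.2.le.trans (h hj ξ η)
  obtain ⟨ρ, h3, h4⟩ := (h2.and self_mem_nhdsWithin).exists
  exact ⟨ρ, h4, h3⟩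

theorem tplus {t : ℝ} (ht : t ∈ Ioo 0 T) :
    Tendsto (fun h => t + h) (nhdsWithin 0 (Ioi 0)) (nhdsWithin t (Ico 0 T)) := by
  refine tendsto_nhdsWithin_iff.2 ⟨?_, ?_⟩
  · have : Tendsto (fun h : ℝ => t + h) (nhds 0) (nhds (t + 0)) := (continuous_const.add continuous_id).tendsto 0
    rw [add_zero] at this
    exact this.mono_left nhdsWithin_le_nhds
  · filter_upwards [Ioo_mem_nhdsGT (sub_pos.2 ht.2)] with h hh
    constructor <;> linarith [hh.1, hh.2, ht.1]

theorem mtch (S : Sol α γ T cα M N θ Ω p p' c) {t : ℝ} (ht : t ∈ Ioo 0 T) {e s : ℝ} (he : 0 < e)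
    (hs : 0 < s) : ∀ᶠ h in nhdsWithin (0:ℝ) (Ioi 0), t + h ∈ Ico 0 T ∧ ∀ n, ∃ a, ∀ ξ,
      (‖p n (t + h) ξ - p n t (a + ξ)‖ < s ∧ ‖p' n (t + h) ξ - p' n t (a + ξ)‖ < s) ∧
      ∃ φ, |φ - (a + ξ)| ≤ s ∧
        ‖p n (t + h) ξ - p n t φ - h • gSQGvel α cα θ (fun n => Ω n t) (p n t φ)‖ ≤ e * h := by
  have ht' : t ∈ Ico 0 T := ⟨ht.1.le, ht.2⟩
  have hmem : ∀ᶠ h in nhdsWithin (0:ℝ) (Ioi 0), t + h ∈ Ico 0 T :=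
    (tplus ht).eventually self_mem_nhdsWithin
  refine hmem.and ?_
  rw [eventually_all]
  intro n
  obtain ⟨U, hU0, hU⟩ := S.velbd ht'
  obtain ⟨ρ, hρ, hsep⟩ := S.sep ht' n
  obtain ⟨κ, hκ, hac⟩ := (S.crv n t ht').arcchord S.γ0 (S.cpos n t ht') (S.smp n t ht')
  set ε := min s (min ρ (κ * s) / 2) with hε
  have hmin : 0 < min ρ (κ * s) := by positivity
  have hε0 : 0 < ε := by positivity
  have hcl := (tplus ht).eventually (S.close n ht' hε0)
  have hpat := (S.patch t ht).mono_left (y := nhdsWithin (0:ℝ) (Ioi 0)) (by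
    refine nhdsWithin_le_of_mem ?_
    filter_upwards [hmem, self_mem_nhdsWithin] with h h1 h2
    exact ⟨h1, (mem_Ioi.1 h2).ne'⟩)
  have hpat' := hpat.eventually (gt_mem_nhds he)
  have hδ : 0 < min ρ (κ * s) / 2 / (e + U) := by positivity
  filter_upwards [hcl, hpat', hmem, self_mem_nhdsWithin, Ioo_mem_nhdsGT hδ] with h hcl hpat hth hh0 hhs
  obtain ⟨a, ha⟩ := hcl
  have hh0 : 0 < h := hh0
  have hsm : (e + U) * h < min ρ (κ * s) / 2 := by
    have := (lt_div_iff₀ (by positivity)).1 hhs.2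
    linarith
  rw [abs_of_pos hh0, div_lt_iff₀ hh0] at hpat
  refine ⟨a, fun ξ => ⟨⟨(ha ξ).1.trans_le (min_le_left _ _), (ha ξ).2.trans_le (min_le_left _ _)⟩, ?_⟩⟩
  have hbigb : Bornology.IsBounded (⋃ n, frontier (Ω n (t + h))) := by
    have : (⋃ n, frontier (Ω n (t + h))) = ⋃ n, range (p n (t + h)) := by simp only [S.fr hth]
    rw [this]; exact (S.bigcpt hth).isBounded
  have hbigt : (⋃ n, frontier (Ω n t)) = ⋃ n, range (p n t) := by simp only [S.fr ht']
  rw [hbigt] at hpat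
  have hq : p n (t + h) ξ ∈ ⋃ n, frontier (Ω n (t + h)) := by
    rw [mem_iUnion]; refine ⟨n, ?_⟩; rw [S.fr hth]; exact ⟨ξ, rfl⟩
  have hcont : Continuous fun x => x + h • gSQGvel α cα θ (fun n => Ω n t) x := by
    have := S.velc ht'; fun_prop
  obtain ⟨y, ⟨x, hx, rfl⟩, hy⟩ := Metric.exists_dist_lt_of_hausdorffDist_lt hq hpat
    (hausE_ne_top ⟨_, hq⟩ (Set.Nonempty.image _ ⟨p n t 0, mem_iUnion.2 ⟨n, 0, rfl⟩⟩) hbigb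
      ((S.bigcpt ht').image hcont).isBounded)
  obtain ⟨j, φ, rfl⟩ := mem_iUnion.1 hx
  rw [dist_eq_norm] at hy
  have hd1 : ‖p n t (a + ξ) - p j t φ‖ < min ρ (κ * s) := by
    have h1 : p n t (a + ξ) - p j t φ = -(p n (t + h) ξ - p n t (a + ξ)) +
      (p n (t + h) ξ - (p j t φ + h • gSQGvel α cα θ (fun n => Ω n t) (p j t φ))) +
      h • gSQGvel α cα θ (fun n => Ω n t) (p j t φ) := by abel
    have h2 := norm_add₃_le (a := -(p n (t + h) ξ - p n t (a + ξ)))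
      (b := (p n (t + h) ξ - (p j t φ + h • gSQGvel α cα θ (fun n => Ω n t) (p j t φ))))
      (c := h • gSQGvel α cα θ (fun n => Ω n t) (p j t φ))
    rw [← h1, norm_neg, norm_smul, Real.norm_of_nonneg hh0.le] at h2
    have h3 := mul_le_mul_of_nonneg_left (hU j φ) hh0.le
    have h4 := (ha ξ).1.trans_le (min_le_right _ _)
    nlinarith
  have hj : n = j := by
    by_contra hj
    have := hsep j hj (a + ξ) φ
    linarith [min_le_left ρ (κ * s)]
  subst hj
  have h5 := hac (a + ξ) φ
  have h6 : distT (a + ξ) φ < s := by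
    by_contra hcon
    push Not at hcon
    have := mul_le_mul_of_nonneg_left hcon hκ.le
    linarith [min_le_right ρ (κ * s)]
  obtain ⟨k, hk, -⟩ := distT_attained (a + ξ) φ
  refine ⟨φ + 2 * π * (-k : ℤ), ?_, ?_⟩
  · rw [abs_sub_comm]
    push_cast
    rw [show a + ξ - (φ + 2 * π * -k) = a + ξ - φ + 2 * π * k by ring, ← hk]; exact h6.le
  · rw [(S.crv n t ht').perk, sub_sub]; exact hy.le

theorem area_deriv (S : Sol α γ T cα M N θ Ω p p' c) (n : Fin N) {t : ℝ} (ht : t ∈ Ioo 0 T) :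
    HasDerivWithinAt (fun t => area (p n t) (p' n t)) 0 (Ici t) t := by
  have hp := Real.pi_pos
  have hp2 := Real.pi_lt_d2
  have hp3 := Real.pi_gt_three
  have hγ := S.γ0
  have hM := S.hM
  have ht' : t ∈ Ico 0 T := ⟨ht.1.le, ht.2⟩
  have hC := S.crv n t ht'
  obtain ⟨U, hU0, hU⟩ := S.velbd ht'
  obtain ⟨κ, hκ, hac⟩ := hC.arcchord hγ (S.cpos n t ht') (S.smp n t ht')
  set u := gSQGvel α cα θ fun n => Ω n t with hu
  have huc : Continuous u := S.velc ht'
  have hfl : ∫ s in (0:ℝ)..(2 * π), X2 (u (p n t s)) (p' n t s) = 0 := by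
    have h1 : ∀ s, X2 (u (p n t s)) (p' n t s) = cα * ∑ j, θ j *
        inner ℝ (perp (∫ y in Ω j t, kern α (p n t s - y))) (p' n t s) := by
      intro s
      have hlin : ∀ f : Fin N → R2, perp (∑ j, f j) = ∑ j, perp (f j) := fun f => by
        apply ext2 <;> simp [perp_0, perp_1]
      simp only [X2, hu, gSQGvel, perp_smul, hlin, inner_smul_left, sum_inner, conj_trivial]
    simp only [h1]
    rw [intervalIntegral.integral_const_mul, intervalIntegral.integral_finsetSum]
    · rw [Finset.sum_eq_zero, mul_zero]
      intro j _
      rw [intervalIntegral.integral_const_mul, hC.flux hγ S.hα0 S.hα (S.bdy j t ht').op.measurableSet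
        ((S.bdy j t ht').ball (S.crv j t ht')), mul_zero]
    · intro j _
      have h2 : Continuous fun x => ∫ y in Ω j t, kern α (x - y) := by
        refine vel_cont α S.hα0 S.hα (S.bdy j t ht').op ((S.bdy j t ht').ball (S.crv j t ht')) ?_
        rw [S.fr ht']; exact (S.crv j t ht').null
      have h3 : Continuous fun s => inner ℝ (perp (∫ y in Ω j t, kern α (p n t s - y))) (p' n t s) :=
        (continuous_perp.comp (h2.comp hC.cont)).inner (hC.cont' hγ)
      exact (continuous_const.mul h3).intervalIntegrable _ _
  set L := (M + 2 * U + 2) / κ with hL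
  have hL0 : 0 ≤ L := by positivity
  rw [hasDerivWithinAt_iff_isLittleO, Asymptotics.isLittleO_iff]
  intro η hη
  set B := 8 * (4 * M * L + 3 * (U + 1)) with hB
  have hB0 : 0 < B := by positivity
  set e := min 1 (η / (2 * B)) with he
  have he0 : 0 < e := by positivity
  have heB : e * B ≤ η / 2 := by
    have := mul_le_mul_of_nonneg_right (min_le_right 1 (η / (2 * B))) hB0.le
    rw [← he] at this
    refine this.trans (le_of_eq ?_); field_simp
  obtain ⟨δ, hδ, hδu⟩ := Metric.uniformContinuousOn_iff.1
    (hC.cpt_range.uniformContinuousOn_of_continuous huc.continuousOn) e he0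
  set r := δ / (2 * M) with hr
  have hr0 : 0 < r := by positivity
  have hosc : ∀ s s', |s - s'| ≤ r → ‖u (p n t s) - u (p n t s')‖ ≤ e := fun s s' hss => by
    have h1 := hδu _ ⟨s, rfl⟩ _ ⟨s', rfl⟩ (by
      rw [dist_eq_norm]
      refine (hC.lip s s').trans_lt ?_
      have := mul_le_mul_of_nonneg_left hss hM.le
      have e1 : M * r = δ / 2 := by rw [hr]; field_simp
      linarith)
    rw [dist_eq_norm] at h1; exact h1.le
  have hsmall : ∀ᶠ h in nhdsWithin (0:ℝ) (Ioi 0),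
      16 * M ^ 2 * (1 + L ^ (2 + γ)) * h ^ γ < η / 2 := by
    have h1 : Tendsto (fun h : ℝ => 16 * M ^ 2 * (1 + L ^ (2 + γ)) * h ^ γ) (nhds 0)
        (nhds (16 * M ^ 2 * (1 + L ^ (2 + γ)) * 0 ^ γ)) :=
      (((Real.continuous_rpow_const hγ.le).tendsto 0).const_mul _)
    rw [Real.zero_rpow hγ.ne', mul_zero] at h1
    exact (h1.mono_left nhdsWithin_le_nhds).eventually (gt_mem_nhds (by positivity))
  have hr1 : 0 < r / (L + 1) := by positivity
  have main : ∀ᶠ h in nhdsWithin (0:ℝ) (Ioi 0),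
      |area (p n (t + h)) (p' n (t + h)) - area (p n t) (p' n t)| ≤ η * h := by
    filter_upwards [hsmall, S.mtch ht he0 (s := 1 / 2) (by norm_num), self_mem_nhdsWithin,
      Ioo_mem_nhdsGT hr1, Ioo_mem_nhdsGT one_pos] with h hsm hmt hh0 hhr hh1
    have hh0 : 0 < h := hh0
    obtain ⟨hth, hmt⟩ := hmt
    obtain ⟨a, ha⟩ := hmt n
    have hCq := S.crv n (t + h) hth
    choose _ f hf1 hf2 using ha
    set m := ⌈2 * π / h⌉₊ with hm
    have hm0 : 0 < m := Nat.ceil_pos.2 (by positivity)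
    have hm0' : (0:ℝ) < m := by exact_mod_cast hm0
    have hm1 : 2 * π / h ≤ m := Nat.le_ceil _
    have hm2 : (m:ℝ) < 2 * π / h + 1 := Nat.ceil_lt_add_one (by positivity)
    have hmh : 2 * π / m ≤ h := by
      rw [div_le_iff₀ hh0] at hm1
      rw [div_le_iff₀ hm0']; linarith
    have hmh2 : m * h ≤ 8 := by
      have := mul_le_mul_of_nonneg_right hm2.le hh0.le
      rw [add_mul, div_mul_cancel₀ _ hh0.ne'] at this
      linarith [hh1.2]
    set x : ℕ → ℝ := fun i => 2 * π * i / m with hx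
    have hxm : x m = x 0 + 2 * π := by simp only [hx]; field_simp; simp
    set φ : ℕ → ℝ := fun i => if i = m then f (x 0) + 2 * π else f (x i) with hφ
    have hφ0 : φ 0 = f (x 0) := by simp only [hφ]; rw [if_neg (by omega)]
    have hφm : φ m = f (x 0) + 2 * π := by simp [hφ]
    have hP : ∀ i, |φ i - (a + x i)| ≤ 1 / 2 ∧
        ‖p n (t + h) (x i) - p n t (φ i) - h • u (p n t (φ i))‖ ≤ e * h := by
      intro i
      by_cases hi : i = m
      · rw [hi, hφm, hxm, hC.per, hCq.per]
        refine ⟨?_, hf2 (x 0)⟩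
        rw [show f (x 0) + 2 * π - (a + (x 0 + 2 * π)) = f (x 0) - (a + x 0) by ring]
        exact hf1 (x 0)
      · have : φ i = f (x i) := by simp only [hφ]; rw [if_neg hi]
        rw [this]
        exact ⟨hf1 _, hf2 _⟩
    have hφL : ∀ i < m, |φ (i + 1) - φ i| ≤ L * h := by
      intro i _
      have hxx : x (i + 1) - x i = 2 * π / m := by simp only [hx]; push_cast; field_simp; ring
      have h0 : 0 ≤ 2 * π / m := by positivity
      have h1 := (hP i).1
      have h2 := (hP (i + 1)).1
      have hpi : |φ (i + 1) - φ i| ≤ π := by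
        rw [abs_le] at h1 h2 ⊢
        constructor <;> linarith [hh1.2]
      have h3 := hac (φ (i + 1)) (φ i)
      rw [distT_eq_abs hpi] at h3
      have h4 : ‖p n t (φ (i + 1)) - p n t (φ i)‖ ≤ (M + 2 * U + 2) * h := by
        have e1 : p n t (φ (i + 1)) - p n t (φ i) =
          (p n (t + h) (x (i + 1)) - p n (t + h) (x i)) -
          (p n (t + h) (x (i + 1)) - p n t (φ (i + 1)) - h • u (p n t (φ (i + 1)))) +
          (p n (t + h) (x i) - p n t (φ i) - h • u (p n t (φ i))) -
          (h • u (p n t (φ (i + 1))) - h • u (p n t (φ i))) := by abel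
        have b1 := hCq.lip (x (i + 1)) (x i)
        rw [hxx, abs_of_nonneg h0] at b1
        have b2 := (hP (i + 1)).2
        have b3 := (hP i).2
        have b4 : ‖h • u (p n t (φ (i + 1))) - h • u (p n t (φ i))‖ ≤ h * U + h * U := by
          refine (norm_sub_le _ _).trans ?_
          rw [norm_smul, norm_smul, Real.norm_of_nonneg hh0.le]
          exact add_le_add (mul_le_mul_of_nonneg_left (hU _ _) hh0.le)
            (mul_le_mul_of_nonneg_left (hU _ _) hh0.le)
        have b5 := mul_le_mul_of_nonneg_left hmh hM.le
        have b6 := mul_le_mul_of_nonneg_right (min_le_left 1 (η / (2 * B))) hh0.le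
        rw [← he] at b6
        rw [e1]
        refine (norm_sub_le _ _).trans ?_
        have b7 := norm_add_le ((p n (t + h) (x (i + 1)) - p n (t + h) (x i)) -
          (p n (t + h) (x (i + 1)) - p n t (φ (i + 1)) - h • u (p n t (φ (i + 1)))))
          (p n (t + h) (x i) - p n t (φ i) - h • u (p n t (φ i)))
        have b8 := norm_sub_le (p n (t + h) (x (i + 1)) - p n (t + h) (x i))
          (p n (t + h) (x (i + 1)) - p n t (φ (i + 1)) - h • u (p n t (φ (i + 1))))
        linarith
      rw [hL, div_mul_eq_mul_div, le_div_iff₀ hκ]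
      linarith
    have hres := hC.area_poly hγ hCq huc (hU n) hL0 hfl he0.le (min_le_left _ _) hosc hh0 (by
      have := (lt_div_iff₀ (by positivity)).1 hhr.2
      nlinarith) hm0 hmh hmh2 φ (by rw [hφm, hφ0]) hφL (fun i _ => (hP i).2)
    refine hres.trans ?_
    rw [show h ^ (1 + γ) = h * h ^ γ by rw [Real.rpow_add hh0, Real.rpow_one]]
    have c1 := mul_le_mul_of_nonneg_right hsm.le hh0.le
    have c2 := mul_le_mul_of_nonneg_right heB hh0.le
    rw [hB] at c2
    linarith
  obtain ⟨ε, hε, hεs⟩ := mem_nhdsGT_iff_exists_Ioo_subset.1 main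
  have hnb : ∀ᶠ x in nhdsWithin t (Ici t), x < t + ε :=
    nhdsWithin_le_nhds (gt_mem_nhds (by linarith [mem_Ioi.1 hε]))
  filter_upwards [hnb, self_mem_nhdsWithin] with x hx1 hx2
  rcases (mem_Ici.1 hx2).eq_or_lt with hx | hx
  · rw [← hx]; simp
  · have := hεs (show x - t ∈ Ioo 0 ε from ⟨by linarith, by linarith⟩)
    simp only [mem_ofPred_eq, add_sub_cancel] at this
    rw [smul_zero, sub_zero, Real.norm_eq_abs, Real.norm_eq_abs, abs_of_pos (by linarith : 0 < x - t)]
    exact this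

theorem area_cont (S : Sol α γ T cα M N θ Ω p p' c) (n : Fin N) :
    ContinuousOn (fun t => area (p n t) (p' n t)) (Ico 0 T) := by
  intro t ht
  have hp := Real.pi_pos
  have hM := S.hM
  rw [ContinuousWithinAt, Metric.tendsto_nhds]
  intro ε hε
  filter_upwards [S.close n ht (ε := ε / (8 * π * M)) (by positivity), self_mem_nhdsWithin] with s hs hsT
  obtain ⟨a, ha⟩ := hs
  have h0 := S.crv n t ht
  have h1 : Crv γ M (c n t) (fun ξ => p n t (a + ξ)) (fun ξ => p' n t (a + ξ)) := by
    refine ⟨fun ξ => ?_, fun ξ => ?_, fun ξ => h0.speed _, fun ξ => h0.bd _, h0.spM, fun ξ η => ?_⟩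
    · have := (h0.der (a + ξ)).scomp ξ ((hasDerivAt_id ξ).const_add a)
      rw [one_smul] at this; exact this
    · rw [← add_assoc, h0.per]
    · have := h0.hol (a + ξ) (a + η)
      rwa [add_sub_add_left_eq_sub] at this
  have h2 := (S.crv n s hsT).area_close S.γ0 h1 ha
  rw [h0.area_shift, show 4 * π * M * (ε / (8 * π * M)) = ε / 2 by field_simp; norm_num] at h2
  rw [Real.dist_eq]; linarith

theorem clow (S : Sol α γ T cα M N θ Ω p p' c) : ∃ c0 > 0, ∀ n, ∀ t ∈ Ico 0 T, c0 ≤ c n t := by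
  have hp := Real.pi_pos
  have hM := S.hM
  have hT := S.hT
  have h1 : ∀ n, ∃ A > 0, ∀ t ∈ Ico 0 T, A ≤ area (p n t) (p' n t) := by
    intro n
    obtain ⟨t0, ht0, hmin⟩ := (isCompact_Icc (a := 0) (b := T / 2)).exists_isMinOn
      ⟨0, by simp; positivity⟩ ((S.area_cont n).mono (fun t ht => ⟨ht.1, by linarith [ht.2]⟩))
    refine ⟨_, S.ccw n t0 ⟨ht0.1, by linarith [ht0.2]⟩, fun t ht => ?_⟩
    rcases le_total t (T / 2) with hle | hle
    · exact hmin ⟨ht.1, hle⟩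
    · have := constant_of_has_deriv_right_zero (f := fun t => area (p n t) (p' n t)) (a := T / 2) (b := t)
        ((S.area_cont n).mono (fun s hs => ⟨by linarith [hs.1], by linarith [hs.2, ht.2]⟩))
        (fun s hs => S.area_deriv n ⟨by linarith [hs.1], by linarith [hs.2, ht.2]⟩) t ⟨hle, le_rfl⟩
      rw [this]
      exact hmin ⟨by positivity, le_rfl⟩
  have h2 : ∀ᶠ r in nhdsWithin (0:ℝ) (Ioi 0), ∀ n, ∀ t ∈ Ico 0 T, r ≤ c n t := by
    rw [eventually_all]
    intro n
    obtain ⟨A, hA, hAt⟩ := h1 n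
    have hpos : 0 < A / (2 * π * M) := by positivity
    filter_upwards [Ioo_mem_nhdsGT hpos] with r hr t ht
    refine hr.2.le.trans ?_
    have h0 := S.crv n t ht
    have h3 := hAt t ht
    rw [area_eq] at h3
    have h4 := intervalIntegral.norm_integral_le_of_norm_le_const (a := 0) (b := 2 * π)
      (f := fun ξ => inner ℝ (perp (p n t ξ)) (p' n t ξ)) (C := M * c n t) (by
        intro s _
        rw [Real.norm_eq_abs]
        exact X2_le' (h0.bd s) (h0.speed s).le)
    rw [Real.norm_eq_abs, sub_zero, abs_of_pos (by positivity : 0 < 2 * π)] at h4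
    rw [div_le_iff₀ (by positivity)]
    have := le_abs_self (∫ ξ in (0:ℝ)..(2 * π), inner ℝ (perp (p n t ξ)) (p' n t ξ))
    linarith
  obtain ⟨r, h3, h4⟩ := (h2.and self_mem_nhdsWithin).exists
  exact ⟨r, h4, h3⟩

end Sol

/-! ### The slope lemma -/

theorem rpow_small {γ A B : ℝ} (hγ : 0 < γ) (hB : 0 < B) :
    ∀ᶠ r in nhdsWithin (0:ℝ) (Ioi 0), A * r ^ γ < B := by
  have h1 : Tendsto (fun h : ℝ => A * h ^ γ) (nhds 0) (nhds (A * 0 ^ γ)) :=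
    ((Real.continuous_rpow_const hγ.le).tendsto 0).const_mul _
  rw [Real.zero_rpow hγ.ne', mul_zero] at h1
  exact (h1.mono_left nhdsWithin_le_nhds).eventually (gt_mem_nhds hB)

namespace Crv
variable {γ M c c1 : ℝ} {p p' q q' : ℝ → R2} {Ω : Set R2}

theorem mono_dir (h : Crv γ M c p p') (hγ : 0 < γ) {e : R2} (he : ‖e‖ = 1) {a b k : ℝ}
    (hk : k + M * |a - b| ^ γ ≤ |inner ℝ e (p' b)|) :
    k * |a - b| ≤ |inner ℝ e (p a - p b)| := by
  have h1 := h.inner_taylor hγ he a b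
  rcases eq_or_ne a b with hab | hab
  · subst hab; simp
  have hpos : 0 < |a - b| := abs_pos.2 (sub_ne_zero.2 hab)
  rw [Real.rpow_add hpos, Real.rpow_one] at h1
  have h2 : |(a - b) * inner ℝ e (p' b)| ≤ |inner ℝ e (p a - p b)| + M * (|a - b| * |a - b| ^ γ) := by
    have := abs_sub_abs_le_abs_sub ((a - b) * inner ℝ e (p' b)) (inner ℝ e (p a - p b))
    rw [abs_sub_comm] at this
    linarith
  rw [abs_mul] at h2
  nlinarith [mul_le_mul_of_nonneg_left hk hpos.le]

set_option maxHeartbeats 2000000 in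
theorem slope0 {c0 ℓ : ℝ} (hγ : 0 < γ) (hM : 0 < M) (hc0 : 0 < c0) (hℓ : 0 < ℓ)
    (hℓM : M * (2 * ℓ) ^ γ ≤ c0 / 4) : ∃ ε > 0, ∀ {c c1 : ℝ} {p p' q q' : ℝ → R2},
    Crv γ M c p p' → Crv γ M c1 q q' → c0 ≤ c → ∀ ξ η (ν : R2), ‖ν‖ = 1 → inner ℝ ν (p' ξ) = 0 →
    (∀ s s', |s| ≤ ℓ → |s'| ≤ ℓ → p (ξ + s) ≠ q (η + s')) →
    0 < |inner ℝ ν (q' η)| →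
    ε * |inner ℝ ν (q' η)| ^ (1 / γ) * |inner ℝ ν (q' η)| / 4 ≤ ‖q η - p ξ‖ := by
  set G := 4 * M / c0 with hG
  have hG0 : 0 < G := by positivity
  obtain ⟨ε, ⟨⟨hε1, hε2⟩, hε3⟩, hε0⟩ := (((rpow_small (A := M * G ^ (1 + γ)) hγ (by norm_num : (0:ℝ) < 1 / 4)).and
    (rpow_small (A := M) hγ (by norm_num : (0:ℝ) < 1 / 4))).and (rpow_small (A := M ^ (1 / γ) * (G + 1))
      (γ := 1) one_pos hℓ)).and self_mem_nhdsWithin |>.exists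
  have hε0 : 0 < ε := hε0
  rw [Real.rpow_one] at hε3
  refine ⟨ε, hε0, ?_⟩
  intro c c1 p p' q q' hp hq hc ξ η ν hν hνp hd hσ
  set σ := |inner ℝ ν (q' η)| with hσd
  set S := ε * σ ^ (1 / γ) with hS
  have hS0 : 0 < S := by positivity
  have hcpos : 0 < c := hc0.trans_le hc
  have hσM : σ ≤ M := (abs_inner_unit hν _).trans ((hq.speed η).le.trans hq.spM)
  have hSγ : S ^ γ = ε ^ γ * σ := by
    rw [hS, Real.mul_rpow hε0.le (by positivity), ← Real.rpow_mul hσ.le, one_div_mul_cancel hγ.ne',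
      Real.rpow_one]
  have hSl : S * (G + 1) < ℓ := by
    have : S ≤ ε * M ^ (1 / γ) := by
      rw [hS]; gcongr
    nlinarith
  have hSl1 : S ≤ ℓ := by nlinarith
  have hSl2 : G * S ≤ ℓ := by nlinarith
  by_contra hcon
  push Not at hcon
  set ρ := ‖q η - p ξ‖ with hρ
  have hρS : ρ ≤ M * S := by
    have : S * σ / 4 ≤ S * M := by nlinarith
    linarith
  set e : R2 := (1 / c) • p' ξ with he
  have he1 : ‖e‖ = 1 := by
    rw [he, norm_smul, hp.speed, Real.norm_of_nonneg (by positivity)]; field_simp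
  have hep : ∀ s, |s| ≤ ℓ → 3 * c / 4 ≤ inner ℝ e (p' (ξ + s)) := by
    intro s hs
    have h1 : inner ℝ e (p' (ξ + s)) = c + inner ℝ e (p' (ξ + s) - p' ξ) := by
      rw [inner_sub_right]
      have : inner ℝ e (p' ξ) = c := by
        rw [he, inner_smul_left, real_inner_self_eq_norm_sq, hp.speed]
        simp only [conj_trivial]; field_simp
      rw [this]; ring
    have h2 := abs_inner_unit he1 (p' (ξ + s) - p' ξ)
    have h3 := hp.hol (ξ + s) ξ
    rw [add_sub_cancel_left] at h3
    have h4 : M * |s| ^ γ ≤ M * (2 * ℓ) ^ γ :=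
      mul_le_mul_of_nonneg_left (Real.rpow_le_rpow (abs_nonneg _) (by linarith) hγ.le) hM.le
    rw [h1]
    linarith [neg_abs_le (inner ℝ e (p' (ξ + s) - p' ξ))]
  have hexp : ∀ s s', |s| ≤ ℓ → |s'| ≤ ℓ → c / 2 * |s - s'| ≤ |inner ℝ e (p (ξ + s) - p (ξ + s'))| := by
    intro s s' hs hs'
    have := hp.mono_dir hγ he1 (a := ξ + s) (b := ξ + s') (k := c / 2) (by
      rw [add_sub_add_left_eq_sub]
      have h1 : |s - s'| ≤ 2 * ℓ := (abs_sub s s').trans (by linarith)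
      have h4 : M * |s - s'| ^ γ ≤ M * (2 * ℓ) ^ γ :=
        mul_le_mul_of_nonneg_left (Real.rpow_le_rpow (abs_nonneg _) h1 hγ.le) hM.le
      linarith [hep s' hs', le_abs_self (inner ℝ e (p' (ξ + s')))])
    rwa [add_sub_add_left_eq_sub] at this
  have hmon : ∀ s, 0 ≤ s → s ≤ ℓ → c / 2 * s ≤ inner ℝ e (p (ξ + s) - p ξ) ∧
      c / 2 * s ≤ -inner ℝ e (p (ξ - s) - p ξ) := by
    intro s hs hsl
    have hM1 : M * s ^ (1 + γ) ≤ c / 4 * s := by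
      rcases hs.eq_or_lt with h0 | h0
      · rw [← h0, Real.zero_rpow (by linarith)]; simp
      rw [Real.rpow_add h0, Real.rpow_one]
      have h4 : M * s ^ γ ≤ M * (2 * ℓ) ^ γ :=
        mul_le_mul_of_nonneg_left (Real.rpow_le_rpow hs (by linarith) hγ.le) hM.le
      nlinarith
    have h0 := hep 0 (by simpa using hℓ.le)
    rw [add_zero] at h0
    have h1 := hp.inner_taylor hγ he1 (ξ + s) ξ
    have h2 := hp.inner_taylor hγ he1 (ξ - s) ξ
    rw [add_sub_cancel_left, abs_of_nonneg hs, abs_le] at h1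
    rw [sub_sub_cancel_left, abs_neg, abs_of_nonneg hs, abs_le] at h2
    constructor <;> nlinarith [h1.1, h2.2]
  -- the graph parameter
  have hXq : ∀ s', |s'| ≤ S → |inner ℝ e (q (η + s') - p ξ)| ≤ 2 * M * S := by
    intro s' hs'
    refine (abs_inner_unit he1 _).trans ?_
    have h1 : q (η + s') - p ξ = (q (η + s') - q η) + (q η - p ξ) := by abel
    rw [h1]
    refine (norm_add_le _ _).trans ?_
    have h2 := hq.lip (η + s') η
    rw [add_sub_cancel_left] at h2
    nlinarith
  have hg : ∀ s', ∃ g, |s'| ≤ S → |g| ≤ G * S ∧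
      inner ℝ e (p (ξ + g) - p ξ) = inner ℝ e (q (η + s') - p ξ) := by
    intro s'
    by_cases hs' : |s'| ≤ S
    · have h1 := hXq s' hs'
      have h2 := hmon (G * S) (by positivity) hSl2
      have h3 : c0 / 2 * (G * S) = 2 * M * S := by rw [hG]; field_simp; norm_num
      have h4 : 2 * M * S ≤ c / 2 * (G * S) := by
        rw [← h3]; gcongr
      rw [abs_le] at h1
      have hc2 : Continuous fun g => inner ℝ e (p (ξ + g) - p ξ) := by
        have := hp.cont; fun_prop
      have hGS : 0 ≤ G * S := by positivity
      obtain ⟨g, hg, hge⟩ := intermediate_value_Icc (by linarith : -(G * S) ≤ G * S) hc2.continuousOn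
        (show inner ℝ e (q (η + s') - p ξ) ∈ Icc _ _ from ⟨by
          rw [← sub_eq_add_neg]; linarith [h2.2], by linarith [h2.1]⟩)
      exact ⟨g, fun _ => ⟨abs_le.2 hg, hge⟩⟩
    · exact ⟨0, fun h => absurd h hs'⟩
  choose g hg using hg
  have hgc : ContinuousOn g (Icc (-S) S) := by
    have : LipschitzOnWith (Real.toNNReal (2 * M / c)) g (Icc (-S) S) := by
      refine LipschitzOnWith.of_dist_le_mul fun x hx y hy => ?_
      obtain ⟨hx1, hx2⟩ := hg x (abs_le.2 hx)
      obtain ⟨hy1, hy2⟩ := hg y (abs_le.2 hy)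
      rw [Real.coe_toNNReal _ (by positivity), Real.dist_eq, Real.dist_eq]
      have h1 := hexp (g x) (g y) (hx1.trans hSl2) (hy1.trans hSl2)
      have h2 : inner ℝ e (p (ξ + g x) - p (ξ + g y)) = inner ℝ e (q (η + x) - q (η + y)) := by
        simp only [inner_sub_right] at hx2 hy2 ⊢; linarith
      rw [h2] at h1
      have h3 := (abs_inner_unit he1 _).trans (hq.lip (η + x) (η + y))
      rw [add_sub_add_left_eq_sub] at h3
      rw [div_mul_eq_mul_div, le_div_iff₀ hcpos]
      linarith
    exact this.continuousOn
  set H : ℝ → ℝ := fun s' => inner ℝ ν (q (η + s') - p (ξ + g s')) with hH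
  have hHc : ContinuousOn H (Icc (-S) S) := by
    have h1 := hp.cont
    have h2 := hq.cont
    have h3 : ContinuousOn (fun s' => p (ξ + g s')) (Icc (-S) S) :=
      h1.comp_continuousOn (continuousOn_const.add hgc)
    have h4 : ContinuousOn (fun s' => q (η + s') - p (ξ + g s')) (Icc (-S) S) :=
      (Continuous.continuousOn (by fun_prop)).sub h3
    exact continuousOn_const.inner h4
  have hest : ∀ s', |s'| = S → |H s' - s' * inner ℝ ν (q' η)| < σ * S := by
    intro s' hs'
    obtain ⟨h1, -⟩ := hg s' hs'.le
    have t1 := hp.inner_taylor hγ hν (ξ + g s') ξ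
    have t2 := hq.inner_taylor hγ hν (η + s') η
    rw [add_sub_cancel_left, hνp, mul_zero, sub_zero] at t1
    rw [add_sub_cancel_left, hs'] at t2
    have t3 := abs_inner_unit hν (q η - p ξ)
    have hexpand : S ^ (1 + γ) = S * (ε ^ γ * σ) := by rw [Real.rpow_add hS0, Real.rpow_one, hSγ]
    have b1 : M * |g s'| ^ (1 + γ) ≤ S * σ / 4 := by
      have : |g s'| ^ (1 + γ) ≤ G ^ (1 + γ) * S ^ (1 + γ) := by
        rw [← Real.mul_rpow hG0.le hS0.le]
        exact Real.rpow_le_rpow (abs_nonneg _) h1 (by linarith)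
      rw [hexpand] at this
      have b2 := mul_le_mul_of_nonneg_left this hM.le
      have b3 := mul_le_mul_of_nonneg_right hε1.le (by positivity : 0 ≤ S * σ)
      linarith
    have b4 : M * S ^ (1 + γ) ≤ S * σ / 4 := by
      rw [hexpand]
      have b3 := mul_le_mul_of_nonneg_right hε2.le (by positivity : 0 ≤ S * σ)
      linarith
    have e1 : H s' - s' * inner ℝ ν (q' η) = (inner ℝ ν (q (η + s') - q η) - s' * inner ℝ ν (q' η)) +
        inner ℝ ν (q η - p ξ) - inner ℝ ν (p (ξ + g s') - p ξ) := by
      simp only [hH, inner_sub_right]; ring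
    rw [e1]
    have hSσ : 0 < S * σ := by positivity
    rw [abs_le] at t1 t2 t3
    rw [abs_lt]
    constructor <;> linarith [t1.1, t1.2, t2.1, t2.2, t3.1, t3.2]
  have hSS : -S ≤ S := by linarith
  have hp1 := hest S (abs_of_pos hS0)
  have hp2 := hest (-S) (by rw [abs_neg]; exact abs_of_pos hS0)
  have hz : ∃ s' ∈ Icc (-S) S, H s' = 0 := by
    rw [abs_lt] at hp1 hp2
    rcases abs_cases (inner ℝ ν (q' η)) with ⟨h1, -⟩ | ⟨h1, -⟩
    · rw [← h1, ← hσd] at hp1 hp2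
      exact intermediate_value_Icc hSS hHc ⟨by linarith [hp2.2], by linarith [hp1.1]⟩
    · have h2 : inner ℝ ν (q' η) = -σ := by rw [hσd, h1]; ring
      rw [h2] at hp1 hp2
      exact intermediate_value_Icc' hSS hHc ⟨by linarith [hp1.2], by linarith [hp2.1]⟩
  obtain ⟨s', hs', hHs⟩ := hz
  obtain ⟨h1, h2⟩ := hg s' (abs_le.2 hs')
  refine hd (g s') s' (h1.trans hSl2) ((abs_le.2 hs').trans hSl1) ?_
  -- both coordinates agree
  have h3 : inner ℝ e (q (η + s') - p (ξ + g s')) = 0 := by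
    simp only [inner_sub_right] at h2 ⊢; linarith
  have h4 := normsq_decomp he1 (q (η + s') - p (ξ + g s'))
  have hνe : inner ℝ e ν = 0 := by rw [he, inner_smul_left, real_inner_comm, hνp, mul_zero]
  have h5 : (inner ℝ (perp e) (q (η + s') - p (ξ + g s'))) = 0 := by
    have d1 := decomp2 he1 ν
    rw [hνe, zero_smul, zero_add] at d1
    have hne : inner ℝ (perp e) ν ≠ 0 := by
      intro h0; rw [h0, zero_smul] at d1; rw [d1] at hν; simp at hν
    have h6 : H s' = inner ℝ (perp e) ν * inner ℝ (perp e) (q (η + s') - p (ξ + g s')) := by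
      simp only [hH]
      conv_lhs => rw [d1]
      rw [inner_smul_left]; simp
    rw [hHs] at h6
    exact (mul_eq_zero.1 h6.symm).resolve_left hne
  rw [h3, h5] at h4
  have h7 : ‖q (η + s') - p (ξ + g s')‖ = 0 := by
    have : ‖q (η + s') - p (ξ + g s')‖ ^ 2 = 0 := by rw [h4]; ring
    simpa using this
  exact (sub_eq_zero.1 (norm_eq_zero.1 h7)).symm

end Crv

namespace Sol
variable {α γ T cα M : ℝ} {N : ℕ} {θ : Fin N → ℝ} {Ω : Fin N → ℝ → Set R2}
    {p p' : Fin N → ℝ → ℝ → R2} {c : Fin N → ℝ → ℝ}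

theorem slope (S : Sol α γ T cα M N θ Ω p p' c) : ∃ K > 0, ∀ t ∈ Ico 0 T, ∀ n j ξ η (ν : R2),
    ‖ν‖ = 1 → inner ℝ ν (p' n t ξ) = 0 →
    |inner ℝ ν (p' j t η)| ≤ K * ‖p j t η - p n t ξ‖ ^ (2 * α) := by
  have hγ := S.γ0
  have hM := S.hM
  have hα0 := S.hα0
  have hα := S.hα
  obtain ⟨c0, hc0, hc⟩ := S.clow
  obtain ⟨ℓ, ⟨hℓ1, hℓ2⟩, hℓ0⟩ := (((rpow_small (A := M * 2 ^ γ) hγ (by positivity : (0:ℝ) < c0 / 4)).and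
    (Ioo_mem_nhdsGT one_pos)).and self_mem_nhdsWithin).exists
  have hℓ0 : 0 < ℓ := hℓ0
  have hℓM : M * (2 * ℓ) ^ γ ≤ c0 / 4 := by
    rw [Real.mul_rpow (by norm_num) hℓ0.le, ← mul_assoc]; exact hℓ1.le
  obtain ⟨ε, hε, hsl⟩ := Crv.slope0 hγ hM hc0 hℓ0 hℓM
  set K1 := (4 / ε) ^ (2 * α) with hK1
  set K2 := M * ((2 / c0) ^ γ * (2 * M) ^ (γ - 2 * α)) with hK2
  have hK10 : 0 < K1 := by positivity
  have hK20 : 0 < K2 := by positivity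
  have hγα : 2 * α ≤ γ := by
    rw [S.hγ, le_div_iff₀ (by linarith)]; nlinarith
  have hexp : (1 + 1 / γ) * (2 * α) = 1 := by
    rw [S.hγ]; field_simp; ring
  refine ⟨K1 + K2, by positivity, ?_⟩
  intro t ht n j ξ η ν hν hνp
  set ρ := ‖p j t η - p n t ξ‖ with hρ
  have hρ0 : 0 ≤ ρ := norm_nonneg _
  have hfar : (∀ s s', |s| ≤ ℓ → |s'| ≤ ℓ → p n t (ξ + s) ≠ p j t (η + s')) →
      |inner ℝ ν (p' j t η)| ≤ K1 * ρ ^ (2 * α) := by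
    intro hd
    rcases (abs_nonneg (inner ℝ ν (p' j t η))).eq_or_lt with h0 | h0
    · rw [← h0]; positivity
    have h1 := hsl (S.crv n t ht) (S.crv j t ht) (hc n t ht) ξ η ν hν hνp hd h0
    set σ := |inner ℝ ν (p' j t η)| with hσ
    have h2 : σ ^ (1 + 1 / γ) ≤ 4 / ε * ρ := by
      rw [Real.rpow_add h0, Real.rpow_one, div_mul_eq_mul_div, le_div_iff₀ hε]
      linarith
    have h3 := Real.rpow_le_rpow (by positivity) h2 (by positivity : 0 ≤ 2 * α)
    rw [← Real.rpow_mul h0.le, hexp, Real.rpow_one, Real.mul_rpow (by positivity) hρ0] at h3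
    exact h3
  have hρp : 0 ≤ ρ ^ (2 * α) := Real.rpow_nonneg hρ0 _
  by_cases hnj : n = j
  · subst hnj
    have hC := S.crv n t ht
    by_cases hdist : distT ξ η ≤ 2 * ℓ
    · obtain ⟨k, hk, -⟩ := distT_attained ξ η
      rw [hk] at hdist
      set ξ' := ξ + 2 * π * k with hξ'
      have e1 : ξ - η + 2 * π * k = ξ' - η := by rw [hξ']; ring
      rw [e1] at hdist
      have hP : p n t ξ' = p n t ξ := hC.perk ξ k
      have hP' : p' n t ξ' = p' n t ξ := hC.perk' ξ k
      have hMl : M * |ξ' - η| ^ γ ≤ M * (2 * ℓ) ^ γ :=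
        mul_le_mul_of_nonneg_left (Real.rpow_le_rpow (abs_nonneg _) hdist hγ.le) hM.le
      have hch := hC.chord hγ (ξ := ξ') (η := η) (by linarith [hc n t ht])
      rw [hP, norm_sub_rev, ← hρ] at hch
      have h1 : |ξ' - η| ≤ 2 / c0 * ρ := by
        rw [div_mul_eq_mul_div, le_div_iff₀ hc0]
        nlinarith [hc n t ht, abs_nonneg (ξ' - η)]
      have h2 : inner ℝ ν (p' n t η) = inner ℝ ν (p' n t η - p' n t ξ') := by
        rw [inner_sub_right, hP', hνp, sub_zero]
      have h3 := (abs_inner_unit hν (p' n t η - p' n t ξ')).trans (hC.hol η ξ')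
      rw [← h2, abs_sub_comm] at h3
      have h4 : |ξ' - η| ^ γ ≤ (2 / c0) ^ γ * ρ ^ γ := by
        rw [← Real.mul_rpow (by positivity) hρ0]
        exact Real.rpow_le_rpow (abs_nonneg _) h1 hγ.le
      have hρM : ρ ≤ 2 * M := by
        refine (norm_sub_le _ _).trans ?_
        linarith [hC.bd η, hC.bd ξ]
      have h5 : ρ ^ γ ≤ (2 * M) ^ (γ - 2 * α) * ρ ^ (2 * α) := by
        rcases hρ0.eq_or_lt with h0 | h0
        · rw [← h0, Real.zero_rpow hγ.ne']; positivity
        calc ρ ^ γ = ρ ^ (γ - 2 * α) * ρ ^ (2 * α) := by rw [← Real.rpow_add h0]; ring_nf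
          _ ≤ _ := mul_le_mul_of_nonneg_right (Real.rpow_le_rpow hρ0 hρM (by linarith)) hρp
      have h6 : |inner ℝ ν (p' n t η)| ≤ K2 * ρ ^ (2 * α) := by
        refine h3.trans ?_
        calc M * |ξ' - η| ^ γ ≤ M * ((2 / c0) ^ γ * ((2 * M) ^ (γ - 2 * α) * ρ ^ (2 * α))) := by
              gcongr
              exact h4.trans (mul_le_mul_of_nonneg_left h5 (by positivity))
          _ = _ := by rw [hK2]; ring
      nlinarith
    · have h1 := hfar (fun s s' hs hs' heq => by
        have h2 := S.smp n t ht _ _ heq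
        have h3 := distT_lip ξ η (ξ + s) (η + s')
        rw [h2] at h3
        have h4 : ξ - (ξ + s) - (η - (η + s')) = s' - s := by ring
        rw [h4] at h3
        have := abs_sub s' s
        linarith)
      nlinarith
  · have h1 := hfar (fun s s' _ _ => S.disj t ht n j hnj _ _)
    nlinarith

end Sol

/-! ### One-dimensional estimates for the core bound -/

theorem int1_bd {ι : Type*} [Fintype ι] (k : ℝ → ℝ) (b0 δ B : ι → ℝ) (hδ : ∀ i, 0 ≤ δ i)
    (hB : ∀ i, 0 ≤ B i) (hk : ∀ b, k b ≠ 0 → ∃ i, |b - b0 i| ≤ δ i ∧ |k b| ≤ B i) :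
    |∫ b, k b| ≤ ∑ i, 2 * δ i * B i := by
  have hint : ∀ i, Integrable ((Icc (b0 i - δ i) (b0 i + δ i)).indicator fun _ => B i) := fun i =>
    (integrable_indicator_iff measurableSet_Icc).2 (integrableOn_const (by simp))
  have hval : ∀ i, ∫ b, (Icc (b0 i - δ i) (b0 i + δ i)).indicator (fun _ => B i) b = 2 * δ i * B i := by
    intro i
    rw [integral_indicator measurableSet_Icc, setIntegral_const, Measure.real, Real.volume_Icc,
      ENNReal.toReal_ofReal (by linarith [hδ i]), smul_eq_mul]
    ring
  have h1 := norm_integral_le_of_norm_le (f := k)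
    (g := fun b => ∑ i, (Icc (b0 i - δ i) (b0 i + δ i)).indicator (fun _ => B i) b)
    (integrable_finsetSum _ fun i _ => hint i) (by
      filter_upwards with b
      have hnn : ∀ i ∈ Finset.univ, 0 ≤ (Icc (b0 i - δ i) (b0 i + δ i)).indicator (fun _ => B i) b :=
        fun i _ => indicator_nonneg (fun _ _ => hB i) _
      by_cases hb : k b = 0
      · rw [hb, norm_zero]; exact Finset.sum_nonneg hnn
      · obtain ⟨i, hi1, hi2⟩ := hk b hb
        refine le_trans ?_ (Finset.single_le_sum hnn (Finset.mem_univ i))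
        rw [abs_le] at hi1
        rw [indicator_of_mem (show b ∈ Icc (b0 i - δ i) (b0 i + δ i) from
          ⟨by linarith [hi1.1], by linarith [hi1.2]⟩)]
        exact hi2)
  rw [integral_finsetSum _ fun i _ => hint i] at h1
  simp only [hval] at h1
  exact h1

def H1 (α m a : ℝ) : ℝ := (Ioc 0 m).indicator (fun a => m ^ (2 * α - 1) * a ^ (-(2 * α))) a +
  (Ioi m).indicator (fun a => m ^ (2 * α) * a ^ (-(1 + 2 * α))) a

theorem H1_int {α m : ℝ} (hα0 : 0 < α) (hα : α ≤ 1 / 4) (hm : 0 < m) :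
    Integrable (H1 α m) ∧ ∫ a, H1 α m a = 1 / (1 - 2 * α) + 1 / (2 * α) := by
  have i1 : IntegrableOn (fun a => m ^ (2 * α - 1) * a ^ (-(2 * α))) (Ioc 0 m) := by
    have := (intervalIntegral.intervalIntegrable_rpow' (a := 0) (b := m)
      (by linarith : -1 < -(2 * α)))
    rw [intervalIntegrable_iff_integrableOn_Ioc_of_le hm.le] at this
    exact this.const_mul _
  have i2 : IntegrableOn (fun a => m ^ (2 * α) * a ^ (-(1 + 2 * α))) (Ioi m) :=
    (integrableOn_Ioi_rpow_of_lt (by linarith) hm).const_mul _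
  have j1 := (integrable_indicator_iff measurableSet_Ioc).2 i1
  have j2 := (integrable_indicator_iff measurableSet_Ioi).2 i2
  refine ⟨j1.add j2, ?_⟩
  have e : ∫ a, H1 α m a = (∫ a, (Ioc 0 m).indicator (fun a => m ^ (2 * α - 1) * a ^ (-(2 * α))) a) +
    ∫ a, (Ioi m).indicator (fun a => m ^ (2 * α) * a ^ (-(1 + 2 * α))) a := integral_add j1 j2
  rw [e, integral_indicator measurableSet_Ioc, integral_indicator measurableSet_Ioi,
    integral_const_mul, integral_const_mul, ← intervalIntegral.integral_of_le hm.le,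
    integral_rpow (Or.inl (by linarith)), integral_Ioi_rpow_of_lt (by linarith) hm,
    Real.zero_rpow (by linarith)]
  have e1 : m ^ (2 * α - 1) * m ^ (-(2 * α) + 1) = 1 := by
    rw [← Real.rpow_add hm]; simp
  have e2 : m ^ (2 * α) * m ^ (-(1 + 2 * α) + 1) = 1 := by
    rw [← Real.rpow_add hm]; simp
  have h3 : (-(2 * α) + 1) ≠ 0 := by linarith
  have h4 : (-(1 + 2 * α) + 1) ≠ 0 := by linarith
  congr 1
  · rw [sub_zero, mul_div_assoc', e1]; congr 1; ring
  · rw [mul_div_assoc', mul_neg, e2, neg_div, ← div_neg]; congr 1; ring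

theorem H1_le {α m a : ℝ} (ha : 0 < a) (h : a ≤ m) : H1 α m a = m ^ (2 * α - 1) * a ^ (-(2 * α)) := by
  rw [H1, indicator_of_mem (show a ∈ Ioc 0 m from ⟨ha, h⟩), indicator_of_notMem (by simpa using h), add_zero]

theorem H1_gt {α m a : ℝ} (h : m < a) : H1 α m a = m ^ (2 * α) * a ^ (-(1 + 2 * α)) := by
  rw [H1, indicator_of_notMem (fun h' => absurd h'.2 (not_le.2 h)), indicator_of_mem (show a ∈ Ioi m from h), zero_add]

theorem H1_nn {α m a : ℝ} (hm : 0 < m) : 0 ≤ H1 α m a := by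
  refine add_nonneg (indicator_nonneg (fun b hb => ?_) _) (indicator_nonneg (fun b hb => ?_) _)
  · have := hb.1; positivity
  · have : 0 < b := hm.trans hb; positivity

theorem powdiff {α d R r1 r2 : ℝ} (hα0 : 0 < α) (hα : α ≤ 1 / 4) (hR : 0 < R) (h1 : R ≤ r1)
    (hd : 2 * d ≤ R) (h12 : |r1 - r2| ≤ d) :
    |r1 ^ (-(2 + 2 * α)) - r2 ^ (-(2 + 2 * α))| ≤ 48 * d * R ^ (-(3 + 2 * α)) := by
  have hd0 : 0 ≤ d := (abs_nonneg _).trans h12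
  have h2 : R / 2 ≤ r2 := by rw [abs_le] at h12; linarith [h12.2]
  have hder : ∀ x ∈ Ici (R / 2), HasDerivWithinAt (fun x : ℝ => x ^ (-(2 + 2 * α)))
      (-(2 + 2 * α) * x ^ (-(2 + 2 * α) - 1)) (Ici (R / 2)) x := fun x hx => by
    have hx0 : x ≠ 0 := by have := mem_Ici.1 hx; linarith
    exact (Real.hasDerivAt_rpow_const (Or.inl hx0)).hasDerivWithinAt
  have hb : ∀ x ∈ Ici (R / 2), ‖-(2 + 2 * α) * x ^ (-(2 + 2 * α) - 1)‖ ≤ 48 * R ^ (-(3 + 2 * α)) := by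
    intro x hx
    have hx1 := mem_Ici.1 hx
    have hx0 : 0 < x := by linarith
    rw [norm_mul, norm_neg, Real.norm_of_nonneg (by linarith), Real.norm_of_nonneg (by positivity),
      show -(2 + 2 * α) - 1 = -(3 + 2 * α) by ring]
    have a1 : x ^ (-(3 + 2 * α)) ≤ (R / 2) ^ (-(3 + 2 * α)) :=
      Real.rpow_le_rpow_of_nonpos (by linarith) hx1 (by linarith)
    have a2 : (R / 2) ^ (-(3 + 2 * α)) = 2 ^ (3 + 2 * α) * R ^ (-(3 + 2 * α)) := by
      rw [Real.div_rpow hR.le (by norm_num), Real.rpow_neg (by norm_num : (0:ℝ) ≤ 2), div_inv_eq_mul,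
        mul_comm]
    have a3 : (2:ℝ) ^ (3 + 2 * α) ≤ 16 := by
      calc (2:ℝ) ^ (3 + 2 * α) ≤ 2 ^ (4:ℝ) := Real.rpow_le_rpow_of_exponent_le (by norm_num) (by linarith)
        _ = 16 := by norm_num
    have a4 : 0 < R ^ (-(3 + 2 * α)) := by positivity
    calc (2 + 2 * α) * x ^ (-(3 + 2 * α)) ≤ 3 * (16 * R ^ (-(3 + 2 * α))) := by
          refine mul_le_mul (by linarith) (a1.trans ?_) (by positivity) (by norm_num)
          rw [a2]; exact mul_le_mul_of_nonneg_right a3 a4.le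
      _ = _ := by ring
  have := (convex_Ici (R / 2)).norm_image_sub_le_of_norm_hasDerivWithin_le hder hb
    (mem_Ici.2 h2) (mem_Ici.2 (by linarith : R / 2 ≤ r1))
  rw [Real.norm_eq_abs, Real.norm_eq_abs] at this
  refine this.trans ?_
  have a4 : 0 < R ^ (-(3 + 2 * α)) := by positivity
  nlinarith

theorem powdiff2 {α a r1 r2 : ℝ} (hα0 : 0 < α) (ha : 0 < a) (h1 : a ≤ r1) (h2 : a ≤ r2) :
    |r1 ^ (-(2 + 2 * α)) - r2 ^ (-(2 + 2 * α))| ≤ 2 * a ^ (-(2 + 2 * α)) := by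
  have b1 : r1 ^ (-(2 + 2 * α)) ≤ a ^ (-(2 + 2 * α)) := Real.rpow_le_rpow_of_nonpos ha h1 (by linarith)
  have b2 : r2 ^ (-(2 + 2 * α)) ≤ a ^ (-(2 + 2 * α)) := Real.rpow_le_rpow_of_nonpos ha h2 (by linarith)
  have c1 : 0 < r1 ^ (-(2 + 2 * α)) := Real.rpow_pos_of_pos (by linarith) _
  have c2 : 0 < r2 ^ (-(2 + 2 * α)) := Real.rpow_pos_of_pos (by linarith) _
  rw [abs_le]; constructor <;> linarith

/-- The numerical heart of the near-arc estimate. -/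
theorem HB {α γ a ρ d : ℝ} (hα0 : 0 < α) (hα : α ≤ 1 / 4) (hγ : 0 < γ) (ha : 0 < a) (hρ : 0 ≤ ρ)
    (hd : 0 < d) : ∃ B ≥ 0, (∀ r1 r2, a ≤ r1 → a ≤ r2 → ρ ≤ r1 → |r1 - r2| ≤ d →
      a * |r1 ^ (-(2 + 2 * α)) - r2 ^ (-(2 + 2 * α))| ≤ B) ∧
      a * (ρ ^ (2 * α) + a ^ γ) * B ≤ 48 * d * (H1 α (max ρ (2 * d)) a + a ^ (γ - 1 - 2 * α)) := by
  set m := max ρ (2 * d) with hm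
  have hm0 : 0 < m := lt_max_of_lt_right (by linarith)
  have hρm : ρ ^ (2 * α) ≤ m ^ (2 * α) := Real.rpow_le_rpow hρ (le_max_left _ _) (by linarith)
  have hρ2 : 0 ≤ ρ ^ (2 * α) := by positivity
  rcases lt_or_ge m a with hma | hma
  · refine ⟨a * (48 * d * a ^ (-(3 + 2 * α))), by positivity, ?_, ?_⟩
    · intro r1 r2 h1 _ _ h4
      refine mul_le_mul_of_nonneg_left (powdiff hα0 hα ha h1 ?_ h4) ha.le
      exact (le_max_right ρ (2 * d)).trans hma.le
    · rw [H1_gt hma]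
      have e1 : a * a * a ^ (-(3 + 2 * α)) = a ^ (-(1 + 2 * α)) := by
        rw [show -(1 + 2 * α) = 1 + 1 + -(3 + 2 * α) by ring, Real.rpow_add ha, Real.rpow_add ha,
          Real.rpow_one]
      have e2 : a ^ γ * a ^ (-(1 + 2 * α)) = a ^ (γ - 1 - 2 * α) := by
        rw [← Real.rpow_add ha]; ring_nf
      calc a * (ρ ^ (2 * α) + a ^ γ) * (a * (48 * d * a ^ (-(3 + 2 * α))))
          = 48 * d * (ρ ^ (2 * α) * (a * a * a ^ (-(3 + 2 * α))) +
            a ^ γ * (a * a * a ^ (-(3 + 2 * α)))) := by ring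
        _ = 48 * d * (ρ ^ (2 * α) * a ^ (-(1 + 2 * α)) + a ^ (γ - 1 - 2 * α)) := by rw [e1, e2]
        _ ≤ _ := by gcongr
  · rw [H1_le ha hma]
    have key : ∀ P, 0 ≤ P → P ≤ m⁻¹ * a ^ (-(2 * α)) → (ρ ^ (2 * α) + a ^ γ) * P ≤
        m ^ (2 * α - 1) * a ^ (-(2 * α)) + a ^ (γ - 1 - 2 * α) := by
      intro P hP hPm
      have e1 : m ^ (2 * α) * (m⁻¹ * a ^ (-(2 * α))) = m ^ (2 * α - 1) * a ^ (-(2 * α)) := by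
        rw [Real.rpow_sub_one hm0.ne']; field_simp
      have e2 : a ^ γ * (a⁻¹ * a ^ (-(2 * α))) = a ^ (γ - 1 - 2 * α) := by
        rw [← Real.rpow_neg_one, ← Real.rpow_add ha, ← Real.rpow_add ha]; ring_nf
      have i1 : m⁻¹ ≤ a⁻¹ := by gcongr
      have i2 : P ≤ a⁻¹ * a ^ (-(2 * α)) := hPm.trans (mul_le_mul_of_nonneg_right i1 (by positivity))
      rw [← e1, ← e2, add_mul]
      exact add_le_add (mul_le_mul hρm hPm hP (by positivity)) (mul_le_mul_of_nonneg_left i2 (by positivity))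
    rcases le_total (2 * d) ρ with hdρ | hdρ
    · have hmρ : m = ρ := max_eq_left hdρ
      have hρ0 : 0 < ρ := by linarith
      refine ⟨a * (48 * d * ρ ^ (-(3 + 2 * α))), by positivity, ?_, ?_⟩
      · intro r1 r2 _ _ h3 h4
        exact mul_le_mul_of_nonneg_left (powdiff hα0 hα hρ0 h3 hdρ h4) ha.le
      · have := key (a * a * ρ ^ (-(3 + 2 * α))) (by positivity) (by
          rw [hmρ]
          have e1 : ρ ^ (-(3 + 2 * α)) = ρ⁻¹ * ρ ^ (-(2 + 2 * α)) := by
            rw [← Real.rpow_neg_one, ← Real.rpow_add hρ0]; ring_nf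
          have e2 : a * a * a ^ (-(2 + 2 * α)) = a ^ (-(2 * α)) := by
            rw [show -(2 * α) = 1 + 1 + -(2 + 2 * α) by ring, Real.rpow_add ha, Real.rpow_add ha,
              Real.rpow_one]
          have i1 : ρ ^ (-(2 + 2 * α)) ≤ a ^ (-(2 + 2 * α)) :=
            Real.rpow_le_rpow_of_nonpos ha (hmρ ▸ hma) (by linarith)
          rw [← e2, e1]
          calc a * a * (ρ⁻¹ * ρ ^ (-(2 + 2 * α))) = ρ⁻¹ * (a * a * ρ ^ (-(2 + 2 * α))) := by ring
            _ ≤ _ := by gcongr)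
        calc a * (ρ ^ (2 * α) + a ^ γ) * (a * (48 * d * ρ ^ (-(3 + 2 * α))))
            = 48 * d * ((ρ ^ (2 * α) + a ^ γ) * (a * a * ρ ^ (-(3 + 2 * α)))) := by ring
          _ ≤ _ := mul_le_mul_of_nonneg_left this (by positivity)
    · have hmd : m = 2 * d := max_eq_right hdρ
      refine ⟨a * (2 * a ^ (-(2 + 2 * α))), by positivity, ?_, ?_⟩
      · intro r1 r2 h1 h2 _ _
        exact mul_le_mul_of_nonneg_left (powdiff2 hα0 ha h1 h2) ha.le
      · have e2 : a * a * a ^ (-(2 + 2 * α)) = a ^ (-(2 * α)) := by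
          rw [show -(2 * α) = 1 + 1 + -(2 + 2 * α) by ring, Real.rpow_add ha, Real.rpow_add ha,
            Real.rpow_one]
        have := key (m⁻¹ * a ^ (-(2 * α))) (by positivity) le_rfl
        have hnn : 0 ≤ (ρ ^ (2 * α) + a ^ γ) * (m⁻¹ * a ^ (-(2 * α))) := by positivity
        calc a * (ρ ^ (2 * α) + a ^ γ) * (a * (2 * a ^ (-(2 + 2 * α))))
            = 2 * m * ((ρ ^ (2 * α) + a ^ γ) * (m⁻¹ * (a * a * a ^ (-(2 + 2 * α))))) := by
              field_simp
          _ = 4 * d * ((ρ ^ (2 * α) + a ^ γ) * (m⁻¹ * a ^ (-(2 * α)))) := by rw [e2, hmd]; ring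
          _ ≤ 48 * d * ((ρ ^ (2 * α) + a ^ γ) * (m⁻¹ * a ^ (-(2 * α)))) := by gcongr; norm_num
          _ ≤ _ := mul_le_mul_of_nonneg_left this (by positivity)


set_option maxHeartbeats 2000000 in
theorem arc_est {α γ M c0 K ℓ r0 : ℝ} (hα0 : 0 < α) (hα : α ≤ 1 / 4) (hγ : 0 < γ) (hγα : 2 * α ≤ γ)
    (hM : 0 < M) (hc0 : 0 < c0) (hK : 0 < K) (hℓ : 0 < ℓ) (hℓM : M * ℓ ^ γ ≤ c0 / 4) (hr0 : 0 < r0)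
    (hKr : K * r0 ^ (2 * α) ≤ c0 / 4) :
    ∃ C > 0, ∀ {c : ℝ} {q q' : ℝ → R2}, Crv γ M c q q' → c0 ≤ c → ∀ (x e ν : R2), ‖x‖ ≤ M →
    ‖e‖ = 1 → ν = perp e → (∀ η, |inner ℝ ν (q' η)| ≤ K * ‖q η - x‖ ^ (2 * α)) →
    ∀ d, 0 < d → 2 * d ≤ r0 → ∀ A A', A ≤ A' → A' ≤ A + ℓ → ∃ m > 0, ∀ a, 0 < a → a ≤ 2 * M →
    ∃ b0 δ B, 0 ≤ δ ∧ 0 ≤ B ∧ 2 * δ * B ≤ C * d * (H1 α m a + a ^ (γ - 1 - 2 * α) + 1) ∧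
      ∀ η ∈ Icc A A', |inner ℝ e (q η - x)| ≤ a → |inner ℝ ν (q η - x) - b0| ≤ δ ∧
        ∀ r1 r2, a ≤ r1 → a ≤ r2 → ‖q η - x‖ ≤ r1 → |r1 - r2| ≤ d →
          a * |r1 ^ (-(2 + 2 * α)) - r2 ^ (-(2 + 2 * α))| ≤ B := by
  set C1 := 4 / c0 * (K + M * (4 / c0) ^ γ * ((2 * M) ^ (γ - 2 * α) + 1) + M * (4 / c0) ^ γ) with hC1
  have hC10 : 0 < C1 := by positivity
  set C2 := 4 * M * (2 * M * (48 * r0 ^ (-(3 + 2 * α)))) with hC2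
  have hC20 : 0 < C2 := by positivity
  refine ⟨96 * C1 + C2, by positivity, ?_⟩
  intro c q q' hq hc x e ν hx he hν hsl d hd hdr A A' hAA hAl
  have hν1 : ‖ν‖ = 1 := by rw [hν, norm_perp, he]
  have hcont : Continuous fun η => ‖q η - x‖ := by have := hq.cont; fun_prop
  obtain ⟨ηs, hηs, hmin⟩ := (isCompact_Icc (a := A) (b := A')).exists_isMinOn ⟨A, le_rfl, hAA⟩
    hcont.continuousOn
  set ρ := ‖q ηs - x‖ with hρ
  have hρ0 : 0 ≤ ρ := norm_nonneg _
  have hmin : ∀ η ∈ Icc A A', ρ ≤ ‖q η - x‖ := fun η hη => hmin hη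
  have hqM : ∀ η, ‖q η - x‖ ≤ 2 * M := fun η => (norm_sub_le _ _).trans (by linarith [hq.bd η])
  have hm0 : 0 < max ρ (2 * d) := lt_max_of_lt_right (by linarith)
  refine ⟨max ρ (2 * d), hm0, ?_⟩
  intro a ha haM
  have hH := H1_nn (α := α) (a := a) hm0
  have hag : 0 < a ^ (γ - 1 - 2 * α) := by positivity
  rcases le_or_gt r0 ρ with hfar | hnear
  · refine ⟨0, 2 * M, a * (48 * d * r0 ^ (-(3 + 2 * α))), by positivity, by positivity, ?_, ?_⟩
    · have h1 : 2 * (2 * M) * (a * (48 * d * r0 ^ (-(3 + 2 * α)))) ≤ C2 * d := by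
        rw [hC2]
        have : a * (48 * d * r0 ^ (-(3 + 2 * α))) ≤ 2 * M * (48 * d * r0 ^ (-(3 + 2 * α))) := by gcongr
        nlinarith
      have h2 : C2 * d * 1 ≤ (96 * C1 + C2) * d * (H1 α (max ρ (2 * d)) a + a ^ (γ - 1 - 2 * α) + 1) := by
        refine mul_le_mul ?_ (by linarith) (by norm_num) (by positivity)
        nlinarith
      linarith
    · intro η hη _
      refine ⟨?_, ?_⟩
      · rw [sub_zero]; exact (abs_inner_unit hν1 _).trans (hqM η)
      · intro r1 r2 _ _ h3 h4
        exact mul_le_mul_of_nonneg_left (powdiff hα0 hα hr0 ((hfar.trans (hmin η hη)).trans h3) hdr h4) ha.le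
  · by_cases hW : ∃ η0 ∈ Icc A A', |inner ℝ e (q η0 - x)| ≤ a
    · obtain ⟨η0, hη0, hX0⟩ := hW
      obtain ⟨B, hB0, hB, hBd⟩ := HB hα0 hα hγ ha hρ0 hd
      have hρ2 : 0 ≤ ρ ^ (2 * α) := by positivity
      have hcp : 0 < c := hc0.trans_le hc
      refine ⟨inner ℝ ν (q η0 - x), C1 * (a * (ρ ^ (2 * α) + a ^ γ)), B, by positivity, hB0, ?_, ?_⟩
      · calc 2 * (C1 * (a * (ρ ^ (2 * α) + a ^ γ))) * B = 2 * C1 * (a * (ρ ^ (2 * α) + a ^ γ) * B) := by ring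
          _ ≤ 2 * C1 * (48 * d * (H1 α (max ρ (2 * d)) a + a ^ (γ - 1 - 2 * α))) := by gcongr
          _ = (96 * C1) * d * (H1 α (max ρ (2 * d)) a + a ^ (γ - 1 - 2 * α)) := by ring
          _ ≤ _ := by
            refine mul_le_mul ?_ (by linarith) (by positivity) (by positivity)
            nlinarith
      · -- flatness
        have hslη : ∀ η, |inner ℝ ν (q' η)| ≤ K * ρ ^ (2 * α) + M * |η - ηs| ^ γ := by
          intro η
          have h1 := hsl ηs
          rw [← hρ] at h1
          have h2 := (abs_inner_unit hν1 (q' η - q' ηs)).trans (hq.hol η ηs)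
          rw [inner_sub_right] at h2
          have := abs_sub_abs_le_abs_sub (inner ℝ ν (q' η)) (inner ℝ ν (q' ηs))
          linarith
        have hshort : ∀ η ∈ Icc A A', ∀ η' ∈ Icc A A', M * |η - η'| ^ γ ≤ c0 / 4 := by
          intro η hη η' hη'
          refine le_trans (mul_le_mul_of_nonneg_left (Real.rpow_le_rpow (abs_nonneg _) ?_ hγ.le) hM.le) hℓM
          rw [abs_le]; constructor <;> linarith [hη.1, hη.2, hη'.1, hη'.2]
        have hKρ : K * ρ ^ (2 * α) ≤ c0 / 4 :=
          (mul_le_mul_of_nonneg_left (Real.rpow_le_rpow hρ0 hnear.le (by linarith)) hK.le).trans hKr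
        have hflat : ∀ η ∈ Icc A A', 3 * c / 4 ≤ |inner ℝ e (q' η)| := by
          intro η hη
          have h1 := hslη η
          have h2 := hshort η hη ηs hηs
          have h3 := normsq_decomp he (q' η)
          rw [hq.speed, ← hν] at h3
          have h4 : |inner ℝ ν (q' η)| ≤ c / 2 := by linarith
          have h5 : (inner ℝ ν (q' η)) ^ 2 ≤ (c / 2) ^ 2 := sq_le_sq' (abs_le.1 h4).1 (abs_le.1 h4).2
          refine le_of_sq_le_sq ?_ (abs_nonneg _)
          rw [sq_abs]; nlinarith
        have hexp : ∀ η ∈ Icc A A', ∀ η' ∈ Icc A A', |η - η'| ≤ 2 / c0 *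
            |inner ℝ e (q η - x) - inner ℝ e (q η' - x)| := by
          intro η hη η' hη'
          have h1 := hq.mono_dir hγ he (a := η) (b := η') (k := c / 2) (by
            linarith [hflat η' hη', hshort η hη η' hη'])
          have h2 : inner ℝ e (q η - x) - inner ℝ e (q η' - x) = inner ℝ e (q η - q η') := by
            simp only [inner_sub_right]; ring
          rw [h2, div_mul_eq_mul_div, le_div_iff₀ hc0]
          nlinarith [abs_nonneg (η - η')]
        intro η hη hX
        refine ⟨?_, fun r1 r2 h1 h2 h3 h4 => hB r1 r2 h1 h2 ((hmin η hη).trans h3) h4⟩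
        have d1 : |η - η0| ≤ 4 / c0 * a := by
          refine (hexp η hη η0 hη0).trans ?_
          have := (abs_sub (inner ℝ e (q η - x)) (inner ℝ e (q η0 - x)))
          calc _ ≤ 2 / c0 * (a + a) := by gcongr; linarith
            _ = _ := by ring
        have d2 : |η0 - ηs| ≤ 2 / c0 * (a + ρ) := by
          refine (hexp η0 hη0 ηs hηs).trans ?_
          have := (abs_sub (inner ℝ e (q η0 - x)) (inner ℝ e (q ηs - x)))
          have h3 := abs_inner_unit he (q ηs - x)
          gcongr; linarith
        have hρM : ρ ≤ 2 * M := hqM ηs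
        have h5 : ρ ^ γ ≤ (2 * M) ^ (γ - 2 * α) * ρ ^ (2 * α) := by
          rcases hρ0.eq_or_lt with h0 | h0
          · rw [← h0, Real.zero_rpow hγ.ne']; positivity
          calc ρ ^ γ = ρ ^ (γ - 2 * α) * ρ ^ (2 * α) := by rw [← Real.rpow_add h0]; ring_nf
            _ ≤ _ := mul_le_mul_of_nonneg_right (Real.rpow_le_rpow hρ0 hρM (by linarith)) hρ2
        have haγ : 0 < a ^ γ := by positivity
        have d3 : |η0 - ηs| ^ γ ≤ (4 / c0) ^ γ * (a ^ γ + (2 * M) ^ (γ - 2 * α) * ρ ^ (2 * α)) := by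
          have h6 : 2 / c0 * (a + ρ) ≤ 4 / c0 * max a ρ := by
            have : a + ρ ≤ 2 * max a ρ := by linarith [le_max_left a ρ, le_max_right a ρ]
            calc 2 / c0 * (a + ρ) ≤ 2 / c0 * (2 * max a ρ) := by gcongr
              _ = _ := by ring
          have h7 : (max a ρ) ^ γ ≤ a ^ γ + ρ ^ γ := by
            have : 0 ≤ ρ ^ γ := by positivity
            rcases max_choice a ρ with h | h <;> rw [h] <;> linarith
          calc |η0 - ηs| ^ γ ≤ (4 / c0 * max a ρ) ^ γ :=
                Real.rpow_le_rpow (abs_nonneg _) (d2.trans h6) hγ.le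
            _ = (4 / c0) ^ γ * (max a ρ) ^ γ := Real.mul_rpow (by positivity) (by positivity)
            _ ≤ _ := by gcongr; linarith
        have d4 : |η - η0| ^ γ ≤ (4 / c0) ^ γ * a ^ γ := by
          rw [← Real.mul_rpow (by positivity) ha.le]
          exact Real.rpow_le_rpow (abs_nonneg _) d1 hγ.le
        have e1 : inner ℝ ν (q η - x) - inner ℝ ν (q η0 - x) = inner ℝ ν (q η - q η0) := by
          simp only [inner_sub_right]; ring
        have t1 := hq.inner_taylor hγ hν1 η η0
        have t2 : |η - η0| ^ (1 + γ) ≤ |η - η0| * |η - η0| ^ γ := by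
          rcases (abs_nonneg (η - η0)).eq_or_lt with h0 | h0
          · rw [← h0, Real.zero_rpow (by linarith)]; simp
          · rw [Real.rpow_add h0, Real.rpow_one]
        rw [e1]
        have t3 : |inner ℝ ν (q η - q η0)| ≤ |η - η0| * (|inner ℝ ν (q' η0)| + M * |η - η0| ^ γ) := by
          have h6 := abs_sub_abs_le_abs_sub (inner ℝ ν (q η - q η0)) ((η - η0) * inner ℝ ν (q' η0))
          rw [abs_mul] at h6
          have h7 := mul_le_mul_of_nonneg_left t2 hM.le
          linarith
        refine t3.trans ?_
        have t4 := hslη η0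
        have t5 : |inner ℝ ν (q' η0)| + M * |η - η0| ^ γ ≤
            (K + M * (4 / c0) ^ γ * ((2 * M) ^ (γ - 2 * α) + 1) + M * (4 / c0) ^ γ) *
              (ρ ^ (2 * α) + a ^ γ) := by
          have h6 := mul_le_mul_of_nonneg_left d3 hM.le
          have h7 := mul_le_mul_of_nonneg_left d4 hM.le
          have h8 : 0 ≤ M * (4 / c0) ^ γ * (2 * M) ^ (γ - 2 * α) * a ^ γ := by positivity
          have h9 : 0 ≤ M * (4 / c0) ^ γ * ρ ^ (2 * α) := by positivity
          have h10 : 0 ≤ K * a ^ γ := by positivity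
          linarith
        calc _ ≤ 4 / c0 * a * ((K + M * (4 / c0) ^ γ * ((2 * M) ^ (γ - 2 * α) + 1) + M * (4 / c0) ^ γ) *
              (ρ ^ (2 * α) + a ^ γ)) :=
              mul_le_mul d1 t5 (by positivity) (by positivity)
          _ = _ := by rw [hC1]; ring
    · refine ⟨0, 0, 0, le_rfl, le_rfl, by simp; positivity, fun η hη hX => absurd ⟨η, hη, hX⟩ hW⟩

/-! ### The core velocity estimate -/

def Fr (x e : R2) (p : ℝ × ℝ) : R2 := x + (p.1 • e + p.2 • perp e)

theorem Fr_mp (x : R2) {e : R2} (he : ‖e‖ = 1) : MeasurePreserving (Fr x e) := by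
  let L : R2 →ₗ[ℝ] R2 :=
    { toFun := fun v => v 0 • e + v 1 • perp e
      map_add' := fun v w => by simp only [PiLp.add_apply, add_smul]; abel
      map_smul' := fun k v => by
        simp only [PiLp.smul_apply, smul_eq_mul, mul_smul, RingHom.id_apply, smul_add] }
  have hL : ∀ v, ‖L v‖ = ‖v‖ := fun v => by
    have h1 := normsq_decomp he (v 0 • e + v 1 • perp e)
    have e1 : inner ℝ e (perp e) = 0 := by
      have := inner_perp_self e; rw [real_inner_comm]; exact this
    have e2 : inner ℝ e e = 1 := by rw [real_inner_self_eq_norm_sq, he]; norm_num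
    have e3 : inner ℝ (perp e) (perp e) = 1 := by rw [real_inner_self_eq_norm_sq, norm_perp, he]; norm_num
    rw [inner_add_right, inner_add_right, inner_smul_right, inner_smul_right, inner_smul_right,
      inner_smul_right, real_inner_comm e (perp e), e1, e2, e3] at h1
    have h2 := normsq2 v
    have h3 : ‖v 0 • e + v 1 • perp e‖ ^ 2 = ‖v‖ ^ 2 := by rw [h1, h2]; ring
    exact (pow_left_inj₀ (norm_nonneg _) (norm_nonneg _) two_ne_zero).1 h3
  let I : R2 →ₗᵢ[ℝ] R2 := ⟨L, hL⟩
  have h1 := (I.toLinearIsometryEquiv rfl).measurePreserving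
  have h2 := (PiLp.volume_preserving_toLp (Fin 2))
  have h3 := (volume_preserving_finTwoArrow ℝ).symm
  have h4 := ((measurePreserving_add_left (volume : Measure R2) x).comp h1).comp (h2.comp h3)
  exact h4

theorem fold_bd {f : ℝ × ℝ → ℝ} (hf : Integrable f) {G : ℝ → ℝ} (hG : IntegrableOn G (Ioi 0))
    (h : ∀ a > 0, |∫ b, (f (a, b) + f (-a, b))| ≤ G a) : |∫ p, f p| ≤ ∫ a in Ioi 0, G a := by
  have hs : ∀ᵐ a : ℝ, Integrable fun b => f (a, b) := hf.prod_right_ae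
  have hs' : ∀ᵐ a : ℝ, Integrable fun b => f (-a, b) :=
    (Measure.measurePreserving_neg (volume : Measure ℝ)).quasiMeasurePreserving.ae hs
  have hφ : Integrable fun a => ∫ b, f (a, b) := hf.integral_prod_left
  have e1 : ∫ p, f p = ∫ a, ∫ b, f (a, b) := integral_prod f hf
  have e2 : ∫ a, ∫ b, f (a, b) = ∫ a in Ioi 0, ((∫ b, f (a, b)) + ∫ b, f (-a, b)) := by
    have hn : IntegrableOn (fun a => ∫ b, f (-a, b)) (Ioi 0) := hφ.comp_neg.integrableOn
    have e3 : ∫ a in Ioi 0, ((∫ b, f (a, b)) + ∫ b, f (-a, b)) =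
      (∫ a in Ioi 0, ∫ b, f (a, b)) + ∫ a in Ioi 0, ∫ b, f (-a, b) := integral_add hφ.integrableOn hn
    have e4 : ∫ a in Ioi 0, ∫ b, f (-a, b) = ∫ a in Iic (-0), ∫ b, f (a, b) :=
      integral_comp_neg_Ioi (0:ℝ) (fun a => ∫ b, f (a, b))
    rw [neg_zero] at e4
    rw [e3, e4, add_comm]
    have e5 : (∫ a in Iic 0, ∫ b, f (a, b)) + (∫ a in Ioi 0, ∫ b, f (a, b)) = ∫ a, ∫ b, f (a, b) :=
      intervalIntegral.integral_Iic_add_Ioi hφ.integrableOn hφ.integrableOn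
    exact e5.symm
  rw [e1, e2, ← Real.norm_eq_abs]
  refine norm_integral_le_of_norm_le hG ?_
  rw [ae_restrict_iff' measurableSet_Ioi]
  filter_upwards [hs, hs'] with a h1 h2 ha
  rw [← integral_add h1 h2]
  exact h a ha

def PP (α a b : ℝ) : ℝ := √(a ^ 2 + b ^ 2) ^ (-(2 + 2 * α))

theorem kernF (α a b : ℝ) {e : R2} (he : ‖e‖ = 1) :
    inner ℝ (perp e) (kern α (-(a • e + b • perp e))) = -a * PP α a b := by
  have e2 : inner ℝ e e = 1 := by rw [real_inner_self_eq_norm_sq, he]; norm_num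
  have e1 : inner ℝ e (perp e) = 0 := by rw [real_inner_comm]; exact inner_perp_self e
  have e3 : inner ℝ (perp e) (perp e) = 1 := by rw [real_inner_self_eq_norm_sq, norm_perp, he]; norm_num
  have hn : ‖-(a • e + b • perp e)‖ = √(a ^ 2 + b ^ 2) := by
    rw [norm_neg, eq_comm, Real.sqrt_eq_iff_mul_self_eq (by positivity) (norm_nonneg _), ← pow_two,
      normsq_decomp he]
    rw [inner_add_right, inner_add_right, inner_smul_right, inner_smul_right, inner_smul_right,
      inner_smul_right, real_inner_comm e (perp e), e1, e2, e3]
    ring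
  have hp : inner ℝ (perp e) (perp (-(a • e + b • perp e))) = -a := by
    have : inner ℝ (perp e) (perp (-(a • e + b • perp e))) = inner ℝ e (-(a • e + b • perp e)) := by
      rw [inner2, inner2, perp_0, perp_1, perp_0, perp_1]; ring
    rw [this, inner_neg_right, inner_add_right, inner_smul_right, inner_smul_right, e1, e2]; ring
  rw [kern, inner_smul_right, hp, hn, PP, Real.rpow_neg (Real.sqrt_nonneg _)]
  ring

theorem arc_index (k : ℕ) {η : ℝ} (hη : η ∈ Icc 0 (2 * π)) :
    ∃ i : Fin (k + 1), η ∈ Icc (2 * π * i / (k + 1)) (2 * π * (i + 1) / (k + 1)) := by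
  have hpi := Real.pi_pos
  have hk : (0:ℝ) < k + 1 := by positivity
  rcases hη.2.eq_or_lt with h | h
  · refine ⟨Fin.last k, ?_, ?_⟩
    · rw [div_le_iff₀ hk, h, Fin.val_last]; nlinarith
    · rw [le_div_iff₀ hk, h, Fin.val_last]
  · have h0 : 0 ≤ η * (k + 1) / (2 * π) := by have := hη.1; positivity
    have h1 := Nat.floor_le h0
    have h2 := Nat.lt_floor_add_one (η * (k + 1) / (2 * π))
    have h3 : ⌊η * (k + 1) / (2 * π)⌋₊ < k + 1 := by
      rw [Nat.floor_lt h0, div_lt_iff₀ (by positivity)]; push_cast; nlinarith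
    refine ⟨⟨_, h3⟩, ?_, ?_⟩
    · rw [div_le_iff₀ hk]; rw [le_div_iff₀ (by positivity)] at h1; simp only; linarith
    · rw [le_div_iff₀ hk]; rw [div_lt_iff₀ (by positivity)] at h2; simp only; linarith

set_option maxHeartbeats 2000000 in
theorem core1 {α γ M c0 K : ℝ} (hα0 : 0 < α) (hα : α ≤ 1 / 4) (hγ : 0 < γ) (hγα : 2 * α < γ)
    (hM : 0 < M) (hc0 : 0 < c0) (hK : 0 < K) :
    ∃ C > 0, ∃ d2 > 0, ∀ {c : ℝ} {q q' : ℝ → R2} {Ω : Set R2}, Crv γ M c q q' → c0 ≤ c → Bdy q Ω →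
    ∀ (x e : R2), ‖x‖ ≤ M → ‖e‖ = 1 → (∀ η, |inner ℝ (perp e) (q' η)| ≤ K * ‖q η - x‖ ^ (2 * α)) →
    ∀ d, 0 < d → d ≤ d2 → |inner ℝ (perp e) (∫ y in Ω, kern α (x - y)) -
      inner ℝ (perp e) (∫ y in Ω, kern α (x - d • perp e - y))| ≤ C * d := by
  have hpi := Real.pi_pos
  obtain ⟨ℓ, hℓM, hℓ⟩ := ((rpow_small (A := M) hγ (by positivity : 0 < c0 / 4)).and
    self_mem_nhdsWithin).exists
  obtain ⟨r0, hKr, hr0⟩ := ((rpow_small (A := K) (by positivity : 0 < 2 * α)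
    (by positivity : 0 < c0 / 4)).and self_mem_nhdsWithin).exists
  replace hℓ : 0 < ℓ := hℓ
  replace hr0 : 0 < r0 := hr0
  obtain ⟨Ca, hCa, harc⟩ := arc_est hα0 hα hγ hγα.le hM hc0 hK hℓ hℓM.le hr0 hKr.le
  obtain ⟨k, hk⟩ := exists_nat_gt (2 * π / ℓ)
  have hk1 : (0:ℝ) < k + 1 := by positivity
  have iJ : IntegrableOn (fun a : ℝ => a ^ (γ - 1 - 2 * α) + 1) (Ioc 0 (2 * M)) := by
    have := (intervalIntegral.intervalIntegrable_rpow' (a := 0) (b := 2 * M)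
      (by linarith : -1 < γ - 1 - 2 * α))
    rw [intervalIntegrable_iff_integrableOn_Ioc_of_le (by positivity)] at this
    exact this.add (integrableOn_const measure_Ioc_lt_top.ne)
  set J := ∫ a in Ioc 0 (2 * M), (a ^ (γ - 1 - 2 * α) + 1) with hJ
  have hJ0 : 0 ≤ J := setIntegral_nonneg measurableSet_Ioc fun a ha => by have := ha.1; positivity
  have h2α : 0 < 1 - 2 * α := by linarith
  set Q := 1 / (1 - 2 * α) + 1 / (2 * α) + J with hQ
  refine ⟨(k + 1) * (Ca * Q), by positivity, r0 / 2, by positivity, ?_⟩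
  intro c q q' Ω hq hc hB x e hx he hsl d hd hd2
  have hper : ∀ ξ, q (ξ + 2 * π) = q ξ := hq.per
  have hΩM := hB.ball hq
  have hmΩ := hB.op.measurableSet
  choose m hm0 hm using fun i : Fin (k + 1) => harc hq hc x e (perp e) hx he rfl hsl d hd (by linarith)
    (2 * π * i / (k + 1)) (2 * π * (i + 1) / (k + 1)) (by gcongr; linarith) (by
      have : 2 * π / (k + 1) ≤ ℓ := by
        rw [div_le_iff₀ hk1]; rw [div_lt_iff₀ hℓ] at hk; nlinarith
      have e : 2 * π * (i + 1) / (k + 1 : ℝ) = 2 * π * i / (k + 1) + 2 * π / (k + 1) := by ring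
      rw [e]; linarith)
  set g : R2 → ℝ := fun w => inner ℝ (perp e) (kern α (x - w)) -
    inner ℝ (perp e) (kern α (x - d • perp e - w)) with hg
  have i1 := kern_int α hα0 hα hmΩ hΩM x
  have i2 := kern_int α hα0 hα hmΩ hΩM (x - d • perp e)
  have ig : IntegrableOn g Ω := (i1.const_inner (perp e)).sub (i2.const_inner (perp e))
  have eq1 : inner ℝ (perp e) (∫ y in Ω, kern α (x - y)) -
      inner ℝ (perp e) (∫ y in Ω, kern α (x - d • perp e - y)) = ∫ w in Ω, g w := by
    rw [← integral_inner i1, ← integral_inner i2,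
      ← integral_sub (i1.const_inner (perp e)) (i2.const_inner (perp e))]
  have igi := (integrable_indicator_iff hmΩ).2 ig
  have hmp := Fr_mp x he
  set f : ℝ × ℝ → ℝ := fun p => Ω.indicator g (Fr x e p) with hf
  have hfi : Integrable f := (hmp.integrable_comp igi.aestronglyMeasurable).2 igi
  have eq2 : ∫ w in Ω, g w = ∫ p, f p := by
    rw [← integral_indicator hmΩ]
    conv_lhs => rw [← hmp.map_eq]
    refine integral_map hmp.measurable.aemeasurable ?_
    rw [hmp.map_eq]; exact igi.aestronglyMeasurable
  have hgF : ∀ a b, g (Fr x e (a, b)) = -a * (PP α a b - PP α a (b + d)) := by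
    intro a b
    rw [hg, Fr]
    simp only
    rw [show x - (x + (a • e + b • perp e)) = -(a • e + b • perp e) by abel,
      show x - d • perp e - (x + (a • e + b • perp e)) = -(a • e + (b + d) • perp e) by
        rw [add_smul]; abel, kernF α a b he, kernF α a (b + d) he]
    ring
  have hPn : ∀ a b, PP α (-a) b = PP α a b := fun a b => by rw [PP, PP, neg_sq]
  have e1 : inner ℝ e (perp e) = 0 := by rw [real_inner_comm]; exact inner_perp_self e
  have e2 : inner ℝ e e = 1 := by rw [real_inner_self_eq_norm_sq, he]; norm_num
  have e3 : inner ℝ (perp e) (perp e) = 1 := by rw [real_inner_self_eq_norm_sq, norm_perp, he]; norm_num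
  have hie : ∀ a b, inner ℝ e (Fr x e (a, b) - x) = a := fun a b => by
    rw [Fr, add_sub_cancel_left, inner_add_right, inner_smul_right, inner_smul_right, e1, e2]; simp
  have hin : ∀ a b, inner ℝ (perp e) (Fr x e (a, b) - x) = b := fun a b => by
    rw [Fr, add_sub_cancel_left, inner_add_right, inner_smul_right, inner_smul_right,
      real_inner_comm, e1, e3]; simp
  -- the pointwise bound
  set G0 : ℝ → ℝ := fun a => ∑ i : Fin (k + 1), Ca * d * (H1 α (m i) a + (a ^ (γ - 1 - 2 * α) + 1)) with hG0
  have iG0 : IntegrableOn G0 (Ioc 0 (2 * M)) := integrable_finsetSum _ fun i _ =>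
    (((H1_int hα0 hα (hm0 i)).1.integrableOn).add iJ).const_mul _
  set G := (Ioc 0 (2 * M)).indicator G0 with hG
  have iG : IntegrableOn G (Ioi 0) := ((integrable_indicator_iff measurableSet_Ioc).2 iG0).integrableOn
  have key : ∀ a > 0, |∫ b, (f (a, b) + f (-a, b))| ≤ G a := by
    intro a ha
    have hkk : ∀ b, f (a, b) + f (-a, b) ≠ 0 →
        a ≤ 2 * M ∧ |f (a, b) + f (-a, b)| = a * |PP α a b - PP α a (b + d)| ∧
        ∃ η ∈ Icc 0 (2 * π), |inner ℝ e (q η - x)| ≤ a ∧ inner ℝ (perp e) (q η - x) = b := by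
      intro b hb
      have hcon : IsPreconnected ((fun a' => Fr x e (a', b)) '' Icc (-a) a) := by
        refine isPreconnected_Icc.image _ (Continuous.continuousOn ?_)
        unfold Fr; fun_prop
      have m1 : Fr x e (a, b) ∈ (fun a' => Fr x e (a', b)) '' Icc (-a) a :=
        ⟨a, ⟨by linarith, le_rfl⟩, rfl⟩
      have m2 : Fr x e (-a, b) ∈ (fun a' => Fr x e (a', b)) '' Icc (-a) a :=
        ⟨-a, ⟨le_rfl, by linarith⟩, rfl⟩
      have hinM : ∀ a', Fr x e (a', b) ∈ Ω → |a'| ≤ 2 * M := fun a' h => by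
        have h1 := abs_inner_unit he (Fr x e (a', b) - x)
        rw [hie] at h1
        have := norm_sub_le (Fr x e (a', b)) x
        linarith [hΩM _ h]
      have hcross : ¬ (Fr x e (a, b) ∈ Ω ↔ Fr x e (-a, b) ∈ Ω) →
          ∃ η ∈ Icc 0 (2 * π), |inner ℝ e (q η - x)| ≤ a ∧ inner ℝ (perp e) (q η - x) = b := by
        intro hne
        have : ∃ w ∈ (fun a' => Fr x e (a', b)) '' Icc (-a) a, w ∈ frontier Ω := by
          by_contra hno
          push Not at hno
          exact hne ⟨fun h => pre_sub hcon hB.op hno m1 h m2, fun h => pre_sub hcon hB.op hno m2 h m1⟩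
        obtain ⟨_, ⟨a', ha', rfl⟩, hw⟩ := this
        rw [← hB.fr] at hw
        obtain ⟨η0, hη0⟩ := hw
        obtain ⟨η, hη, hr⟩ := redper η0
        have hqη : q η = Fr x e (a', b) := by rw [← hr q hper]; exact hη0
        refine ⟨η, hη, ?_, ?_⟩
        · rw [hqη, hie]; exact abs_le.2 ha'
        · rw [hqη, hin]
      have hgp := hgF a b
      have hgn := hgF (-a) b
      rw [hPn, hPn, neg_neg] at hgn
      by_cases c1 : Fr x e (a, b) ∈ Ω <;> by_cases c2 : Fr x e (-a, b) ∈ Ω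
      · exfalso; apply hb
        simp only [hf]
        rw [indicator_of_mem c1, indicator_of_mem c2, hgp, hgn]; ring
      · refine ⟨by have := hinM a c1; rwa [abs_of_pos ha] at this, ?_, hcross (by tauto)⟩
        simp only [hf]
        rw [indicator_of_mem c1, indicator_of_notMem c2, hgp, add_zero, abs_mul, abs_neg, abs_of_pos ha]
      · refine ⟨by have := hinM _ c2; rwa [abs_neg, abs_of_pos ha] at this, ?_, hcross (by tauto)⟩
        simp only [hf]
        rw [indicator_of_notMem c1, indicator_of_mem c2, hgn, zero_add, abs_mul, abs_of_pos ha]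
      · exfalso; apply hb
        simp only [hf]
        rw [indicator_of_notMem c1, indicator_of_notMem c2, add_zero]
    rcases le_or_gt a (2 * M) with haM | haM
    · choose b0 δ B hδ hB0 hδB hcov using fun i => hm i a ha haM
      rw [hG, indicator_of_mem (show a ∈ Ioc 0 (2 * M) from ⟨ha, haM⟩)]
      refine (int1_bd _ b0 δ B hδ hB0 ?_).trans (Finset.sum_le_sum fun i _ => ?_)
      · intro b hb
        obtain ⟨_, hval, η, hη, hη1, hη2⟩ := hkk b hb
        obtain ⟨i, hi⟩ := arc_index k hη
        obtain ⟨h1, h2⟩ := hcov i η hi hη1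
        refine ⟨i, by rw [← hη2]; exact h1, ?_⟩
        rw [hval]
        refine h2 _ _ ?_ ?_ ?_ ?_
        · exact Real.le_sqrt_of_sq_le (by nlinarith)
        · exact Real.le_sqrt_of_sq_le (by nlinarith)
        · refine Real.le_sqrt_of_sq_le ?_
          rw [normsq_decomp he, hη2]
          have := sq_le_sq' (by linarith [(abs_le.1 hη1).1]) (abs_le.1 hη1).2
          linarith
        · have hs1 : ∀ b : ℝ, √(a ^ 2 + b ^ 2) = ‖mk2 a b‖ := fun b => by
            rw [Real.sqrt_eq_iff_mul_self_eq (by positivity) (norm_nonneg _), ← pow_two, normsq2]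
            simp [mk2]
          rw [hs1, hs1]
          refine (abs_norm_sub_norm_le _ _).trans ?_
          have h3 : ‖mk2 a b - mk2 a (b + d)‖ ^ 2 = d ^ 2 := by
            rw [normsq2]; simp [mk2]
          exact ((pow_left_inj₀ (norm_nonneg _) hd.le two_ne_zero).1 h3).le
      · rw [← add_assoc]; exact hδB i
    · have h0 : ∀ b, f (a, b) + f (-a, b) = 0 := fun b => by
        by_contra hb
        exact absurd (hkk b hb).1 (not_le.2 haM)
      simp only [h0, integral_zero, abs_zero]
      rw [hG, indicator_of_notMem (fun h => absurd h.2 (not_le.2 haM))]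
  rw [eq1, eq2]
  refine (fold_bd hfi iG key).trans ?_
  have e5 : ∫ a in Ioi 0, G a = ∫ a in Ioc 0 (2 * M), G0 a := by
    rw [hG, setIntegral_indicator measurableSet_Ioc]
    congr 2
    exact inter_eq_right.2 Ioc_subset_Ioi_self
  have e7 : ∀ i ∈ Finset.univ, IntegrableOn (fun a : ℝ => Ca * d * (H1 α (m i) a +
      (a ^ (γ - 1 - 2 * α) + 1))) (Ioc 0 (2 * M)) := fun i _ =>
    (((H1_int hα0 hα (hm0 i)).1.integrableOn).add iJ).const_mul _
  rw [e5, hG0, integral_finsetSum _ e7]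
  have e6 : ∀ i : Fin (k + 1), ∫ a in Ioc 0 (2 * M), Ca * d * (H1 α (m i) a + (a ^ (γ - 1 - 2 * α) + 1))
      ≤ Ca * d * Q := by
    intro i
    rw [integral_const_mul, integral_add (H1_int hα0 hα (hm0 i)).1.integrableOn iJ, ← hJ]
    rw [hQ, ← (H1_int hα0 hα (hm0 i)).2]
    refine mul_le_mul_of_nonneg_left (add_le_add ?_ le_rfl) (by positivity)
    exact setIntegral_le_integral (H1_int hα0 hα (hm0 i)).1 (Eventually.of_forall fun a => H1_nn (hm0 i))
  refine (Finset.sum_le_sum fun i _ => e6 i).trans ?_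
  rw [Finset.sum_const, Finset.card_univ, Fintype.card_fin, nsmul_eq_mul]
  push_cast
  exact le_of_eq (by ring)

theorem Sol.γα {α γ T cα M : ℝ} {N : ℕ} {θ : Fin N → ℝ} {Ω : Fin N → ℝ → Set R2}
    {p p' : Fin N → ℝ → ℝ → R2} {c : Fin N → ℝ → ℝ} (h : Sol α γ T cα M N θ Ω p p' c) : 2 * α < γ := by
  have h0 := h.hα0; have h1 := h.hα
  rw [h.hγ, lt_div_iff₀ (by linarith)]; nlinarith

theorem Sol.core {α γ T cα M : ℝ} {N : ℕ} {θ : Fin N → ℝ} {Ω : Fin N → ℝ → Set R2}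
    {p p' : Fin N → ℝ → ℝ → R2} {c : Fin N → ℝ → ℝ} (h : Sol α γ T cα M N θ Ω p p' c) :
    ∃ C > 0, ∃ d2 > 0, ∀ t ∈ Ico 0 T, ∀ n ξ (ν : R2), ‖ν‖ = 1 → inner ℝ ν (p' n t ξ) = 0 →
      ∀ d, 0 < d → d ≤ d2 → |inner ℝ ν (gSQGvel α cα θ (fun n => Ω n t) (p n t ξ) -
        gSQGvel α cα θ (fun n => Ω n t) (p n t ξ - d • ν))| ≤ C * d := by
  obtain ⟨c0, hc0, hcl⟩ := h.clow
  obtain ⟨K, hK, hsl⟩ := h.slope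
  obtain ⟨C, hC, d2, hd2, hcore⟩ := core1 h.hα0 h.hα h.γ0 h.γα h.hM hc0 hK
  have hcα := h.hcα
  refine ⟨cα * (∑ j, |θ j|) * C + 1, ?_, d2, hd2, ?_⟩
  · have : 0 ≤ ∑ j, |θ j| := Finset.sum_nonneg fun j _ => abs_nonneg _
    positivity
  intro t ht n ξ ν hν hperp d hd hdd
  have hee : perp (-perp ν) = ν := by
    have := perp_perp ν
    rw [show -perp ν = (-1:ℝ) • perp ν by simp, perp_smul, this]; simp
  have hj : ∀ j, |inner ℝ ν (∫ y in Ω j t, kern α (p n t ξ - y)) -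
      inner ℝ ν (∫ y in Ω j t, kern α (p n t ξ - d • ν - y))| ≤ C * d := fun j => by
    have := hcore (h.crv j t ht) (hcl j t ht) (h.bdy j t ht) (p n t ξ) (-perp ν)
      ((h.crv n t ht).bd ξ) (by rw [norm_neg, norm_perp, hν]) (fun η => by
        rw [hee]; exact hsl t ht n j ξ η ν hν hperp) d hd hdd
    rwa [hee] at this
  have e1 : inner ℝ ν (gSQGvel α cα θ (fun n => Ω n t) (p n t ξ) -
        gSQGvel α cα θ (fun n => Ω n t) (p n t ξ - d • ν)) = cα * ∑ j, θ j *
        (inner ℝ ν (∫ y in Ω j t, kern α (p n t ξ - y)) -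
      inner ℝ ν (∫ y in Ω j t, kern α (p n t ξ - d • ν - y))) := by
    rw [gSQGvel, gSQGvel, ← smul_sub, ← Finset.sum_sub_distrib, inner_smul_right, inner_sum]
    congr 1
    refine Finset.sum_congr rfl fun j _ => ?_
    rw [← smul_sub, inner_smul_right, inner_sub_right]
  rw [e1, abs_mul, abs_of_pos hcα]
  have e2 : |∑ j, θ j * (inner ℝ ν (∫ y in Ω j t, kern α (p n t ξ - y)) -
      inner ℝ ν (∫ y in Ω j t, kern α (p n t ξ - d • ν - y)))| ≤ ∑ j, |θ j| * (C * d) :=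
    (Finset.abs_sum_le_sum_abs _ _).trans (Finset.sum_le_sum fun j _ => by
      rw [abs_mul]; exact mul_le_mul_of_nonneg_left (hj j) (abs_nonneg _))
  rw [← Finset.sum_mul] at e2
  have := mul_le_mul_of_nonneg_left e2 hcα.le
  nlinarith

/-! ### The minimal distance and its decay -/

theorem distT_shift (ξ η : ℝ) (k k' : ℤ) : distT ξ η ≤ distT (ξ + 2 * π * k) (η + 2 * π * k') := by
  obtain ⟨m, h, -⟩ := distT_attained (ξ + 2 * π * k) (η + 2 * π * k')
  rw [h]
  refine (distT_le ξ η (k - k' + m)).trans (le_of_eq ?_)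
  congr 1; push_cast; ring

theorem redperk (ξ : ℝ) : ∃ ζ ∈ Icc 0 (2 * π), ∃ k : ℤ, ζ = ξ + 2 * π * k := by
  have hp := Real.pi_pos
  refine ⟨toIcoMod (by positivity : (0:ℝ) < 2 * π) 0 ξ, ?_, -toIcoDiv (by positivity : (0:ℝ) < 2 * π) 0 ξ, ?_⟩
  · have := toIcoMod_mem_Ico (by positivity : (0:ℝ) < 2 * π) 0 ξ
    rw [zero_add] at this; exact Ico_subset_Icc_self this
  · rw [toIcoMod, zsmul_eq_mul]; push_cast; ring

theorem distT_cont : Continuous fun q : ℝ × ℝ => distT q.1 q.2 := by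
  refine (LipschitzWith.of_le_add_mul 2 fun q q' => ?_).continuous
  refine (distT_lip q.1 q.2 q'.1 q'.2).trans ?_
  have h1 := abs_sub (q.1 - q'.1) (q.2 - q'.2)
  have h2 : |q.1 - q'.1| ≤ dist q q' := by rw [← Real.dist_eq]; exact le_max_left _ _
  have h3 : |q.2 - q'.2| ≤ dist q q' := by rw [← Real.dist_eq]; exact le_max_right _ _
  have : ((2:NNReal):ℝ) = 2 := rfl
  rw [this]; linarith

/-- `D` is a truncated minimal distance between far-away boundary points. -/
structure MinD (T ℓ d1 : ℝ) {N : ℕ} (p : Fin N → ℝ → ℝ → R2) (D : ℝ → ℝ) : Prop where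
  pos : ∀ t ∈ Ico 0 T, 0 < D t
  le : ∀ t ∈ Ico 0 T, D t ≤ d1
  low : ∀ t ∈ Ico 0 T, ∀ n j ξ η, (n ≠ j ∨ ℓ ≤ distT ξ η) → D t ≤ ‖p n t ξ - p j t η‖
  att : ∀ t ∈ Ico 0 T, D t = d1 ∨ ∃ n j ξ η, (n ≠ j ∨ ℓ ≤ distT ξ η) ∧ D t = ‖p n t ξ - p j t η‖

namespace Sol
variable {α γ T cα M : ℝ} {N : ℕ} {θ : Fin N → ℝ} {Ω : Fin N → ℝ → Set R2}
    {p p' : Fin N → ℝ → ℝ → R2} {c : Fin N → ℝ → ℝ}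

theorem exD (S : Sol α γ T cα M N θ Ω p p' c) {ℓ d1 : ℝ} (hℓ : 0 < ℓ) (hd1 : 0 < d1) :
    ∃ D, MinD T ℓ d1 p D := by
  have hex : ∀ t, t ∈ Ico 0 T → ∃ D, 0 < D ∧ D ≤ d1 ∧
      (∀ n j ξ η, (n ≠ j ∨ ℓ ≤ distT ξ η) → D ≤ ‖p n t ξ - p j t η‖) ∧
      (D = d1 ∨ ∃ n j ξ η, (n ≠ j ∨ ℓ ≤ distT ξ η) ∧ D = ‖p n t ξ - p j t η‖) := by
    intro t ht
    let A : Fin N → Fin N → Set (ℝ × ℝ) := fun n j => (Icc 0 (2 * π) ×ˢ Icc 0 (2 * π)) ∩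
      {q | n ≠ j ∨ ℓ ≤ distT q.1 q.2}
    let W : Set ℝ := {d1} ∪ ⋃ n, ⋃ j, (fun q : ℝ × ℝ => ‖p n t q.1 - p j t q.2‖) '' A n j
    have hA : ∀ n j, IsCompact (A n j) := fun n j => by
      refine (isCompact_Icc.prod isCompact_Icc).inter_right ?_
      exact (isClosed_const (p := n ≠ j)).union (isClosed_le continuous_const distT_cont)
    have hW : IsCompact W := by
      refine isCompact_singleton.union (isCompact_iUnion fun n => isCompact_iUnion fun j => ?_)
      refine (hA n j).image ?_
      have h1 := (S.crv n t ht).cont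
      have h2 := (S.crv j t ht).cont
      fun_prop
    have hWne : W.Nonempty := ⟨d1, Or.inl rfl⟩
    have hmem := hW.sInf_mem hWne
    have hlow : ∀ y ∈ W, sInf W ≤ y := fun y hy => csInf_le hW.bddBelow hy
    have hatt : sInf W = d1 ∨ ∃ n j ξ η, (n ≠ j ∨ ℓ ≤ distT ξ η) ∧ sInf W = ‖p n t ξ - p j t η‖ := by
      rcases hmem with h | h
      · exact Or.inl h
      · simp only [mem_iUnion] at h
        obtain ⟨n, j, q, hq, hqe⟩ := h
        exact Or.inr ⟨n, j, q.1, q.2, hq.2, hqe.symm⟩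
    refine ⟨sInf W, ?_, hlow _ (Or.inl rfl), ?_, hatt⟩
    · rcases hatt with h | ⟨n, j, ξ, η, had, h⟩
      · rw [h]; exact hd1
      · rw [h, norm_pos_iff, sub_ne_zero]
        by_cases hnj : n = j
        · subst hnj
          intro he
          have := S.smp n t ht ξ η he
          rcases had with had | had
          · exact had rfl
          · linarith
        · exact S.disj t ht n j hnj ξ η
    · intro n j ξ η had
      obtain ⟨ζ, hζ, k, hk⟩ := redperk ξ
      obtain ⟨ζ', hζ', k', hk'⟩ := redperk η
      apply hlow
      refine Or.inr (mem_iUnion.2 ⟨n, mem_iUnion.2 ⟨j, (ζ, ζ'), ⟨⟨hζ, hζ'⟩, ?_⟩, ?_⟩⟩)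
      · rcases had with had | had
        · exact Or.inl had
        · refine Or.inr (had.trans ?_)
          rw [hk, hk']; exact distT_shift _ _ _ _
      · simp only
        rw [hk, hk', (S.crv n t ht).perk, (S.crv j t ht).perk]
  choose! D h1 h2 h3 h4 using hex
  exact ⟨D, h1, h2, h3, h4⟩

theorem contD (S : Sol α γ T cα M N θ Ω p p' c) {ℓ d1 : ℝ} {D : ℝ → ℝ} (hD : MinD T ℓ d1 p D) :
    ContinuousOn D (Ico 0 T) := by
  intro t0 ht0
  rw [ContinuousWithinAt, Metric.tendsto_nhds]
  intro ε hε
  have hcl : ∀ᶠ t in nhdsWithin t0 (Ico 0 T), ∀ n, ∃ a, ∀ ξ,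
      ‖p n t ξ - p n t0 (a + ξ)‖ < ε / 3 ∧ ‖p' n t ξ - p' n t0 (a + ξ)‖ < ε / 3 :=
    eventually_all.2 fun n => S.close n ht0 (by positivity)
  filter_upwards [hcl, self_mem_nhdsWithin] with t hcl ht
  choose a ha using hcl
  have hcmp : ∀ n j ξ η, |‖p n t ξ - p j t η‖ - ‖p n t0 (a n + ξ) - p j t0 (a j + η)‖| < ε := by
    intro n j ξ η
    refine (abs_norm_sub_norm_le _ _).trans_lt ?_
    rw [show p n t ξ - p j t η - (p n t0 (a n + ξ) - p j t0 (a j + η)) =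
      (p n t ξ - p n t0 (a n + ξ)) - (p j t η - p j t0 (a j + η)) by abel]
    refine (norm_sub_le _ _).trans_lt ?_
    linarith [(ha n ξ).1, (ha j η).1]
  have hdT : ∀ b ξ η : ℝ, distT (b + ξ) (b + η) = distT ξ η := fun b ξ η => by
    unfold distT; congr 1; ext k; congr 1; ring
  rw [Real.dist_eq, abs_lt]
  constructor
  · rcases hD.att t ht with h | ⟨n, j, ξ, η, had, h⟩
    · have := hD.le t0 ht0; linarith
    · have h1 := hD.low t0 ht0 n j (a n + ξ) (a j + η) (by
        by_cases hnj : n = j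
        · subst hnj; rw [hdT]; exact had
        · exact Or.inl hnj)
      have := (abs_lt.1 (hcmp n j ξ η)).1; linarith
  · rcases hD.att t0 ht0 with h | ⟨n, j, ξ, η, had, h⟩
    · have := hD.le t ht; linarith
    · have h1 := hD.low t ht n j (-a n + ξ) (-a j + η) (by
        by_cases hnj : n = j
        · subst hnj; rw [hdT]; exact had
        · exact Or.inl hnj)
      have := (abs_lt.1 (hcmp n j (-a n + ξ) (-a j + η))).2
      rw [add_neg_cancel_left, add_neg_cancel_left] at this
      linarith

theorem wlow (S : Sol α γ T cα M N θ Ω p p' c) {ℓ d1 c0 : ℝ} {D : ℝ → ℝ} (hD : MinD T ℓ d1 p D)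
    (hc0 : 0 < c0) (hcl : ∀ n, ∀ t ∈ Ico 0 T, c0 ≤ c n t) (hℓM : M * ℓ ^ γ ≤ c0 / 2)
    (hd1 : d1 ≤ c0 * ℓ / 16) {t : ℝ} (ht : t ∈ Ico 0 T) {n j ξ η} (had : n ≠ j ∨ ℓ / 4 ≤ distT ξ η) :
    D t ≤ ‖p n t ξ - p j t η‖ := by
  by_cases hnj : n = j
  · subst hnj
    replace had : ℓ / 4 ≤ distT ξ η := had.resolve_left (fun h => h rfl)
    rcases le_total ℓ (distT ξ η) with h | h
    · exact hD.low t ht _ _ _ _ (Or.inr h)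
    · obtain ⟨k, hk, -⟩ := distT_attained ξ η
      have hC := S.crv n t ht
      have h1 := hC.chord S.γ0 (ξ := ξ + 2 * π * k) (η := η) (by
        rw [show ξ + 2 * π * k - η = ξ - η + 2 * π * k by ring, ← hk]
        have h2 := Real.rpow_le_rpow (distT_nonneg ξ η) h S.γ0.le
        have := mul_le_mul_of_nonneg_left h2 S.hM.le
        linarith [hcl n t ht])
      rw [hC.perk, show ξ + 2 * π * k - η = ξ - η + 2 * π * k by ring, ← hk] at h1
      have h3 : c0 / 2 * (ℓ / 4) ≤ c n t / 2 * distT ξ η := by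
        have := hcl n t ht
        have := distT_nonneg ξ η
        gcongr <;> linarith
      have := hD.le t ht
      have h4 := (hD.pos t ht)
      linarith
  · exact hD.low t ht _ _ _ _ (Or.inl hnj)

set_option maxHeartbeats 1000000 in
theorem dkey (S : Sol α γ T cα M N θ Ω p p' c) {ℓ d1 C d2 κ K : ℝ} {D : ℝ → ℝ} (hℓ : 0 < ℓ)
    (hDpos : ∀ t ∈ Ico 0 T, 0 < D t) {t : ℝ} (ht : t ∈ Ico 0 T) (hDd : D t ≤ d2)
    (hcore : ∀ t ∈ Ico 0 T, ∀ n ξ (ν : R2), ‖ν‖ = 1 → inner ℝ ν (p' n t ξ) = 0 →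
      ∀ d, 0 < d → d ≤ d2 → |inner ℝ ν (gSQGvel α cα θ (fun n => Ω n t) (p n t ξ) -
        gSQGvel α cα θ (fun n => Ω n t) (p n t ξ - d • ν))| ≤ C * d)
    (n j : Fin N) (hlow : ∀ ξ η, (n ≠ j ∨ ℓ / 4 ≤ distT ξ η) → D t ≤ ‖p n t ξ - p j t η‖)
    (hκ : C * D t < κ) :
    ∀ᶠ h in nhdsWithin (0:ℝ) (Ioi 0), ∀ φ ∈ Icc 0 (2 * π), ∀ ψ ∈ Icc 0 (2 * π),
      (n ≠ j ∨ ℓ / 2 ≤ distT φ ψ) → ‖p n t φ - p j t ψ‖ ≤ D t + h * K →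
      -κ * ‖p n t φ - p j t ψ‖ < inner ℝ (p n t φ - p j t ψ)
        (gSQGvel α cα θ (fun n => Ω n t) (p n t φ) - gSQGvel α cα θ (fun n => Ω n t) (p j t ψ)) := by
  by_contra hcon
  obtain ⟨F, hF, hFn⟩ := ultra_of hcon
  set u := gSQGvel α cα θ (fun n => Ω n t) with hu
  have huc : Continuous u := S.velc ht
  have hch : ∀ᶠ h in (F : Filter ℝ), ∃ q : ℝ × ℝ, q ∈ Icc 0 (2 * π) ×ˢ Icc 0 (2 * π) ∧
      (n ≠ j ∨ ℓ / 2 ≤ distT q.1 q.2) ∧ ‖p n t q.1 - p j t q.2‖ ≤ D t + h * K ∧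
      inner ℝ (p n t q.1 - p j t q.2) (u (p n t q.1) - u (p j t q.2)) ≤ -κ * ‖p n t q.1 - p j t q.2‖ := by
    filter_upwards [hFn] with h hh
    push Not at hh
    obtain ⟨φ, hφ, ψ, hψ, h1, h2, h3⟩ := hh
    exact ⟨(φ, ψ), ⟨hφ, hψ⟩, h1, h2, h3⟩
  obtain ⟨f, hf⟩ := hch.choice
  obtain ⟨⟨φ, ψ⟩, -, hlim⟩ := (isCompact_Icc.prod isCompact_Icc).ultrafilter_le_nhds (F.map f)
    (le_principal_iff.2 (hf.mono fun h hh => hh.1))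
  have hlim : Tendsto f (F : Filter ℝ) (nhds (φ, ψ)) := hlim
  have hC1 := (S.crv n t ht).cont
  have hC2 := (S.crv j t ht).cont
  have hWc : Continuous fun q : ℝ × ℝ => p n t q.1 - p j t q.2 := by fun_prop
  have hNc : Continuous fun q : ℝ × ℝ => ‖p n t q.1 - p j t q.2‖ := hWc.norm
  have hIc : Continuous fun q : ℝ × ℝ => inner ℝ (p n t q.1 - p j t q.2) (u (p n t q.1) - u (p j t q.2)) := by
    refine hWc.inner ?_
    fun_prop
  have hh0 : Tendsto (fun h : ℝ => D t + h * K) (F : Filter ℝ) (nhds (D t + 0 * K)) := by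
    refine Tendsto.mono_left ?_ (hF.trans nhdsWithin_le_nhds)
    exact (show Continuous fun h : ℝ => D t + h * K by fun_prop).tendsto 0
  have had : n ≠ j ∨ ℓ / 2 ≤ distT φ ψ := by
    by_cases hnj : n = j
    · refine Or.inr (ge_of_tendsto ((distT_cont.tendsto (φ, ψ)).comp hlim) ?_)
      filter_upwards [hf] with h hh
      exact hh.2.1.resolve_left (fun h => h hnj)
    · exact Or.inl hnj
  have hle : ‖p n t φ - p j t ψ‖ ≤ D t := by
    have := le_of_tendsto_of_tendsto ((hNc.tendsto (φ, ψ)).comp hlim) hh0 (hf.mono fun h hh => hh.2.2.1)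
    simpa using this
  have hDp := hDpos t ht
  have heq : ‖p n t φ - p j t ψ‖ = D t := le_antisymm hle
    (hlow _ _ (had.imp id fun h => by linarith))
  have hin : inner ℝ (p n t φ - p j t ψ) (u (p n t φ) - u (p j t ψ)) ≤ -κ * D t := by
    have := le_of_tendsto_of_tendsto ((hIc.tendsto (φ, ψ)).comp hlim)
      (((hNc.tendsto (φ, ψ)).comp hlim).const_mul (-κ)) (hf.mono fun h hh => hh.2.2.2)
    simpa [heq] using this
  have hcrit : inner ℝ (p n t φ - p j t ψ) (p' n t φ) = 0 := by
    have hd : HasDerivAt (fun s => ‖p n t s - p j t ψ‖ ^ 2) (2 * inner ℝ (p n t φ - p j t ψ) (p' n t φ)) φ :=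
      (((S.crv n t ht).der φ).sub_const (p j t ψ)).norm_sq
    have hmin : IsLocalMin (fun s => ‖p n t s - p j t ψ‖ ^ 2) φ := by
      have hev : ∀ᶠ s in nhds φ, n ≠ j ∨ ℓ / 4 ≤ distT s ψ := by
        rcases had with h | h
        · exact Eventually.of_forall fun _ => Or.inl h
        · have hc : Continuous fun s => distT s ψ := distT_cont.comp (Continuous.prodMk_left ψ)
          have := hc.tendsto φ (lt_mem_nhds (show ℓ / 4 < distT φ ψ by linarith))
          filter_upwards [this] with s hs
          exact Or.inr (le_of_lt hs)
      filter_upwards [hev] with s hs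
      rw [heq]
      exact pow_le_pow_left₀ hDp.le (hlow s ψ hs) 2
    have := hmin.hasDerivAt_eq_zero hd
    linarith
  set ν := (D t)⁻¹ • (p n t φ - p j t ψ) with hν
  have hν1 : ‖ν‖ = 1 := by
    rw [hν, norm_smul, heq, Real.norm_of_nonneg (by positivity), inv_mul_cancel₀ hDp.ne']
  have hc := hcore t ht n φ ν hν1 (by rw [hν, real_inner_smul_left, hcrit, mul_zero]) (D t) hDp hDd
  have hDν : D t • ν = p n t φ - p j t ψ := by rw [hν, smul_inv_smul₀ hDp.ne']
  rw [hDν, sub_sub_cancel, hν, real_inner_smul_left, abs_le] at hc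
  have h5 := mul_le_mul_of_nonneg_left hc.1 hDp.le
  rw [mul_inv_cancel_left₀ hDp.ne'] at h5
  have h6 : D t * (C * D t) < D t * κ := by gcongr
  nlinarith

theorem dini (S : Sol α γ T cα M N θ Ω p p' c) {ℓ d1 C d2 c0 : ℝ} {D : ℝ → ℝ} (hℓ : 0 < ℓ)
    (hD : MinD T ℓ d1 p D) (hdd : d1 ≤ d2) (hC : 0 < C)
    (hcore : ∀ t ∈ Ico 0 T, ∀ n ξ (ν : R2), ‖ν‖ = 1 → inner ℝ ν (p' n t ξ) = 0 →
      ∀ d, 0 < d → d ≤ d2 → |inner ℝ ν (gSQGvel α cα θ (fun n => Ω n t) (p n t ξ) -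
        gSQGvel α cα θ (fun n => Ω n t) (p n t ξ - d • ν))| ≤ C * d)
    (hc0 : 0 < c0) (hcl : ∀ n, ∀ t ∈ Ico 0 T, c0 ≤ c n t) (hℓM : M * ℓ ^ γ ≤ c0 / 2)
    (hd1 : d1 ≤ c0 * ℓ / 16) {t : ℝ} (ht : t ∈ Ioo 0 T) {r : ℝ} (hr : C * D t < r) :
    ∀ᶠ h in nhdsWithin (0:ℝ) (Ioi 0), D t - D (t + h) < r * h := by
  have ht' : t ∈ Ico 0 T := ⟨ht.1.le, ht.2⟩
  have hDp := hD.pos t ht'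
  set e := (r - C * D t) / 8 with he
  have he0 : 0 < e := by rw [he]; linarith
  have hr0 : 0 < r := lt_trans (by positivity) hr
  obtain ⟨U, hU0, hU⟩ := S.velbd ht'
  have hkey : ∀ᶠ h in nhdsWithin (0:ℝ) (Ioi 0), ∀ n j, ∀ φ ∈ Icc 0 (2 * π), ∀ ψ ∈ Icc 0 (2 * π),
      (n ≠ j ∨ ℓ / 2 ≤ distT φ ψ) → ‖p n t φ - p j t ψ‖ ≤ D t + h * (2 * U + 2 * e) →
      -(r - 4 * e) * ‖p n t φ - p j t ψ‖ < inner ℝ (p n t φ - p j t ψ)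
        (gSQGvel α cα θ (fun n => Ω n t) (p n t φ) - gSQGvel α cα θ (fun n => Ω n t) (p j t ψ)) :=
    eventually_all.2 fun n => eventually_all.2 fun j =>
      S.dkey (d1 := d1) hℓ hD.pos ht' ((hD.le t ht').trans hdd) hcore n j
        (fun ξ η had => S.wlow hD hc0 hcl hℓM hd1 ht' had) (by linarith)
  filter_upwards [hkey, S.mtch ht he0 (s := ℓ / 4) (by positivity), self_mem_nhdsWithin] with h hkey hm hh
  have hh : 0 < h := hh
  obtain ⟨hth, hm⟩ := hm
  by_contra hcon
  push Not at hcon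
  have hrh : 0 < r * h := by positivity
  rcases hD.att _ hth with h1 | ⟨n, j, ξ, η, had, h1⟩
  · have := hD.le t ht'; linarith
  choose a ha using hm
  obtain ⟨-, φ, hφ, hφe⟩ := ha n ξ
  obtain ⟨-, ψ, hψ, hψe⟩ := ha j η
  set u := gSQGvel α cα θ (fun n => Ω n t) with hu
  have had2 : n ≠ j ∨ ℓ / 2 ≤ distT φ ψ := by
    by_cases hnj : n = j
    · subst hnj
      have h2 := had.resolve_left (fun h => h rfl)
      have h3 := distT_lip ξ η φ ψ
      have h4 : |ξ - φ - (η - ψ)| ≤ ℓ / 2 := by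
        rw [abs_le] at hφ hψ ⊢
        constructor <;> linarith [hφ.1, hφ.2, hψ.1, hψ.2]
      exact Or.inr (by linarith)
    · exact Or.inl hnj
  set x := p n t φ with hx
  set y := p j t ψ with hy
  have hxy : D t ≤ ‖x - y‖ := S.wlow hD hc0 hcl hℓM hd1 ht' (had2.imp id fun h => by linarith)
  -- lower bound for the new distance
  have h2 : ‖(x - y) + h • (u x - u y)‖ ≤ D (t + h) + 2 * e * h := by
    have e1 : (x - y) + h • (u x - u y) = (p n (t + h) ξ - p j (t + h) η) -
      ((p n (t + h) ξ - x - h • u x) - (p j (t + h) η - y - h • u y)) := by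
      rw [smul_sub]; abel
    rw [e1, h1]
    refine (norm_sub_le _ _).trans ?_
    have := norm_sub_le (p n (t + h) ξ - x - h • u x) (p j (t + h) η - y - h • u y)
    linarith
  have h3 : ‖x - y‖ ≤ D t + h * (2 * U + 2 * e) := by
    have e1 : x - y = ((x - y) + h • (u x - u y)) - h • (u x - u y) := by abel
    have h4 : ‖h • (u x - u y)‖ ≤ h * (2 * U) := by
      rw [norm_smul, Real.norm_of_nonneg hh.le]
      refine mul_le_mul_of_nonneg_left ((norm_sub_le _ _).trans ?_) hh.le
      linarith [hU n φ, hU j ψ]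
    have h5 := norm_sub_le ((x - y) + h • (u x - u y)) (h • (u x - u y))
    rw [← e1] at h5
    linarith
  obtain ⟨φ', hφ', k, hk⟩ := redperk φ
  obtain ⟨ψ', hψ', k', hk'⟩ := redperk ψ
  have ex : p n t φ' = x := by rw [hk, (S.crv n t ht').perk]
  have ey : p j t ψ' = y := by rw [hk', (S.crv j t ht').perk]
  have h6 := hkey n j φ' hφ' ψ' hψ' (had2.imp id fun h => h.trans (by
    rw [hk, hk']; exact distT_shift _ _ _ _))
  rw [ex, ey] at h6
  have h7 := h6 h3
  have h8 := real_inner_le_norm (x - y) ((x - y) + h • (u x - u y))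
  rw [inner_add_right, real_inner_self_eq_norm_sq, real_inner_smul_right] at h8
  have hp : 0 < ‖x - y‖ := by linarith
  have h9 := mul_lt_mul_of_pos_left h7 hh
  have h10 := mul_le_mul_of_nonneg_left h2 hp.le
  have h11 : ‖x - y‖ * (‖x - y‖ - (r - 4 * e) * h) < ‖x - y‖ * (D (t + h) + 2 * e * h) := by nlinarith
  have h12 := lt_of_mul_lt_mul_left h11 hp.le
  nlinarith [mul_pos he0 hh]

theorem Dlow (S : Sol α γ T cα M N θ Ω p p' c) {ℓ d1 C d2 c0 : ℝ} {D : ℝ → ℝ} (hℓ : 0 < ℓ)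
    (hD : MinD T ℓ d1 p D) (hdd : d1 ≤ d2) (hC : 0 < C)
    (hcore : ∀ t ∈ Ico 0 T, ∀ n ξ (ν : R2), ‖ν‖ = 1 → inner ℝ ν (p' n t ξ) = 0 →
      ∀ d, 0 < d → d ≤ d2 → |inner ℝ ν (gSQGvel α cα θ (fun n => Ω n t) (p n t ξ) -
        gSQGvel α cα θ (fun n => Ω n t) (p n t ξ - d • ν))| ≤ C * d)
    (hc0 : 0 < c0) (hcl : ∀ n, ∀ t ∈ Ico 0 T, c0 ≤ c n t) (hℓM : M * ℓ ^ γ ≤ c0 / 2)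
    (hd1 : d1 ≤ c0 * ℓ / 16) : ∃ m > 0, ∀ t ∈ Ico 0 T, m ≤ D t := by
  have hT := S.hT
  have hcont := S.contD hD
  have h0 : (0:ℝ) ∈ Ico 0 T := ⟨le_rfl, hT⟩
  have hD0 := hD.pos 0 h0
  have hev := hcont 0 h0 (lt_mem_nhds (show D 0 / 2 < D 0 by linarith))
  obtain ⟨s0, hs0, hsub⟩ := Metric.mem_nhdsWithin_iff.1 hev
  set s := min (s0 / 2) (T / 2) with hs
  have hsp : 0 < s := by positivity
  have hsT : s < T := (min_le_right _ _).trans_lt (by linarith)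
  have hs1 : s < s0 := (min_le_left _ _).trans_lt (by linarith)
  have hsI : s ∈ Ico 0 T := ⟨hsp.le, hsT⟩
  have hDs := hD.pos s hsI
  set L := C + 1 with hL
  refine ⟨min (D 0 / 2) (D s * rexp (-(L * T))), by positivity, ?_⟩
  intro t ht
  rcases le_total t s with hts | hts
  · refine (min_le_left _ _).trans ?_
    have : t ∈ Metric.ball (0:ℝ) s0 ∩ Ico 0 T := by
      refine ⟨?_, ht⟩
      rw [Metric.mem_ball, Real.dist_eq, sub_zero, abs_of_nonneg ht.1]; linarith
    exact le_of_lt (hsub this)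
  · refine (min_le_right _ _).trans ?_
    have hIcc : Icc s t ⊆ Ico 0 T := fun x hx => ⟨hsp.le.trans hx.1, hx.2.trans_lt ht.2⟩
    have hg := image_le_of_liminf_slope_right_lt_deriv_boundary' (f := fun x => -D x)
      (f' := fun x => C * D x) (a := s) (b := t) (B := fun x => -(D s * rexp (L * (s - x))))
      (B' := fun x => L * (D s * rexp (L * (s - x)))) ((hcont.mono hIcc).neg) ?_ ?_ ?_ ?_ ?_
      (right_mem_Icc.2 hts)
    · have h1 : D s * rexp (L * (s - t)) ≤ D t := by linarith
      refine le_trans ?_ h1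
      have : -(L * T) ≤ L * (s - t) := by
        have : 0 < L := by linarith
        nlinarith [ht.2]
      gcongr
    · intro x hx r hr
      have hxI : x ∈ Ioo 0 T := ⟨hsp.trans_le hx.1, hx.2.trans ht.2⟩
      have hd := S.dini hℓ hD hdd hC hcore hc0 hcl hℓM hd1 hxI hr
      have htd : Tendsto (fun z => z - x) (nhdsWithin x (Ioi x)) (nhdsWithin 0 (Ioi 0)) := by
        refine tendsto_nhdsWithin_iff.2 ⟨?_, ?_⟩
        · have := (show Continuous fun z : ℝ => z - x by fun_prop).tendsto x
          rw [sub_self] at this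
          exact this.mono_left nhdsWithin_le_nhds
        · filter_upwards [self_mem_nhdsWithin] with z hz
          exact mem_Ioi.2 (sub_pos.2 (mem_Ioi.1 hz))
      refine Eventually.frequently ?_
      filter_upwards [htd.eventually hd, self_mem_nhdsWithin] with z hz hzx
      have hzx : 0 < z - x := sub_pos.2 hzx
      rw [add_sub_cancel] at hz
      rw [slope_def_field, div_lt_iff₀ hzx]
      linarith
    · simp
    · fun_prop
    · intro x hx
      refine HasDerivAt.hasDerivWithinAt ?_
      have h1 : HasDerivAt (fun x : ℝ => L * (s - x)) (L * (-1)) x :=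
        ((hasDerivAt_id x).const_sub s).const_mul L
      refine ((h1.exp.const_mul (D s)).neg).congr_deriv ?_
      ring
    · intro x hx hfx
      have h1 : D x = D s * rexp (L * (s - x)) := by simpa using hfx
      rw [← h1]
      have := hD.pos x (hIcc ⟨hx.1, hx.2.le⟩)
      rw [hL]; nlinarith

theorem final (S : Sol α γ T cα M N θ Ω p p' c) :
    ∃ C > 0, ∀ t ∈ Ico 0 T, ∀ n j : Fin N, ∀ ξ η, (N:ℝ) * (if n = j then 0 else 1) + distT ξ η ≤
      C * ‖p n t ξ - p j t η‖ := by
  obtain ⟨c0, hc0, hcl⟩ := S.clow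
  obtain ⟨C, hC, d2, hd2, hcore⟩ := S.core
  obtain ⟨ℓ, hℓM, hℓ⟩ := ((rpow_small (A := M) S.γ0 (by positivity : 0 < c0 / 2)).and
    self_mem_nhdsWithin).exists
  replace hℓ : 0 < ℓ := hℓ
  obtain ⟨D, hD⟩ := S.exD hℓ (show 0 < min d2 (c0 * ℓ / 16) by positivity)
  obtain ⟨m, hm, hmD⟩ := S.Dlow hℓ hD (min_le_left _ _) hC hcore hc0 hcl hℓM.le (min_le_right _ _)
  have hpi := Real.pi_pos
  refine ⟨(N + π) / m + 2 / c0, by positivity, ?_⟩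
  intro t ht n j ξ η
  have hnn := norm_nonneg (p n t ξ - p j t η)
  by_cases had : n ≠ j ∨ ℓ ≤ distT ξ η
  · have h1 := (hmD t ht).trans (hD.low t ht n j ξ η had)
    have h2 : (N:ℝ) * (if n = j then 0 else 1) ≤ N := by split_ifs <;> simp
    have h3 := distT_le_pi ξ η
    have h4 : (N + π) / m * m ≤ (N + π) / m * ‖p n t ξ - p j t η‖ := by gcongr
    rw [div_mul_cancel₀ _ hm.ne'] at h4
    have : 0 ≤ 2 / c0 * ‖p n t ξ - p j t η‖ := by positivity
    rw [add_mul]; linarith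
  · push Not at had
    obtain ⟨rfl, hlt⟩ := had
    obtain ⟨k, hk, -⟩ := distT_attained ξ η
    have hCv := S.crv n t ht
    have h1 := hCv.chord S.γ0 (ξ := ξ + 2 * π * k) (η := η) (by
      rw [show ξ + 2 * π * k - η = ξ - η + 2 * π * k by ring, ← hk]
      have h2 := Real.rpow_le_rpow (distT_nonneg ξ η) hlt.le S.γ0.le
      have := mul_le_mul_of_nonneg_left h2 S.hM.le
      linarith [hcl n t ht])
    rw [hCv.perk, show ξ + 2 * π * k - η = ξ - η + 2 * π * k by ring, ← hk] at h1
    have h2 : c0 / 2 * distT ξ η ≤ ‖p n t ξ - p n t η‖ := le_trans (by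
      have := hcl n t ht
      have := distT_nonneg ξ η
      gcongr) h1
    have h3 : distT ξ η ≤ 2 / c0 * ‖p n t ξ - p n t η‖ := by
      rw [div_mul_eq_mul_div, le_div_iff₀ hc0]; linarith
    have : 0 ≤ (N + π) / m * ‖p n t ξ - p n t η‖ := by positivity
    rw [if_pos rfl, add_mul]; linarith

end Sol

/-- (Exponential bound on the approach rate; Remark 1 after Theorem 1.3) Let `α ∈ (0,1/4]`,
`γ = 2α/(1−2α)`, and let `ω = Σ_{n} θₙ χ_{Ωₙ(t)}` be a patch solution to the g-SQG equation
on `ℝ²` on `[0,T)`, `T < ∞`, whose patch boundaries are parameterized by constant-speed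
counterclockwise parameterizations `zₙ(·,t)`, with
`sup_{t∈[0,T)} ‖Ω(t)‖_{C^{1,γ}} < ∞`.  Then
there is `C < ∞` such that for every `t ∈ [0,T)`,
`sup_{(n,ξ)≠(j,η)} (|n−j| + |ξ−η|)/|zₙ(ξ,t) − z_j(η,t)| ≤ C e^{Ct}`: boundaries of distinct
patches and folds of the same patch boundary approach at most exponentially quickly. -/
theorem exponential_approach_bound
    (α γ T cα : ℝ) (N : ℕ) (θ : Fin N → ℝ)
    (Ω : Fin N → ℝ → Set R2) (z : Fin N → ℝ → ℝ → R2)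
    (hα0 : 0 < α) (hα : α ≤ 1 / 4) (hγ : γ = 2 * α / (1 - 2 * α))
    (hT : 0 < T) (hcα : 0 < cα) (hθ : ∀ n, θ n ≠ 0)
    -- each `Ωₙ(t)` is a bounded open set
    (hopen : ∀ n, ∀ t ∈ Ico 0 T, IsOpen (Ω n t))
    (hbdd : ∀ n, ∀ t ∈ Ico 0 T, Bornology.IsBounded (Ω n t))
    -- the boundaries are pairwise disjoint
    (hdisj : ∀ t ∈ Ico 0 T, ∀ n j : Fin N, n ≠ j →
      frontier (Ω n t) ∩ frontier (Ω j t) = ∅)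
    -- `zₙ(·,t)` is a simple closed `C¹` curve parameterizing `∂Ωₙ(t)`
    (hzper : ∀ n, ∀ t ∈ Ico 0 T, ∀ ξ : ℝ, z n (ξ + 2 * π) t = z n ξ t)
    (hzinj : ∀ n, ∀ t ∈ Ico 0 T, InjOn (fun ξ => z n ξ t) (Ico 0 (2 * π)))
    (hzC1 : ∀ n, ∀ t ∈ Ico 0 T, ContDiff ℝ 1 (fun ξ => z n ξ t))
    (hzim : ∀ n, ∀ t ∈ Ico 0 T, (fun ξ => z n ξ t) '' Ico 0 (2 * π) = frontier (Ω n t))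
    -- with constant speed
    (hspeed : ∀ n, ∀ t ∈ Ico 0 T, ∃ c : ℝ, 0 < c ∧
      ∀ ξ : ℝ, ‖deriv (fun ζ => z n ζ t) ξ‖ = c)
    -- counterclockwise (positive signed area)
    (hccw : ∀ n, ∀ t ∈ Ico 0 T,
      0 < ∫ ξ in (0:ℝ)..(2 * π),
        (z n ξ t 0 * (deriv (fun ζ => z n ζ t) ξ) 1
          - z n ξ t 1 * (deriv (fun ζ => z n ζ t) ξ) 0))
    -- each boundary is continuous in time w.r.t. Hausdorff distance
    (hHaus : ∀ n, ∀ t₀ ∈ Ico 0 T,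
      Tendsto (fun t => Metric.hausdorffDist (frontier (Ω n t)) (frontier (Ω n t₀)))
        (nhdsWithin t₀ (Ico 0 T)) (nhds 0))
    -- patch solution: `lim_{h→0} d_H(∂Ω(t+h), X^h_{u(·,t)}[∂Ω(t)])/h = 0`
    (hpatch : ∀ t ∈ Ioo 0 T,
      Tendsto (fun h =>
          Metric.hausdorffDist (⋃ n, frontier (Ω n (t + h)))
            ((fun x => x + h • gSQGvel α cα θ (fun n => Ω n t) x) ''
              ⋃ n, frontier (Ω n t)) / |h|)
        (nhdsWithin 0 {h : ℝ | t + h ∈ Ico 0 T ∧ h ≠ 0}) (nhds 0))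
    -- uniform `C^{1,γ}` bound on the patch boundaries
    (hC1γ : ∃ M : ℝ, ∀ n, ∀ t ∈ Ico 0 T, ∀ ξ η : ℝ,
      ‖z n ξ t‖ ≤ M ∧ ‖deriv (fun ζ => z n ζ t) ξ‖ ≤ M ∧
        ‖deriv (fun ζ => z n ζ t) ξ - deriv (fun ζ => z n ζ t) η‖ ≤ M * |ξ - η| ^ γ) :
    -- conclusion: the arc-chord ratio stays uniformly bounded up to time `T`
    ∃ C : ℝ, ∀ t ∈ Ico 0 T, ∀ n j : Fin N, ∀ ξ η : ℝ, (n ≠ j ∨ distT ξ η ≠ 0) →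
      (|((n : ℕ) : ℤ) - ((j : ℕ) : ℤ)| : ℝ) + distT ξ η ≤
        C * Real.exp (C * t) * ‖z n ξ t - z j η t‖ := by
  have hpi := Real.pi_pos
  obtain ⟨M0, hM0⟩ := hC1γ
  choose! c hc hsp using hspeed
  have S : Sol α γ T cα (max M0 1) N θ Ω (fun n t ξ => z n ξ t)
      (fun n t ξ => deriv (fun ζ => z n ζ t) ξ) c := by
    have hM : 0 < max M0 1 := lt_max_of_lt_right one_pos
    refine ⟨hα0, hα, hγ, hT, hcα, hM, ?_, hc, ?_, ?_, ?_, ?_, hHaus, hpatch⟩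
    · intro n t ht
      refine ⟨fun ξ => ?_, hzper n t ht, hsp n t ht, fun ξ => ?_, ?_, fun ξ η => ?_⟩
      · exact ((hzC1 n t ht).differentiable one_ne_zero ξ).hasDerivAt
      · exact (hM0 n t ht ξ ξ).1.trans (le_max_left _ _)
      · rw [← hsp n t ht 0]; exact (hM0 n t ht 0 0).2.1.trans (le_max_left _ _)
      · exact (hM0 n t ht ξ η).2.2.trans (mul_le_mul_of_nonneg_right (le_max_left _ _)
          (Real.rpow_nonneg (abs_nonneg _) _))
    · intro n t ht ξ η he
      have hP : Function.Periodic (fun ξ => z n ξ t) (2 * π) := hzper n t ht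
      have h2 : (0:ℝ) < 2 * π := by positivity
      have m1 := toIcoMod_mem_Ico h2 0 ξ
      have m2 := toIcoMod_mem_Ico h2 0 η
      rw [zero_add] at m1 m2
      have v1 : z n (toIcoMod h2 0 ξ) t = z n ξ t := hP.sub_zsmul_eq (toIcoDiv h2 0 ξ)
      have v2 : z n (toIcoMod h2 0 η) t = z n η t := hP.sub_zsmul_eq (toIcoDiv h2 0 η)
      have h3 : toIcoMod h2 0 ξ = toIcoMod h2 0 η := hzinj n t ht m1 m2 (by
        simp only; rw [v1, v2]; exact he)
      have h4 := distT_le ξ η (toIcoDiv h2 0 η - toIcoDiv h2 0 ξ)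
      rw [toIcoMod, toIcoMod, zsmul_eq_mul, zsmul_eq_mul] at h3
      have h5 : ξ - η + 2 * π * ((toIcoDiv h2 0 η - toIcoDiv h2 0 ξ : ℤ) : ℝ) = 0 := by
        push_cast; linarith
      rw [h5, abs_zero] at h4
      exact le_antisymm h4 (distT_nonneg _ _)
    · intro n t ht
      refine ⟨hopen n t ht, hbdd n t ht, ?_⟩
      rw [← hzim n t ht]
      have hP : Function.Periodic (fun ξ => z n ξ t) (2 * π) := hzper n t ht
      refine Subset.antisymm ?_ (image_subset_range _ _)
      rintro _ ⟨ξ, rfl⟩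
      obtain ⟨y, hy, hye⟩ := hP.exists_mem_Ico₀ (by positivity) ξ
      exact ⟨y, hy, hye.symm⟩
    · intro n t ht
      exact hccw n t ht
    · intro t ht n j hnj ξ η he
      have hfr : ∀ n ξ, z n ξ t ∈ frontier (Ω n t) := fun n ξ => by
        obtain ⟨y, hy, hye⟩ := (show Function.Periodic (fun ξ => z n ξ t) (2 * π) from
          hzper n t ht).exists_mem_Ico₀ (by positivity) ξ
        rw [← hzim n t ht]
        exact ⟨y, hy, hye.symm⟩
      have h1 : z n ξ t ∈ frontier (Ω n t) ∩ frontier (Ω j t) :=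
        ⟨hfr n ξ, by have := hfr j η; rwa [← he] at this⟩
      rw [hdisj t ht n j hnj] at h1
      exact h1
  obtain ⟨C, hC, hfin⟩ := S.final
  refine ⟨C, fun t ht n j ξ η _ => ?_⟩
  have h1 := hfin t ht n j ξ η
  have h2 : (|((n : ℕ) : ℤ) - ((j : ℕ) : ℤ)| : ℝ) ≤ (N:ℝ) * (if n = j then 0 else 1) := by
    split_ifs with hnj
    · subst hnj; simp
    · have := n.2; have := j.2
      rw [mul_one, abs_le]
      have a1 : ((n : ℕ) : ℝ) ≤ N := by exact_mod_cast n.2.le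
      have a2 : ((j : ℕ) : ℝ) ≤ N := by exact_mod_cast j.2.le
      have a3 : (0:ℝ) ≤ ((n : ℕ) : ℝ) := by positivity
      have a4 : (0:ℝ) ≤ ((j : ℕ) : ℝ) := by positivity
      push_cast
      constructor <;> linarith
  have h3 : C ≤ C * Real.exp (C * t) := le_mul_of_one_le_right hC.le
    (Real.one_le_exp (mul_nonneg hC.le ht.1))
  exact (add_le_add h2 le_rfl).trans (h1.trans (mul_le_mul_of_nonneg_right h3 (norm_nonneg _)))

end
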